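/- Let q ∈ {2, 3, 4, 5, 7, 8, 9, 11, 13, 16, 17, 19} and let n ≥ 5 be a natural number. There exists a primitive 2-normal element in F_{q^n} over F_q if and only if gcd(q^3 − q, n) ≠ 1. -/

import Mathlib

open Polynomial

noncomputable section

/-- An element of a finite field is *primitive* if it generates the cyclic multiplicative
group, i.e. its multiplicative order is `card E - 1`. -/
def IsPrimitiveElem {E : Type*} [Field E] [Fintype E] (α : E) : Prop :=
  orderOf α = Fintype.card E - 1

/-- The polynomial `g_α(x) = Σ_{i=0}^{n-1} α^{q^i} x^{n-1-i} ∈ F_{q^n}[x]`. -/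
def gPoly {E : Type*} [Field E] (q n : ℕ) (α : E) : Polynomial E :=
  ∑ i ∈ Finset.range n, C (α ^ q ^ i) * X ^ (n - 1 - i)

/-- `α ∈ F_{q^n}` is `k`-normal over `F_q` if `gcd(x^n - 1, g_α(x))` in `F_{q^n}[x]`
has degree `k`. -/
def IsKNormal {E : Type*} [Field E] (q n k : ℕ) (α : E) : Prop :=
  (@EuclideanDomain.gcd (Polynomial E) _ (Classical.decEq _)
    ((X : Polynomial E) ^ n - 1) (gPoly q n α)).natDegree = k

/-- A nontrivial character correlates with its translates as a random function would. -/
theorem sum_mulChar_mul_inv_add {E : Type*} [Field E] [Fintype E] (χ : MulChar E ℂ) (hχ : χ ≠ 1)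
    (y z : E) (hyz : y ≠ z) : ∑ x, χ (x + y) * χ⁻¹ (x + z) = -1 := by
  have hd : y - z ≠ 0 := sub_ne_zero.mpr hyz
  let e : E ≃ E := (Equiv.mulLeft₀ (-(y - z)) (neg_ne_zero.mpr hd)).trans (Equiv.subRight z)
  rw [← Equiv.sum_comp e]
  have h : ∀ t, χ (e t + y) * χ⁻¹ (e t + z) = χ⁻¹ (-1) * (χ⁻¹ t * χ (1 - t)) := by
    intro t
    have h1 : e t + y = (y - z) * (1 - t) := by simp [e]; ring
    have h2 : e t + z = (-1) * ((y - z) * t) := by simp [e]; ring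
    have h3 : χ (y - z) * χ⁻¹ (y - z) = 1 := by
      rw [← MulChar.mul_apply, mul_inv_cancel, MulChar.one_apply (Ne.isUnit hd)]
    rw [h1, h2, map_mul, map_mul, map_mul]
    linear_combination χ⁻¹ (-1) * (χ⁻¹ t * χ (1 - t)) * h3
  rw [Finset.sum_congr rfl fun t _ => h t, ← Finset.mul_sum]
  have h4 := jacobiSum_nontrivial_inv (inv_ne_one.mpr hχ)
  rw [inv_inv, jacobiSum] at h4
  rw [h4, mul_neg, ← map_mul]
  simp

/-- Square-root cancellation for multiplicative characters over additive subgroups. -/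
theorem norm_sum_mulChar_addSubgroup_le {E : Type*} [Field E] [Fintype E] (χ : MulChar E ℂ)
    (hχ : χ ≠ 1) (U : AddSubgroup E) [Fintype U] :
    ‖∑ u : U, χ u‖ ≤ √(Fintype.card E) := by
  classical
  set S := ∑ u : U, χ u with hS
  have hstar : ∀ x, (starRingEnd ℂ) (χ x) = χ⁻¹ x := fun x => MulChar.star_apply' χ x
  have key : (∑ x : E, ‖∑ u : U, χ (x + u)‖ ^ 2 : ℝ) =
      Fintype.card U * ((Fintype.card E : ℝ) - Fintype.card U) := by
    have hsq : ∀ x : E, ((‖∑ u : U, χ (x + u)‖ ^ 2 : ℝ) : ℂ) =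
        ∑ u : U, ∑ v : U, χ (x + u) * χ⁻¹ (x + v) := by
      intro x
      rw [Complex.ofReal_pow, ← Complex.mul_conj', map_sum, Finset.sum_mul_sum]
      simp_rw [hstar]
    have : ((∑ x : E, ‖∑ u : U, χ (x + u)‖ ^ 2 : ℝ) : ℂ) =
        Fintype.card U * ((Fintype.card E : ℂ) - Fintype.card U) := by
      rw [Complex.ofReal_sum, Finset.sum_congr rfl fun x _ => hsq x, Finset.sum_comm]
      have h1 : ∀ u : U, ∑ x : E, ∑ v : U, χ (x + u) * χ⁻¹ (x + v) =
          (Fintype.card E : ℂ) - Fintype.card U := by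
        intro u
        rw [Finset.sum_comm]
        have h2 : ∀ v : U, ∑ x : E, χ (x + u) * χ⁻¹ (x + v) =
            -1 + if v = u then (Fintype.card E : ℂ) else 0 := by
          intro v
          split_ifs with h
          · subst h
            simp_rw [← MulChar.mul_apply, mul_inv_cancel]
            have := Equiv.sum_comp (Equiv.addRight (v : E)) fun x => (1 : MulChar E ℂ) x
            simp only [Equiv.coe_addRight] at this
            rw [this, MulChar.sum_one_eq_card_units, Fintype.card_units,
              Nat.cast_sub Fintype.card_pos]
            push_cast; ring
          · rw [sum_mulChar_mul_inv_add χ hχ _ _ fun h' => h (Subtype.ext h'.symm)]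
            ring
        rw [Finset.sum_congr rfl fun v _ => h2 v, Finset.sum_add_distrib]
        simp; ring
      rw [Finset.sum_congr rfl fun u _ => h1 u]
      simp [mul_sub]
    exact_mod_cast this
  have hle : (Fintype.card U : ℝ) * ‖S‖ ^ 2 ≤ ∑ x : E, ‖∑ u : U, χ (x + u)‖ ^ 2 := by
    have h1 : ∀ x : U, ∑ u : U, χ ((x : E) + u) = S := fun x => by
      rw [hS, ← Equiv.sum_comp (Equiv.addLeft x) fun u : U => χ u]; simp
    calc (Fintype.card U : ℝ) * ‖S‖ ^ 2 = ∑ x : U, ‖∑ u : U, χ ((x : E) + u)‖ ^ 2 := by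
          simp_rw [h1]; simp
      _ ≤ _ := by
          have := Finset.sum_le_sum_of_subset_of_nonneg
            (f := fun x : E => ‖∑ u : U, χ (x + u)‖ ^ 2)
            (Finset.subset_univ (Finset.univ.image ((↑) : U → E))) fun _ _ _ => by positivity
          rwa [Finset.sum_image fun a _ b _ h => Subtype.ext h] at this
  have hpos : (0 : ℝ) < Fintype.card U := by exact_mod_cast Fintype.card_pos
  refine Real.le_sqrt_of_sq_le ?_
  rw [key] at hle
  have := le_of_mul_le_mul_left hle hpos
  linarith

/-- The difference between `1` and the average of the nontrivial powers of `η`; it vanishes on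
`r`-th powers when `η` has order `r`. -/
def nonpowerWeight {E : Type*} [Field E] (r : ℕ) (η : MulChar E ℂ) (x : E) : ℂ :=
  1 - (∑ j ∈ Finset.Ico 1 r, (η ^ j) x) / (r - 1)

theorem nonpowerWeight_pow {E : Type*} [Field E] {r : ℕ} (hr : 2 ≤ r) {η : MulChar E ℂ}
    (hη : orderOf η = r) {y : E} (hy : y ≠ 0) : nonpowerWeight r η (y ^ r) = 0 := by
  have h : ∀ j, (η ^ j) (y ^ r) = 1 := by
    intro j
    have hr0 : r ≠ 0 := by omega
    rw [map_pow, ← MulChar.pow_apply' _ hr0, ← pow_mul, mul_comm, pow_mul, ← hη,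
      pow_orderOf_eq_one, one_pow, MulChar.one_apply (Ne.isUnit hy)]
  have : ((r : ℂ) - 1) ≠ 0 := by
    rw [sub_ne_zero]; exact_mod_cast (by omega : r ≠ 1)
  simp [nonpowerWeight, h, Nat.cast_sub (show 1 ≤ r by omega), this]

theorem norm_sum_mul_nonpowerWeight_le {E : Type*} [Field E] [Fintype E] (G : Finset E)
    (h0 : (0 : E) ∉ G) (B : ℝ) (hB : ∀ χ : MulChar E ℂ, χ ≠ 1 → ‖∑ x ∈ G, χ x‖ ≤ B)
    (η : ℕ → MulChar E ℂ) (T : Finset ℕ) (hT : ∀ r ∈ T, r.Prime)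
    (hη : ∀ r ∈ T, orderOf (η r) = r) (χ : MulChar E ℂ)
    (hχ : ∀ r ∈ T, (orderOf χ).Coprime r) :
    (χ ≠ 1 → ‖∑ x ∈ G, χ x * ∏ r ∈ T, nonpowerWeight r (η r) x‖ ≤ 2 ^ T.card * B) ∧
    (χ = 1 → ‖∑ x ∈ G, χ x * ∏ r ∈ T, nonpowerWeight r (η r) x - G.card‖ ≤
      (2 ^ T.card - 1) * B) := by
  classical
  induction T using Finset.induction_on generalizing χ with
  | empty =>
    refine ⟨fun h => by simpa using hB χ h, fun h => ?_⟩
    subst h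
    have : ∑ x ∈ G, (1 : MulChar E ℂ) x = G.card := by
      rw [Finset.sum_congr rfl fun x hx =>
        MulChar.one_apply (Ne.isUnit fun h => h0 (h ▸ hx) : IsUnit x)]
      simp
    simp [this]
  | insert r T hr ih =>
    have hT' : ∀ s ∈ T, s.Prime := fun s hs => hT s (Finset.mem_insert_of_mem hs)
    have hη' : ∀ s ∈ T, orderOf (η s) = s := fun s hs => hη s (Finset.mem_insert_of_mem hs)
    have hχ' : ∀ s ∈ T, (orderOf χ).Coprime s := fun s hs => hχ s (Finset.mem_insert_of_mem hs)
    have hrp := hT r (Finset.mem_insert_self _ _)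
    have hr2 := hrp.two_le
    have hηr := hη r (Finset.mem_insert_self _ _)
    have hχr := hχ r (Finset.mem_insert_self _ _)
    have hr1 : (0 : ℝ) < (r : ℝ) - 1 := by
      have : (2 : ℝ) ≤ r := by exact_mod_cast hr2
      linarith
    have hr1' : ‖(r : ℂ) - 1‖ = (r : ℝ) - 1 := by
      have : ((r : ℂ) - 1) = (((r : ℝ) - 1 : ℝ) : ℂ) := by push_cast; rfl
      rw [this, Complex.norm_real, Real.norm_of_nonneg hr1.le]
    have expand : ∑ x ∈ G, χ x * ∏ s ∈ insert r T, nonpowerWeight s (η s) x =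
        ∑ x ∈ G, χ x * ∏ s ∈ T, nonpowerWeight s (η s) x -
        (∑ j ∈ Finset.Ico 1 r, ∑ x ∈ G,
          (χ * η r ^ j) x * ∏ s ∈ T, nonpowerWeight s (η s) x) / (r - 1) := by
      rw [Finset.sum_comm, Finset.sum_div, ← Finset.sum_sub_distrib]
      refine Finset.sum_congr rfl fun x _ => ?_
      rw [Finset.prod_insert hr, nonpowerWeight]
      simp_rw [MulChar.mul_apply]
      rw [← Finset.sum_mul, ← Finset.mul_sum]
      ring
    have tail : ‖(∑ j ∈ Finset.Ico 1 r, ∑ x ∈ G,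
        (χ * η r ^ j) x * ∏ s ∈ T, nonpowerWeight s (η s) x) / ((r : ℂ) - 1)‖ ≤
          2 ^ T.card * B := by
      rw [norm_div, hr1', div_le_iff₀ hr1]
      have : ∀ j ∈ Finset.Ico 1 r, ‖∑ x ∈ G,
          (χ * η r ^ j) x * ∏ s ∈ T, nonpowerWeight s (η s) x‖ ≤ 2 ^ T.card * B := by
        intro j hj
        rw [Finset.mem_Ico] at hj
        refine (ih hT' hη' (χ * η r ^ j) fun s hs => ?_).1 fun h => ?_
        · have hne : r ≠ s := fun h => hr (h ▸ hs)
          have h1 : orderOf (η r ^ j) ∣ r := by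
            rw [orderOf_dvd_iff_pow_eq_one, ← pow_mul, mul_comm, pow_mul]
            nth_rw 2 [← hηr]
            rw [pow_orderOf_eq_one, one_pow]
          have h2 := (Commute.all χ (η r ^ j)).orderOf_mul_dvd_mul_orderOf
          exact Nat.Coprime.of_dvd_left h2 (Nat.Coprime.mul_left (hχ' s hs)
            (Nat.Coprime.of_dvd_left h1 ((Nat.coprime_primes hrp (hT' s hs)).mpr hne)))
        · have h1 : η r ^ (j * orderOf χ) = 1 := by
            have h2 : (χ * η r ^ j) ^ orderOf χ = 1 := by rw [h, one_pow]
            rwa [mul_pow, pow_orderOf_eq_one, one_mul, ← pow_mul] at h2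
          rw [← orderOf_dvd_iff_pow_eq_one, hηr] at h1
          have := Nat.le_of_dvd (by omega) (hχr.symm.dvd_of_dvd_mul_right h1)
          omega
      refine (norm_sum_le _ _).trans ((Finset.sum_le_sum this).trans ?_)
      simp [Nat.cast_sub (show 1 ≤ r by omega)]
      linarith
    rw [expand, Finset.card_insert_of_notMem hr, pow_succ]
    obtain ⟨ih1, ih2⟩ := ih hT' hη' χ hχ'
    refine ⟨fun h => ?_, fun h => ?_⟩
    · refine (norm_sub_le _ _).trans ?_
      have := ih1 h
      linarith
    · rw [sub_right_comm]
      refine (norm_sub_le _ _).trans ?_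
      have := ih2 h
      linarith

theorem exists_prime_pow_of_orderOf_ne {E : Type*} [Field E] [Fintype E] {x : E} (hx : x ≠ 0)
    (ho : orderOf x ≠ Fintype.card E - 1) :
    ∃ r ∈ (Fintype.card E - 1).primeFactors, ∃ y : E, y ≠ 0 ∧ y ^ r = x := by
  classical
  obtain ⟨u, rfl⟩ := Ne.isUnit hx
  obtain ⟨g, hg⟩ := IsCyclic.exists_ofOrder_eq_natCard (α := Eˣ)
  rw [Nat.card_eq_fintype_card, Fintype.card_units] at hg
  have hM : 0 < Fintype.card E - 1 := Nat.sub_pos_of_lt Fintype.one_lt_card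
  have hgen : ∀ v : Eˣ, v ∈ Subgroup.zpowers g := by
    intro v
    have : Subgroup.zpowers g = ⊤ := by
      rw [← Subgroup.card_eq_iff_eq_top, Nat.card_zpowers, hg, Nat.card_eq_fintype_card,
        Fintype.card_units]
    rw [this]; trivial
  obtain ⟨k, rfl⟩ := (mem_zpowers_iff_mem_range_orderOf.mp (hgen u)) |> Finset.mem_image.mp |>
    fun ⟨k, _, h⟩ => (⟨k, h⟩ : ∃ k, g ^ k = u)
  rw [orderOf_units, orderOf_pow, hg] at ho
  have hgcd : Nat.gcd (Fintype.card E - 1) k ≠ 1 := fun h => ho (by rw [h, Nat.div_one])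
  obtain ⟨r, hr, hrd⟩ := Nat.exists_prime_and_dvd hgcd
  obtain ⟨l, rfl⟩ := hrd.trans (Nat.gcd_dvd_right _ _)
  refine ⟨r, Nat.mem_primeFactors.mpr ⟨hr, hrd.trans (Nat.gcd_dvd_left _ _), hM.ne'⟩,
    (g ^ l : Eˣ), Units.ne_zero _, ?_⟩
  rw [← Units.val_pow_eq_pow_val, ← pow_mul, mul_comm]

/-- A set on which all nontrivial characters have small sums contains a generator of the
multiplicative group. -/
theorem exists_primitive_mem {E : Type*} [Field E] [Fintype E] (G : Finset E)
    (h0 : (0 : E) ∉ G) (B : ℝ) (hB : ∀ χ : MulChar E ℂ, χ ≠ 1 → ‖∑ x ∈ G, χ x‖ ≤ B)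
    (hB0 : 0 ≤ B) (hG : 2 ^ (Fintype.card E - 1).primeFactors.card * B < G.card) :
    ∃ x ∈ G, orderOf x = Fintype.card E - 1 := by
  classical
  set T := (Fintype.card E - 1).primeFactors with hTdef
  have hT : ∀ r ∈ T, r.Prime := fun r hr => Nat.prime_of_mem_primeFactors hr
  have hex : ∀ r : ℕ, ∃ η : MulChar E ℂ, r ∈ T → orderOf η = r := by
    intro r
    by_cases hr : r ∈ T
    · obtain ⟨η, hη⟩ := MulChar.exists_mulChar_orderOf E (Nat.dvd_of_mem_primeFactors hr)
        (Complex.isPrimitiveRoot_exp r (hT r hr).ne_zero)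
      exact ⟨η, fun _ => hη⟩
    · exact ⟨1, fun h => absurd h hr⟩
  choose η hη using hex
  by_contra! hno
  have hzero : ∀ x ∈ G, (1 : MulChar E ℂ) x * ∏ r ∈ T, nonpowerWeight r (η r) x = 0 := by
    intro x hx
    have hx0 : x ≠ 0 := fun h => h0 (h ▸ hx)
    obtain ⟨r, hr, y, hy, rfl⟩ := exists_prime_pow_of_orderOf_ne hx0 (hno x hx)
    rw [Finset.prod_eq_zero hr (nonpowerWeight_pow (hT r hr).two_le (hη r hr) hy), mul_zero]
  have := (norm_sum_mul_nonpowerWeight_le G h0 B hB η T hT hη 1 fun r _ => by simp).2 rfl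
  rw [Finset.sum_eq_zero hzero, zero_sub, norm_neg, Complex.norm_natCast] at this
  linarith

section Frobenius

variable (K : Type*) [Field K] [Fintype K] (E : Type*) [Field E] [Fintype E] [Algebra K E]

/-- The Frobenius of `E` over `K`, as a `K`-linear map. -/
abbrev frobeniusLinear : E →ₗ[K] E := (FiniteField.frobeniusAlgHom K E).toLinearMap

/-- The elements of `E` annihilated by `a`, for `K[X]` acting through the Frobenius. -/
abbrev frobeniusKer (a : K[X]) : Submodule K E := LinearMap.ker (aeval (frobeniusLinear K E) a)

theorem aeval_frobeniusLinear_X_pow_sub_one :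
    aeval (frobeniusLinear K E) (X ^ Module.finrank K E - 1 : K[X]) = 0 := by
  rw [← FiniteField.minpoly_frobeniusAlgHom K E]
  exact minpoly.aeval _ _

variable {K E}

omit [Fintype E] in
theorem frobeniusLinear_pow_apply (i : ℕ) (x : E) :
    (frobeniusLinear K E ^ i) x = x ^ Fintype.card K ^ i := by
  rw [Module.End.pow_apply]
  change (⇑(FiniteField.frobeniusAlgHom K E))^[i] x = _
  rw [FiniteField.coe_frobeniusAlgHom, pow_iterate]

theorem finrank_frobeniusKer_le {a : K[X]} (ha : a ≠ 0) :
    Module.finrank K (frobeniusKer K E a) ≤ a.natDegree := by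
  classical
  have hq := Fintype.one_lt_card (α := K)
  let P : E[X] := ∑ i ∈ Finset.range (a.natDegree + 1),
    C (algebraMap K E (a.coeff i)) * X ^ Fintype.card K ^ i
  have hinj : ∀ i j, Fintype.card K ^ i = Fintype.card K ^ j → i = j := fun i j h =>
    Nat.pow_right_injective hq h
  have hP : P ≠ 0 := by
    intro h
    have h1 : P.coeff (Fintype.card K ^ a.natDegree) = algebraMap K E a.leadingCoeff := by
      simp only [P, finsetSum_coeff, coeff_C_mul, coeff_X_pow]
      rw [Finset.sum_eq_single a.natDegree]
      · simp
      · intro i _ hi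
        rw [if_neg fun h => hi (hinj _ _ h).symm, mul_zero]
      · simp
    rw [h, coeff_zero, eq_comm, map_eq_zero] at h1
    exact ha (leadingCoeff_eq_zero.mp h1)
  have hdeg : P.natDegree ≤ Fintype.card K ^ a.natDegree := by
    refine natDegree_sum_le_of_forall_le _ _ fun i hi => (natDegree_C_mul_X_pow_le _ _).trans ?_
    exact Nat.pow_le_pow_right hq.le (Nat.lt_succ_iff.mp (Finset.mem_range.mp hi))
  have heval : ∀ x : E, P.eval x = aeval (frobeniusLinear K E) a x := by
    intro x
    rw [aeval_eq_sum_range, LinearMap.sum_apply, eval_finsetSum]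
    refine Finset.sum_congr rfl fun i _ => ?_
    rw [LinearMap.smul_apply, frobeniusLinear_pow_apply, Algebra.smul_def]
    simp
  have hcard : Fintype.card (frobeniusKer K E a) ≤ Fintype.card K ^ a.natDegree := by
    rw [Fintype.card_of_subtype (Finset.univ.filter fun x => x ∈ frobeniusKer K E a) (by simp)]
    refine (Polynomial.card_le_degree_of_subset_roots (p := P) fun x hx => ?_).trans hdeg
    simp only [Finset.mem_val, Finset.mem_filter, Finset.mem_univ, true_and,
      LinearMap.mem_ker] at hx
    rw [mem_roots hP, IsRoot, heval, hx]
  rw [Module.card_eq_pow_finrank (K := K)] at hcard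
  exact (Nat.pow_le_pow_iff_right hq).mp hcard

theorem finrank_frobeniusKer {a b : K[X]} (hab : a * b = X ^ Module.finrank K E - 1) :
    Module.finrank K (frobeniusKer K E a) = a.natDegree := by
  have hne : (X ^ Module.finrank K E - 1 : K[X]) ≠ 0 :=
    (monic_X_pow_sub_C 1 Module.finrank_pos.ne').ne_zero
  have ha : a ≠ 0 := by rintro rfl; exact hne (by rw [← hab, zero_mul])
  have hb : b ≠ 0 := by rintro rfl; exact hne (by rw [← hab, mul_zero])
  have hd : a.natDegree + b.natDegree = Module.finrank K E := by
    rw [← natDegree_mul ha hb, hab]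
    exact natDegree_X_pow_sub_C
  refine le_antisymm (finrank_frobeniusKer_le ha) ?_
  have h1 := LinearMap.finrank_range_add_finrank_ker (aeval (frobeniusLinear K E) b)
  have h2 := finrank_frobeniusKer_le (E := E) hb
  have h3 : LinearMap.range (aeval (frobeniusLinear K E) b) ≤ frobeniusKer K E a := by
    rw [LinearMap.range_le_ker_iff]
    change aeval (frobeniusLinear K E) a * aeval (frobeniusLinear K E) b = 0
    rw [← map_mul, hab, aeval_frobeniusLinear_X_pow_sub_one]
  have h4 := Submodule.finrank_mono h3
  change _ + Module.finrank K (frobeniusKer K E b) = _ at h1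
  omega

theorem card_frobeniusKer {a : K[X]} (ha : a ∣ X ^ Module.finrank K E - 1)
    [Fintype (frobeniusKer K E a)] :
    Fintype.card (frobeniusKer K E a) = Fintype.card K ^ a.natDegree := by
  obtain ⟨b, hb⟩ := ha
  rw [Module.card_eq_pow_finrank (K := K), finrank_frobeniusKer hb.symm]

/-- The annihilator of `x` for `K[X]` acting through the Frobenius has a generator. -/
theorem exists_frobeniusOrder (x : E) :
    ∃ m : K[X], ∀ a : K[X], x ∈ frobeniusKer K E a ↔ m ∣ a := by
  let I : Ideal K[X] :=
    { carrier := {a | aeval (frobeniusLinear K E) a x = 0}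
      add_mem' := fun {a b} ha hb => by
        simp only [Set.mem_ofPred_eq] at ha hb ⊢
        rw [map_add, LinearMap.add_apply, ha, hb, add_zero]
      zero_mem' := by simp
      smul_mem' := fun c a ha => by
        simp only [Set.mem_ofPred_eq] at ha ⊢
        rw [smul_eq_mul, map_mul, Module.End.mul_apply, ha, map_zero] }
  refine ⟨Submodule.IsPrincipal.generator I, fun a => ?_⟩
  rw [← Submodule.IsPrincipal.mem_iff_generator_dvd]
  rfl

omit [Fintype K] in
theorem prod_dvd_of_monic_irreducible {g : K[X]} (T : Finset K[X])
    (hT : ∀ h ∈ T, Monic h ∧ Irreducible h ∧ h ∣ g) : ∏ h ∈ T, h ∣ g := by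
  refine Finset.prod_dvd_of_isRelPrime (fun a ha b hb hab => ?_) fun h hh => (hT h hh).2.2
  refine ((hT a ha).2.1.isRelPrime_iff_not_dvd).mpr fun hdvd => hab ?_
  exact eq_of_monic_of_associated (hT a ha).1 (hT b hb).1
    ((hT a ha).2.1.associated_of_dvd (hT b hb).2.1 hdvd)

theorem mem_frobeniusKer_prod_iff {g : K[X]} (hg : g ≠ 0) (T : Finset K[X])
    (hT : ∀ h ∈ T, Monic h ∧ Irreducible h ∧ h ∣ g) (x : E) :
    (x ∈ frobeniusKer K E g ∧ ∀ h ∈ T, x ∈ frobeniusKer K E (g / h)) ↔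
      x ∈ frobeniusKer K E (g / ∏ h ∈ T, h) := by
  obtain ⟨m, hm⟩ := exists_frobeniusOrder (K := K) x
  simp_rw [hm]
  have key : ∀ h : K[X], h ∣ g → (m ∣ g / h ↔ m * h ∣ g) := by
    rintro h ⟨c, rfl⟩
    have hh : h ≠ 0 := left_ne_zero_of_mul hg
    rw [mul_div_cancel_left₀ _ hh, mul_comm m, mul_dvd_mul_iff_left hh]
  have hprod : ∏ h ∈ T, h ∣ g := prod_dvd_of_monic_irreducible T hT
  rw [key _ hprod]
  constructor
  · rintro ⟨⟨c, rfl⟩, h2⟩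
    have hm0 : m ≠ 0 := left_ne_zero_of_mul hg
    refine mul_dvd_mul_left m (prod_dvd_of_monic_irreducible T fun h hh =>
      ⟨(hT h hh).1, (hT h hh).2.1, ?_⟩)
    have := (key h (hT h hh).2.2).mp (h2 h hh)
    exact (mul_dvd_mul_iff_left hm0).mp this
  · intro h
    refine ⟨(dvd_mul_right _ _).trans h, fun a ha => (key a (hT a ha).2.2).mpr ?_⟩
    exact (mul_dvd_mul_left m (Finset.dvd_prod_of_mem (fun h => h) ha)).trans h

open Classical in
/-- The elements of `E` annihilated by `g` but by no `g / h` with `h ∈ H`. -/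
def frobeniusOrderSet (K : Type*) [Field K] [Fintype K] (E : Type*) [Field E] [Fintype E]
    [Algebra K E] (g : K[X]) (H : Finset K[X]) : Finset E :=
  Finset.univ.filter fun x => x ∈ frobeniusKer K E g ∧ ∀ h ∈ H, x ∉ frobeniusKer K E (g / h)

open Classical in
theorem sum_frobeniusOrderSet {g : K[X]} (hg : g ≠ 0) (H : Finset K[X])
    (hH : ∀ h ∈ H, Monic h ∧ Irreducible h ∧ h ∣ g) (f : E → ℂ) :
    ∑ x ∈ frobeniusOrderSet K E g H, f x =
      ∑ T ∈ H.powerset, (-1) ^ T.card * ∑ x : frobeniusKer K E (g / ∏ h ∈ T, h), f x := by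
  have h := Finset.inclusion_exclusion_sum_inf_compl H
    (fun h => Finset.univ.filter fun x : E => x ∈ frobeniusKer K E (g / h))
    (fun x => if x ∈ frobeniusKer K E g then f x else 0)
  have h1 : ∑ x ∈ frobeniusOrderSet K E g H, f x =
      ∑ x ∈ H.inf fun h => (Finset.univ.filter fun x : E => x ∈ frobeniusKer K E (g / h))ᶜ,
        if x ∈ frobeniusKer K E g then f x else 0 := by
    rw [← Finset.sum_filter]
    refine Finset.sum_congr ?_ fun _ _ => rfl
    ext x
    simp [frobeniusOrderSet, Finset.mem_inf, and_comm]
  rw [h1, h]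
  refine Finset.sum_congr rfl fun T hT => ?_
  rw [zsmul_eq_mul]
  push_cast
  congr 1
  rw [← Finset.sum_filter,
    ← Finset.sum_subtype (Finset.univ.filter fun x => x ∈ frobeniusKer K E (g / ∏ h ∈ T, h))
      (by simp) f]
  refine Finset.sum_congr ?_ fun _ _ => rfl
  ext x
  have := mem_frobeniusKer_prod_iff hg T
    (fun h hh => hH h (Finset.mem_powerset.mp hT hh)) x
  simp only [Finset.mem_filter, Finset.mem_inf, Finset.mem_univ, true_and]
  rw [← this, and_comm]

theorem card_frobeniusOrderSet {g : K[X]} (hg : g ∣ X ^ Module.finrank K E - 1)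
    (H : Finset K[X]) (hH : ∀ h ∈ H, Monic h ∧ Irreducible h ∧ h ∣ g) :
    ((frobeniusOrderSet K E g H).card : ℝ) =
      (Fintype.card K : ℝ) ^ g.natDegree *
        ∏ h ∈ H, (1 - ((Fintype.card K : ℝ) ^ h.natDegree)⁻¹) := by
  classical
  have hne : (X ^ Module.finrank K E - 1 : K[X]) ≠ 0 :=
    (monic_X_pow_sub_C 1 Module.finrank_pos.ne').ne_zero
  have hg0 : g ≠ 0 := fun h => hne (by rw [h] at hg; exact zero_dvd_iff.mp hg)
  have hq : (Fintype.card K : ℂ) ≠ 0 := by exact_mod_cast Fintype.card_ne_zero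
  have h := sum_frobeniusOrderSet (E := E) hg0 H hH fun _ => 1
  have hC : ((frobeniusOrderSet K E g H).card : ℂ) =
      (Fintype.card K : ℂ) ^ g.natDegree *
        ∏ h ∈ H, (1 - ((Fintype.card K : ℂ) ^ h.natDegree)⁻¹) := by
    rw [Finset.sum_const, nsmul_eq_mul, mul_one] at h
    rw [h, Finset.prod_sub, Finset.mul_sum]
    simp only [Finset.prod_const_one, mul_one]
    refine Finset.sum_congr rfl fun T hT => ?_
    have hT' : ∀ h ∈ T, Monic h ∧ Irreducible h ∧ h ∣ g :=
      fun h hh => hH h (Finset.mem_powerset.mp hT hh)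
    have hprod : ∏ h ∈ T, h ∣ g := prod_dvd_of_monic_irreducible T hT'
    obtain ⟨c, hc⟩ := hprod
    have hP0 : ∏ h ∈ T, h ≠ 0 := by rintro h; rw [h, zero_mul] at hc; exact hg0 hc
    have hc0 : c ≠ 0 := by rintro rfl; rw [mul_zero] at hc; exact hg0 hc
    have hdiv : g / ∏ h ∈ T, h = c := by rw [hc, mul_div_cancel_left₀ _ hP0]
    have hdeg : g.natDegree = ∑ h ∈ T, h.natDegree + c.natDegree := by
      conv_lhs => rw [hc, natDegree_mul hP0 hc0]
      rw [natDegree_prod _ _ fun h hh => (hT' h hh).1.ne_zero]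
    have hcdvd : c ∣ X ^ Module.finrank K E - 1 := (Dvd.intro_left _ hc.symm).trans hg
    rw [Finset.sum_const, nsmul_eq_mul, mul_one, Finset.card_univ, hdiv, card_frobeniusKer hcdvd,
      hdeg, pow_add, Finset.prod_inv_distrib, Finset.prod_pow_eq_pow_sum]
    push_cast
    field_simp
  apply Complex.ofReal_injective
  push_cast
  exact hC

theorem norm_sum_frobeniusOrderSet_le {g : K[X]} (hg : g ≠ 0)
    (H : Finset K[X]) (hH : ∀ h ∈ H, Monic h ∧ Irreducible h ∧ h ∣ g)
    (χ : MulChar E ℂ) (hχ : χ ≠ 1) :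
    ‖∑ x ∈ frobeniusOrderSet K E g H, χ x‖ ≤ 2 ^ H.card * √(Fintype.card E) := by
  classical
  rw [sum_frobeniusOrderSet hg H hH]
  refine (norm_sum_le _ _).trans ?_
  refine (Finset.sum_le_card_nsmul _ _ (√(Fintype.card E)) fun T _ => ?_).trans ?_
  · rw [norm_mul, norm_pow, norm_neg, norm_one, one_pow, one_mul]
    exact norm_sum_mulChar_addSubgroup_le χ hχ (frobeniusKer K E (g / ∏ h ∈ T, h)).toAddSubgroup
  · rw [nsmul_eq_mul, Finset.card_powerset]
    simp

end Frobenius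

section KNormal

variable {K : Type*} [Field K] [Fintype K] {E : Type*} [Field E] [Fintype E] [Algebra K E]

omit [Fintype E] in
theorem gPoly_eq_sum_frobeniusLinear (n : ℕ) (α : E) :
    gPoly (Fintype.card K) n α =
      ∑ i ∈ Finset.range n, C ((frobeniusLinear K E ^ i) α) * X ^ (n - 1 - i) := by
  simp_rw [frobeniusLinear_pow_apply]
  rfl

omit [Fintype E] in
theorem natDegree_gPoly_lt {q n : ℕ} (hn : 0 < n) (α : E) : (gPoly q n α).natDegree < n := by
  refine lt_of_le_of_lt (natDegree_sum_le_of_forall_le (n := n - 1) _ _ fun i _ => ?_) (by omega)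
  exact (natDegree_C_mul_X_pow_le _ _).trans (by omega)

omit [Fintype E] in
theorem gPoly_coeff_pred {q n : ℕ} (hn : 0 < n) (α : E) : (gPoly q n α).coeff (n - 1) = α := by
  simp only [gPoly, finsetSum_coeff, coeff_C_mul, coeff_X_pow]
  rw [Finset.sum_eq_single 0]
  · simp
  · intro i hi h0
    rw [Finset.mem_range] at hi
    rw [if_neg (by omega), mul_zero]
  · simp [hn.ne']

omit [Fintype E] in
theorem X_pow_sub_one_dvd_gPoly_iff {q n : ℕ} (hq : q ≠ 0) (hn : 0 < n) (α : E) :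
    (X ^ n - 1 : E[X]) ∣ gPoly q n α ↔ α = 0 := by
  constructor
  · intro h
    have h0 : gPoly q n α = 0 := by
      refine eq_zero_of_dvd_of_natDegree_lt h ?_
      have : (X ^ n - 1 : E[X]).natDegree = n := natDegree_X_pow_sub_C
      rw [this]
      exact natDegree_gPoly_lt hn α
    rw [← gPoly_coeff_pred (q := q) hn α, h0, coeff_zero]
  · intro h
    have : gPoly q n α = 0 := by
      rw [gPoly]
      refine Finset.sum_eq_zero fun i _ => ?_
      rw [h, zero_pow (pow_ne_zero i hq), map_zero, zero_mul]
    rw [this]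
    exact dvd_zero _

theorem X_pow_sub_one_dvd_map_mul_gPoly_sub (p : K[X]) (α : E) :
    (X ^ Module.finrank K E - 1 : E[X]) ∣ p.map (algebraMap K E) *
      gPoly (Fintype.card K) (Module.finrank K E) α -
      gPoly (Fintype.card K) (Module.finrank K E) (aeval (frobeniusLinear K E) p α) := by
  set n := Module.finrank K E with hn
  set q := Fintype.card K with hq
  have hadd : ∀ a b : E, gPoly q n (a + b) = gPoly q n a + gPoly q n b := by
    intro a b
    simp_rw [hq, gPoly_eq_sum_frobeniusLinear, map_add, add_mul, Finset.sum_add_distrib]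
  have hsmul : ∀ (c : K) (a : E), gPoly q n (c • a) = C (algebraMap K E c) * gPoly q n a := by
    intro c a
    simp_rw [hq, gPoly_eq_sum_frobeniusLinear, map_smul, Algebra.smul_def, map_mul,
      Finset.mul_sum, mul_assoc]
  have hX : ∀ β : E, X * gPoly q n β - gPoly q n (frobeniusLinear K E β) =
      C β * (X ^ n - 1) := by
    intro β
    have hn0 : 0 < n := Module.finrank_pos
    obtain ⟨k, hk⟩ : ∃ k, n = k + 1 := ⟨n - 1, by omega⟩
    have hβ : β ^ q ^ n = β := by
      rw [hq, hn, ← Module.card_eq_pow_finrank, FiniteField.pow_card]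
    have hσ : frobeniusLinear K E β = β ^ q := rfl
    rw [hσ]
    have h1 : X * gPoly q n β = C β * X ^ n + ∑ i ∈ Finset.range k, C (β ^ q ^ (i + 1)) *
        X ^ (k - i) := by
      rw [gPoly, hk, Finset.sum_range_succ', mul_add, add_comm, Finset.mul_sum]
      congr 1
      · simp [pow_succ]; ring
      · refine Finset.sum_congr rfl fun i hi => ?_
        rw [Finset.mem_range] at hi
        rw [show k - i = (k + 1 - 1 - (i + 1)) + 1 by omega, pow_succ (X : E[X])]
        ring
    have h2 : gPoly q n (β ^ q) = C β + ∑ i ∈ Finset.range k, C (β ^ q ^ (i + 1)) *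
        X ^ (k - i) := by
      rw [gPoly, hk, Finset.sum_range_succ, add_comm]
      congr 1
      · rw [← pow_mul, ← pow_succ', ← hk, hβ, show n - 1 - k = 0 by omega, pow_zero, mul_one]
      · refine Finset.sum_congr rfl fun i hi => ?_
        rw [← pow_mul, ← pow_succ']
        simp
    rw [h1, h2]
    ring
  induction p using Polynomial.induction_on with
  | C a =>
    rw [map_C, aeval_C, Module.algebraMap_end_apply, hsmul, sub_self]
    exact dvd_zero _
  | add a b ha hb =>
    rw [Polynomial.map_add, map_add, LinearMap.add_apply, hadd]
    have h5 := dvd_add ha hb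
    rwa [sub_add_sub_comm, ← add_mul] at h5
  | monomial i a ih =>
    have h1 : aeval (frobeniusLinear K E) (C a * X ^ (i + 1)) α =
        frobeniusLinear K E (aeval (frobeniusLinear K E) (C a * X ^ i) α) := by
      rw [pow_succ', ← mul_assoc, mul_comm (C a), mul_assoc, map_mul, aeval_X,
        Module.End.mul_apply]
    have h2 : (C a * X ^ (i + 1) : K[X]).map (algebraMap K E) =
        X * (C a * X ^ i : K[X]).map (algebraMap K E) := by
      rw [pow_succ', ← mul_assoc, mul_comm (C a), mul_assoc, Polynomial.map_mul, map_X]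
    rw [h1, h2]
    have h3 := hX (aeval (frobeniusLinear K E) (C a * X ^ i) α)
    have h4 := dvd_mul_left (X ^ n - 1) (C (aeval (frobeniusLinear K E) (C a * X ^ i) α))
    rw [← h3] at h4
    have h5 := dvd_add (ih.mul_left X) h4
    rwa [mul_sub, ← mul_assoc, sub_add_sub_cancel] at h5

theorem X_pow_sub_one_dvd_map_mul_gPoly_iff (p : K[X]) (α : E) :
    (X ^ Module.finrank K E - 1 : E[X]) ∣ p.map (algebraMap K E) *
      gPoly (Fintype.card K) (Module.finrank K E) α ↔ α ∈ frobeniusKer K E p := by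
  rw [LinearMap.mem_ker, ← X_pow_sub_one_dvd_gPoly_iff (Fintype.card_ne_zero (α := K))
    (Module.finrank_pos (R := K) (M := E))]
  exact (dvd_iff_dvd_of_dvd_sub (X_pow_sub_one_dvd_map_mul_gPoly_sub p α))

/-- Every monic divisor of `X ^ n - 1` that also divides `g_α`, and is the greatest such, has
coefficients in `K`. -/
theorem exists_map_eq_of_isGCD {α : E} {G : E[X]} (hG : G.Monic)
    (h1 : G ∣ X ^ Module.finrank K E - 1)
    (h2 : G ∣ gPoly (Fintype.card K) (Module.finrank K E) α)
    (h3 : ∀ D : E[X], D ∣ X ^ Module.finrank K E - 1 →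
      D ∣ gPoly (Fintype.card K) (Module.finrank K E) α → D ∣ G) :
    ∃ P : K[X], P.map (algebraMap K E) = G := by
  classical
  set n := Module.finrank K E with hn
  have hn0 : 0 < n := Module.finrank_pos
  set q := Fintype.card K with hq
  let φ : E →+* E := (FiniteField.frobeniusAlgHom K E : E →ₐ[K] E).toRingHom
  have hφ : ∀ x, φ x = x ^ q := fun x => rfl
  have hXn : (X ^ n - 1 : E[X]).map φ = X ^ n - 1 := by simp
  have hg : (gPoly q n α).map φ = gPoly q n (aeval (frobeniusLinear K E) (X : K[X]) α) := by
    have hσ : aeval (frobeniusLinear K E) (X : K[X]) α = φ α := by rw [aeval_X]; rfl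
    rw [hσ]
    simp only [gPoly, Polynomial.map_sum, Polynomial.map_mul, map_C, Polynomial.map_pow, map_X,
      map_pow]
  have hD1 : G.map φ ∣ X ^ n - 1 := by
    rw [← hXn]; exact Polynomial.map_dvd φ h1
  have hD2 : G.map φ ∣ X * gPoly q n α := by
    have h4 := X_pow_sub_one_dvd_map_mul_gPoly_sub (K := K) (X : K[X]) α
    rw [map_X, ← hg] at h4
    have h5 := hD1.trans h4
    exact (dvd_iff_dvd_of_dvd_sub h5).mpr (Polynomial.map_dvd φ h2)
  have hcop : IsCoprime (G.map φ) X := by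
    obtain ⟨c, hc⟩ := hD1
    refine ⟨-c, X ^ (n - 1), ?_⟩
    have : (X : E[X]) ^ (n - 1) * X = X ^ n := by rw [← pow_succ]; congr 1; omega
    rw [this]
    linear_combination hc
  have hD3 : G.map φ ∣ G := h3 _ hD1 (hcop.dvd_of_dvd_mul_left hD2)
  have heq : G.map φ = G := by
    refine (eq_of_monic_of_dvd_of_natDegree_le (hG.map φ) hG hD3 ?_).symm
    rw [natDegree_map]
  rw [← Polynomial.mem_lifts, Polynomial.lifts_iff_coeff_lifts]
  intro i
  have hc : (G.coeff i) ^ q = G.coeff i := by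
    rw [← hφ, ← coeff_map, heq]
  have hroots : (X ^ q - X : E[X]).roots = (X ^ q - X : K[X]).roots.map (algebraMap K E) := by
    have hsplit : Splits (X ^ q - X : K[X]) := by
      rw [splits_iff_card_roots, FiniteField.roots_X_pow_card_sub_X,
        FiniteField.X_pow_card_sub_X_natDegree_eq K Fintype.one_lt_card]
      rfl
    have := hsplit.roots_map (algebraMap K E)
    simpa using this
  have hmem : G.coeff i ∈ (X ^ q - X : E[X]).roots := by
    rw [mem_roots (FiniteField.X_pow_card_sub_X_ne_zero E Fintype.one_lt_card)]
    rw [IsRoot, eval_sub, eval_pow, eval_X, ← hq, hc, sub_self]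
  rw [hroots, Multiset.mem_map] at hmem
  obtain ⟨a, -, ha⟩ := hmem
  exact ⟨a, ha⟩

theorem natDegree_gcd_eq {α : E} {f g : K[X]} (hfg : f * g = X ^ Module.finrank K E - 1)
    (hα : ∀ a : K[X], α ∈ frobeniusKer K E a ↔ g ∣ a) :
    IsKNormal (Fintype.card K) (Module.finrank K E) f.natDegree α := by
  classical
  set n := Module.finrank K E with hn
  have hn0 : 0 < n := Module.finrank_pos
  set q := Fintype.card K with hq
  have hne : (X ^ n - 1 : K[X]) ≠ 0 := (monic_X_pow_sub_C 1 hn0.ne').ne_zero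
  have hne' : (X ^ n - 1 : E[X]) ≠ 0 := (monic_X_pow_sub_C 1 hn0.ne').ne_zero
  have hf : f ≠ 0 := by rintro rfl; exact hne (by rw [← hfg, zero_mul])
  have hg : g ≠ 0 := by rintro rfl; exact hne (by rw [← hfg, mul_zero])
  have hfgE : f.map (algebraMap K E) * g.map (algebraMap K E) = X ^ n - 1 := by
    rw [← Polynomial.map_mul, hfg]; simp
  have hgE : g.map (algebraMap K E) ≠ 0 := by
    rwa [Ne, Polynomial.map_eq_zero]
  rw [IsKNormal]
  set D := @EuclideanDomain.gcd (Polynomial E) _ (Classical.decEq _)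
    ((X : Polynomial E) ^ n - 1) (gPoly q n α) with hD
  have hD1 : D ∣ X ^ n - 1 := @EuclideanDomain.gcd_dvd_left _ _ (Classical.decEq _) _ _
  have hD2 : D ∣ gPoly q n α := @EuclideanDomain.gcd_dvd_right _ _ (Classical.decEq _) _ _
  have hD3 : ∀ P : E[X], P ∣ X ^ n - 1 → P ∣ gPoly q n α → P ∣ D := fun P h1 h2 =>
    @EuclideanDomain.dvd_gcd _ _ (Classical.decEq _) _ _ _ h1 h2
  have hD0 : D ≠ 0 := by rintro h; rw [h, zero_dvd_iff] at hD1; exact hne' hD1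
  have hfD : f.map (algebraMap K E) ∣ D := by
    refine hD3 _ ⟨_, hfgE.symm⟩ ?_
    have := (X_pow_sub_one_dvd_map_mul_gPoly_iff g α).mpr ((hα g).mpr dvd_rfl)
    rw [← hfgE, mul_comm] at this
    exact (mul_dvd_mul_iff_left hgE).mp this
  have hle : f.natDegree ≤ D.natDegree := by
    rw [← natDegree_map (algebraMap K E)]
    exact natDegree_le_of_dvd hfD hD0
  refine le_antisymm ?_ hle
  have hassoc : Associated D (normalize D) := (normalize_associated D).symm
  obtain ⟨P, hP⟩ := exists_map_eq_of_isGCD (K := K) (α := α) (monic_normalize hD0)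
    ((normalize_dvd_iff).mpr hD1) ((normalize_dvd_iff).mpr hD2)
    (fun Q h1 h2 => dvd_normalize_iff.mpr (hD3 Q h1 h2))
  have hPdvd : P ∣ X ^ n - 1 := by
    have : P.map (algebraMap K E) ∣ (X ^ n - 1 : K[X]).map (algebraMap K E) := by
      rw [hP]; simpa using normalize_dvd_iff.mpr hD1
    exact (Polynomial.map_dvd_map' _).mp this
  obtain ⟨P', hP'⟩ := hPdvd
  have hP'E : P.map (algebraMap K E) * P'.map (algebraMap K E) = X ^ n - 1 := by
    rw [← Polynomial.map_mul, ← hP']; simp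
  have hgP' : g ∣ P' := by
    rw [← hα, ← X_pow_sub_one_dvd_map_mul_gPoly_iff, ← hn, ← hP'E, mul_comm]
    refine mul_dvd_mul_left _ ?_
    rw [hP]
    exact normalize_dvd_iff.mpr hD2
  have hP'0 : P' ≠ 0 := by rintro rfl; exact hne (by rw [hP', mul_zero])
  have hP0 : P ≠ 0 := by rintro rfl; exact hne (by rw [hP', zero_mul])
  have e1 : P.natDegree + P'.natDegree = f.natDegree + g.natDegree := by
    rw [← natDegree_mul hP0 hP'0, ← natDegree_mul hf hg, ← hP', hfg]
  have e2 := natDegree_le_of_dvd hgP' hP'0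
  have e3 : D.natDegree = P.natDegree := by
    rw [natDegree_eq_of_degree_eq (degree_eq_degree_of_associated hassoc), ← hP, natDegree_map]
  omega

/-- The degree `k` of a `k`-normal element is the degree of a divisor of `X ^ n - 1`. -/
theorem exists_natDegree_eq_of_isKNormal {α : E} {k : ℕ}
    (h : IsKNormal (Fintype.card K) (Module.finrank K E) k α) :
    ∃ P : K[X], P.Monic ∧ P ∣ X ^ Module.finrank K E - 1 ∧ P.natDegree = k := by
  classical
  set n := Module.finrank K E with hn
  have hn0 : 0 < n := Module.finrank_pos
  set q := Fintype.card K with hq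
  have hne' : (X ^ n - 1 : E[X]) ≠ 0 := (monic_X_pow_sub_C 1 hn0.ne').ne_zero
  rw [IsKNormal] at h
  set D := @EuclideanDomain.gcd (Polynomial E) _ (Classical.decEq _)
    ((X : Polynomial E) ^ n - 1) (gPoly q n α) with hD
  have hD1 : D ∣ X ^ n - 1 := @EuclideanDomain.gcd_dvd_left _ _ (Classical.decEq _) _ _
  have hD2 : D ∣ gPoly q n α := @EuclideanDomain.gcd_dvd_right _ _ (Classical.decEq _) _ _
  have hD3 : ∀ P : E[X], P ∣ X ^ n - 1 → P ∣ gPoly q n α → P ∣ D := fun P h1 h2 =>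
    @EuclideanDomain.dvd_gcd _ _ (Classical.decEq _) _ _ _ h1 h2
  have hD0 : D ≠ 0 := by rintro h; rw [h, zero_dvd_iff] at hD1; exact hne' hD1
  have hassoc : Associated D (normalize D) := (normalize_associated D).symm
  obtain ⟨P, hP⟩ := exists_map_eq_of_isGCD (K := K) (α := α) (monic_normalize hD0)
    ((normalize_dvd_iff).mpr hD1) ((normalize_dvd_iff).mpr hD2)
    (fun Q h1 h2 => dvd_normalize_iff.mpr (hD3 Q h1 h2))
  refine ⟨P, ?_, ?_, ?_⟩
  · rw [Monic, ← (algebraMap K E).injective.eq_iff, ← leadingCoeff_map, hP, map_one]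
    exact monic_normalize hD0
  · have : P.map (algebraMap K E) ∣ (X ^ n - 1 : K[X]).map (algebraMap K E) := by
      rw [hP]; simpa using normalize_dvd_iff.mpr hD1
    exact (Polynomial.map_dvd_map' _).mp this
  · rw [← h, natDegree_eq_of_degree_eq (degree_eq_degree_of_associated hassoc), ← hP,
      natDegree_map]

theorem exists_primitive_isKNormal_of_lt {f g : K[X]}
    (hfg : f * g = X ^ Module.finrank K E - 1) (hg : g.natDegree ≠ 0) (H : Finset K[X])
    (hH : ∀ h, h ∈ H ↔ Monic h ∧ Irreducible h ∧ h ∣ g)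
    (hlt : 2 ^ (Fintype.card E - 1).primeFactors.card * (2 ^ H.card * √(Fintype.card E)) <
      (Fintype.card K : ℝ) ^ g.natDegree *
        ∏ h ∈ H, (1 - ((Fintype.card K : ℝ) ^ h.natDegree)⁻¹)) :
    ∃ α : E, IsPrimitiveElem α ∧
      IsKNormal (Fintype.card K) (Module.finrank K E) f.natDegree α := by
  classical
  have hg0 : g ≠ 0 := by rintro rfl; simp at hg
  have hH' : ∀ h ∈ H, Monic h ∧ Irreducible h ∧ h ∣ g := fun h => (hH h).mp
  have hfactor : ∀ c : K[X], c ∣ g → ¬ IsUnit c → ∃ h ∈ H, h ∣ c := by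
    intro c hc hcu
    have hc0 : c ≠ 0 := fun h => hg0 (by rwa [h, zero_dvd_iff] at hc)
    obtain ⟨h, hirr, hdvd⟩ := WfDvdMonoid.exists_irreducible_factor hcu hc0
    refine ⟨normalize h, (hH _).mpr ⟨monic_normalize hirr.ne_zero, ?_, ?_⟩, ?_⟩
    · exact (normalize_associated h).symm.irreducible hirr
    · exact normalize_dvd_iff.mpr (hdvd.trans hc)
    · exact normalize_dvd_iff.mpr hdvd
  have h0 : (0 : E) ∉ frobeniusOrderSet K E g H := by
    obtain ⟨h, hh, -⟩ := hfactor g dvd_rfl fun hu => hg (natDegree_eq_zero_of_isUnit hu)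
    intro hmem
    exact (Finset.mem_filter.mp hmem).2.2 h hh (zero_mem _)
  rw [← card_frobeniusOrderSet ⟨f, by rw [mul_comm, hfg]⟩ H hH'] at hlt
  obtain ⟨α, hα, hprim⟩ := exists_primitive_mem (frobeniusOrderSet K E g H) h0
    (2 ^ H.card * √(Fintype.card E))
    (fun χ hχ => norm_sum_frobeniusOrderSet_le hg0 H hH' χ hχ) (by positivity) hlt
  refine ⟨α, hprim, natDegree_gcd_eq hfg fun a => ?_⟩
  obtain ⟨hα1, hα2⟩ := (Finset.mem_filter.mp hα).2
  obtain ⟨m, hm⟩ := exists_frobeniusOrder (K := K) α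
  simp_rw [hm] at hα1 hα2 ⊢
  suffices hgm : g ∣ m from ⟨hgm.trans, hα1.trans⟩
  obtain ⟨c, rfl⟩ := hα1
  by_cases hc : IsUnit c
  · exact hc.dvd_mul_right.mp dvd_rfl
  · exfalso
    obtain ⟨h, hh, e, rfl⟩ := hfactor c (dvd_mul_left _ _) hc
    refine hα2 h hh ⟨e, ?_⟩
    have hh0 : h ≠ 0 := (hH' h hh).1.ne_zero
    rw [mul_left_comm, mul_div_cancel_left₀ _ hh0]

end KNormal

section Divisors

variable {K : Type*} [Field K] [Fintype K]

omit [Fintype K] in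
theorem dvd_X_pow_gcd_sub_one {h : K[X]} {a b : ℕ} (ha : h ∣ X ^ a - 1) (hb : h ∣ X ^ b - 1) :
    h ∣ X ^ Nat.gcd a b - 1 := by
  rw [← AdjoinRoot.mk_eq_zero, map_sub, sub_eq_zero, map_pow, map_one] at *
  exact pow_gcd_eq_one.mpr ⟨ha, hb⟩

theorem dvd_X_pow_gcd_card_sub_one {h : K[X]} (hirr : Irreducible h) {n d : ℕ} (hn : n ≠ 0)
    (hd : h.natDegree ∣ d) (h1 : h ∣ X ^ n - 1) :
    h ∣ X ^ Nat.gcd n (Fintype.card K ^ d - 1) - 1 := by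
  refine dvd_X_pow_gcd_sub_one h1 ?_
  have h2 := hirr.natDegree_dvd_iff_dvd_X_pow_card_pow_sub_X.mp hd
  rw [Nat.card_eq_fintype_card] at h2
  have h3 : (X ^ Fintype.card K ^ d - X : K[X]) = X * (X ^ (Fintype.card K ^ d - 1) - 1) := by
    have : 0 < Fintype.card K ^ d := pow_pos Fintype.card_pos _
    rw [mul_sub, ← pow_succ', mul_one, Nat.sub_add_cancel this]
  rw [h3] at h2
  refine (hirr.prime.dvd_or_dvd h2).resolve_left fun hX => hirr.not_isUnit ?_
  rw [isUnit_iff_dvd_one]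
  have := dvd_sub (hX.trans (dvd_pow_self X hn)) h1
  simpa using this

theorem natDegree_dvd_of_dvd_X_pow_gcd_card_sub_one {h : K[X]} (hirr : Irreducible h) {n d : ℕ}
    (h1 : h ∣ X ^ Nat.gcd n (Fintype.card K ^ d - 1) - 1) : h.natDegree ∣ d := by
  refine hirr.natDegree_dvd_iff_dvd_X_pow_card_pow_sub_X.mpr ?_
  rw [Nat.card_eq_fintype_card]
  have h3 : (X ^ Fintype.card K ^ d - X : K[X]) = X * (X ^ (Fintype.card K ^ d - 1) - 1) := by
    have : 0 < Fintype.card K ^ d := pow_pos Fintype.card_pos _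
    rw [mul_sub, ← pow_succ', mul_one, Nat.sub_add_cancel this]
  rw [h3]
  refine (h1.trans ?_).mul_left _
  obtain ⟨k, hk⟩ := Nat.gcd_dvd_right n (Fintype.card K ^ d - 1)
  conv_rhs => rw [hk, pow_mul]
  exact sub_one_dvd_pow_sub_one _ _

omit [Fintype K] in
theorem sum_natDegree_add_le (S : Finset K[X]) (hS : ∀ h ∈ S, Monic h ∧ Irreducible h) {G : ℕ}
    (hG : 0 < G) (hSG : ∀ h ∈ S, h ∣ X ^ G - 1) {W : K[X]} (hW : W ∣ X ^ G - 1)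
    (hSW : ∀ h ∈ S, ¬ h ∣ W) : ∑ h ∈ S, h.natDegree + W.natDegree ≤ G := by
  have hne : (X ^ G - 1 : K[X]) ≠ 0 := (monic_X_pow_sub_C 1 hG.ne').ne_zero
  have h1 : ∏ h ∈ S, h ∣ X ^ G - 1 :=
    prod_dvd_of_monic_irreducible S fun h hh => ⟨(hS h hh).1, (hS h hh).2, hSG h hh⟩
  have h2 : IsRelPrime (∏ h ∈ S, h) W :=
    IsRelPrime.prod_left fun h hh => (hS h hh).2.isRelPrime_iff_not_dvd.mpr (hSW h hh)
  have h3 := natDegree_le_of_dvd (h2.mul_dvd h1 hW) hne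
  have hP : ∏ h ∈ S, h ≠ 0 := Finset.prod_ne_zero_iff.mpr fun h hh => (hS h hh).1.ne_zero
  have hW0 : W ≠ 0 := fun h => hne (by rwa [h, zero_dvd_iff] at hW)
  rw [natDegree_mul hP hW0, natDegree_prod _ _ fun h hh => (hS h hh).1.ne_zero] at h3
  exact h3.trans_eq natDegree_X_pow_sub_C

/-- The total degree of the members of `H` of degree `d`. -/
def degreeMass (H : Finset K[X]) (d : ℕ) : ℕ := ∑ h ∈ H with h.natDegree = d, h.natDegree

theorem degreeMass_one_le {n : ℕ} (hn : n ≠ 0) (H : Finset K[X])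
    (hH : ∀ h ∈ H, Monic h ∧ Irreducible h ∧ h ∣ X ^ n - 1) :
    degreeMass H 1 ≤ Nat.gcd n (Fintype.card K - 1) := by
  have := sum_natDegree_add_le (H.filter fun h => h.natDegree = 1)
    (fun h hh => ⟨(hH h (Finset.mem_filter.mp hh).1).1, (hH h (Finset.mem_filter.mp hh).1).2.1⟩)
    (G := Nat.gcd n (Fintype.card K - 1)) (Nat.gcd_pos_of_pos_left _ (Nat.pos_of_ne_zero hn))
    (fun h hh => by
      obtain ⟨hh1, hh2⟩ := Finset.mem_filter.mp hh
      have := dvd_X_pow_gcd_card_sub_one (hH h hh1).2.1 hn (dvd_of_eq hh2) (hH h hh1).2.2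
      rwa [pow_one] at this)
    (one_dvd _) (fun h hh hd => (hH h (Finset.mem_filter.mp hh).1).2.1.not_isUnit
      (isUnit_of_dvd_one hd))
  simpa [degreeMass] using this

theorem degreeMass_add_le {n : ℕ} (hn : n ≠ 0) (H : Finset K[X])
    (hH : ∀ h ∈ H, Monic h ∧ Irreducible h ∧ h ∣ X ^ n - 1) {d e : ℕ} (hed : e ∣ d) (hlt : e < d)
    (he : 0 < e) :
    degreeMass H d + Nat.gcd n (Fintype.card K ^ e - 1) ≤
      Nat.gcd n (Fintype.card K ^ d - 1) := by
  have hdvd : Nat.gcd n (Fintype.card K ^ e - 1) ∣ Nat.gcd n (Fintype.card K ^ d - 1) :=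
    Nat.gcd_dvd_gcd_of_dvd_right _ (Nat.pow_sub_one_dvd_pow_sub_one _ hed)
  have := sum_natDegree_add_le (H.filter fun h => h.natDegree = d)
    (fun h hh => ⟨(hH h (Finset.mem_filter.mp hh).1).1, (hH h (Finset.mem_filter.mp hh).1).2.1⟩)
    (G := Nat.gcd n (Fintype.card K ^ d - 1)) (Nat.gcd_pos_of_pos_left _ (Nat.pos_of_ne_zero hn))
    (fun h hh => by
      obtain ⟨hh1, hh2⟩ := Finset.mem_filter.mp hh
      exact dvd_X_pow_gcd_card_sub_one (hH h hh1).2.1 hn (dvd_of_eq hh2) (hH h hh1).2.2)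
    (W := X ^ Nat.gcd n (Fintype.card K ^ e - 1) - 1)
    (by
      obtain ⟨k, hk⟩ := hdvd
      rw [hk, pow_mul]
      exact sub_one_dvd_pow_sub_one _ _)
    (fun h hh hd => by
      obtain ⟨hh1, hh2⟩ := Finset.mem_filter.mp hh
      have := natDegree_dvd_of_dvd_X_pow_gcd_card_sub_one (hH h hh1).2.1 hd
      rw [hh2] at this
      exact absurd (Nat.le_of_dvd he this) (not_le.mpr hlt))
  rwa [show (X ^ Nat.gcd n (Fintype.card K ^ e - 1) - 1 : K[X]).natDegree =
    Nat.gcd n (Fintype.card K ^ e - 1) from natDegree_X_pow_sub_C] at this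

omit [Fintype K] in
theorem sum_natDegree_le {n : ℕ} (hn : n ≠ 0) (H : Finset K[X])
    (hH : ∀ h ∈ H, Monic h ∧ Irreducible h ∧ h ∣ X ^ n - 1) :
    ∑ h ∈ H, h.natDegree ≤ n := by
  have := sum_natDegree_add_le H (fun h hh => ⟨(hH h hh).1, (hH h hh).2.1⟩)
    (Nat.pos_of_ne_zero hn) (fun h hh => (hH h hh).2.2) (one_dvd _)
    (fun h hh hd => (hH h hh).2.1.not_isUnit (isUnit_of_dvd_one hd))
  simpa using this

end Divisors

/-- Abel summation for products of powers with decreasing bases. -/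
theorem prod_pow_le_of_partial_sums {c₁ c₂ c₃ c₄ c₅ : ℝ} (h12 : c₂ ≤ c₁) (h23 : c₃ ≤ c₂)
    (h34 : c₄ ≤ c₃) (h45 : c₅ ≤ c₄) (h5 : 1 ≤ c₅) {s₁ s₂ s₃ s₄ s₅ t₁ t₂ t₃ t₄ n : ℕ}
    (ht12 : t₁ ≤ t₂) (ht23 : t₂ ≤ t₃) (ht34 : t₃ ≤ t₄) (ht4 : t₄ ≤ n)
    (hs1 : s₁ ≤ t₁) (hs2 : s₁ + s₂ ≤ t₂) (hs3 : s₁ + s₂ + s₃ ≤ t₃) (hs4 : s₁ + s₂ + s₃ + s₄ ≤ t₄)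
    (hs5 : s₁ + s₂ + s₃ + s₄ + s₅ ≤ n) :
    c₁ ^ s₁ * c₂ ^ s₂ * c₃ ^ s₃ * c₄ ^ s₄ * c₅ ^ s₅ ≤
      c₁ ^ t₁ * c₂ ^ (t₂ - t₁) * c₃ ^ (t₃ - t₂) * c₄ ^ (t₄ - t₃) * c₅ ^ (n - t₄) := by
  have p5 : 0 < c₅ := by linarith
  have p4 : 0 < c₄ := by linarith
  have p3 : 0 < c₃ := by linarith
  have p2 : 0 < c₂ := by linarith
  have p1 : 0 < c₁ := by linarith
  obtain ⟨a₁, rfl⟩ := Nat.exists_eq_add_of_le hs1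
  obtain ⟨a₂, ha₂⟩ := Nat.exists_eq_add_of_le hs2
  obtain ⟨a₃, ha₃⟩ := Nat.exists_eq_add_of_le hs3
  obtain ⟨a₄, ha₄⟩ := Nat.exists_eq_add_of_le hs4
  obtain ⟨a₅, ha₅⟩ := Nat.exists_eq_add_of_le hs5
  have key : ∀ {a b : ℝ}, 0 < b → b ≤ a → ∀ i : ℕ, b ^ i ≤ a ^ i := fun hb hab i =>
    pow_le_pow_left₀ hb.le hab i
  have e2 : t₂ - (s₁ + a₁) + a₁ = s₂ + a₂ := by omega
  have e3 : t₃ - t₂ + a₂ = s₃ + a₃ := by omega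
  have e4 : t₄ - t₃ + a₃ = s₄ + a₄ := by omega
  have e5 : n - t₄ + a₄ = s₅ + a₅ := by omega
  have f2 : c₂ ^ (t₂ - (s₁ + a₁)) * c₂ ^ a₁ = c₂ ^ s₂ * c₂ ^ a₂ := by rw [← pow_add, e2, pow_add]
  have f3 : c₃ ^ (t₃ - t₂) * c₃ ^ a₂ = c₃ ^ s₃ * c₃ ^ a₃ := by rw [← pow_add, e3, pow_add]
  have f4 : c₄ ^ (t₄ - t₃) * c₄ ^ a₃ = c₄ ^ s₄ * c₄ ^ a₄ := by rw [← pow_add, e4, pow_add]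
  have f5 : c₅ ^ (n - t₄) * c₅ ^ a₄ = c₅ ^ s₅ * c₅ ^ a₅ := by rw [← pow_add, e5, pow_add]
  have hpos : 0 < c₂ ^ a₁ * c₃ ^ a₂ * c₄ ^ a₃ * c₅ ^ a₄ := by positivity
  refine le_of_mul_le_mul_right ?_ hpos
  have hmid : c₂ ^ a₁ * c₃ ^ a₂ * c₄ ^ a₃ * c₅ ^ a₄ ≤
      c₁ ^ a₁ * c₂ ^ a₂ * c₃ ^ a₃ * c₄ ^ a₄ * c₅ ^ a₅ := by
    have g1 := key p2 h12 a₁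
    have g2 := key p3 h23 a₂
    have g3 := key p4 h34 a₃
    have g4 := key p5 h45 a₄
    have g5 : 1 ≤ c₅ ^ a₅ := one_le_pow₀ h5
    calc c₂ ^ a₁ * c₃ ^ a₂ * c₄ ^ a₃ * c₅ ^ a₄
        ≤ c₁ ^ a₁ * c₂ ^ a₂ * c₃ ^ a₃ * c₄ ^ a₄ := by gcongr
      _ ≤ _ := le_mul_of_one_le_right (by positivity) g5
  calc c₁ ^ s₁ * c₂ ^ s₂ * c₃ ^ s₃ * c₄ ^ s₄ * c₅ ^ s₅ *
        (c₂ ^ a₁ * c₃ ^ a₂ * c₄ ^ a₃ * c₅ ^ a₄)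
      ≤ c₁ ^ s₁ * c₂ ^ s₂ * c₃ ^ s₃ * c₄ ^ s₄ * c₅ ^ s₅ *
        (c₁ ^ a₁ * c₂ ^ a₂ * c₃ ^ a₃ * c₄ ^ a₄ * c₅ ^ a₅) := by gcongr
    _ = c₁ ^ (s₁ + a₁) * (c₂ ^ s₂ * c₂ ^ a₂) * (c₃ ^ s₃ * c₃ ^ a₃) * (c₄ ^ s₄ * c₄ ^ a₄) *
        (c₅ ^ s₅ * c₅ ^ a₅) := by ring
    _ = _ := by rw [← f2, ← f3, ← f4, ← f5]; ring

/-- `64 ^ ω(M)` is at most `M`, up to the contribution of the primes below `64`. -/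
theorem pow_card_primeFactors_mul_le {M : ℕ} (hM : M ≠ 0) :
    64 ^ M.primeFactors.card * ∏ p ∈ M.primeFactors with p < 64, p ≤
      M * 64 ^ (M.primeFactors.filter (· < 64)).card := by
  have h1 : 64 ^ (M.primeFactors.filter (¬ · < 64)).card ≤
      ∏ p ∈ M.primeFactors with ¬ p < 64, p := by
    refine Finset.pow_card_le_prod _ _ _ fun p hp => ?_
    exact not_lt.mp (Finset.mem_filter.mp hp).2
  have h2 := Finset.prod_filter_mul_prod_filter_not M.primeFactors (· < 64) fun p => p
  have h3 := Nat.le_of_dvd (Nat.pos_of_ne_zero hM) (Nat.prod_primeFactors_dvd M)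
  rw [← Finset.card_filter_add_card_filter_not (s := M.primeFactors) (· < 64), pow_add]
  calc _ = 64 ^ (M.primeFactors.filter (· < 64)).card *
        (64 ^ (M.primeFactors.filter (¬ · < 64)).card *
          ∏ p ∈ M.primeFactors with p < 64, p) := by ring
    _ ≤ 64 ^ (M.primeFactors.filter (· < 64)).card *
        ((∏ p ∈ M.primeFactors with ¬ p < 64, p) *
          ∏ p ∈ M.primeFactors with p < 64, p) := by gcongr
    _ ≤ 64 ^ (M.primeFactors.filter (· < 64)).card * M := by
        rw [mul_comm (∏ p ∈ M.primeFactors with ¬ p < 64, p), h2]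
        gcongr
    _ = _ := mul_comm _ _

/-- Numerical criterion for the existence of primitive `k`-normal elements. The numbers `uⱼ / 1000`
bound the `j`-th roots of the sixth powers of the sieve weights of factors of degree `j`, and `tⱼ`
bounds the total degree of the factors of degree at most `j`. -/
theorem exists_primitive_isKNormal_of_bounds {K : Type*} [Field K] [Fintype K]
    {E : Type*} [Field E] [Fintype E] [Algebra K E] {q n : ℕ} (hq : Fintype.card K = q)
    (hn : Module.finrank K E = n) {f g : K[X]} (hfg : f * g = X ^ n - 1) (hf : f.natDegree = 2)
    (hn3 : 3 ≤ n)
    {u₁ u₂ u₃ u₄ u₅ : ℕ} (h12 : u₂ ≤ u₁) (h23 : u₃ ≤ u₂) (h34 : u₄ ≤ u₃) (h45 : u₅ ≤ u₄)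
    (h5 : 1000 ≤ u₅)
    (hl1 : (2 * q) ^ 6 * 1000 ≤ u₁ * (q - 1) ^ 6)
    (hl2 : (2 * q ^ 2) ^ 6 * 1000 ^ 2 ≤ u₂ ^ 2 * (q ^ 2 - 1) ^ 6)
    (hl3 : (2 * q ^ 3) ^ 6 * 1000 ^ 3 ≤ u₃ ^ 3 * (q ^ 3 - 1) ^ 6)
    (hl4 : (2 * q ^ 4) ^ 6 * 1000 ^ 4 ≤ u₄ ^ 4 * (q ^ 4 - 1) ^ 6)
    (hl5 : (2 * q ^ 5) ^ 6 * 1000 ^ 5 ≤ u₅ ^ 5 * (q ^ 5 - 1) ^ 6)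
    {t₁ t₂ t₃ t₄ : ℕ} (ht12 : t₁ ≤ t₂) (ht23 : t₂ ≤ t₃) (ht34 : t₃ ≤ t₄) (ht4 : t₄ ≤ n)
    (ht1 : Nat.gcd n (q - 1) ≤ t₁) (ht2 : Nat.gcd n (q ^ 2 - 1) ≤ t₂)
    (ht3 : min n (t₂ + (Nat.gcd n (q ^ 3 - 1) - Nat.gcd n (q - 1))) ≤ t₃)
    (ht4' : min n (t₃ + (Nat.gcd n (q ^ 4 - 1) - Nat.gcd n (q ^ 2 - 1))) ≤ t₄)
    (hmain : u₁ ^ t₁ * u₂ ^ (t₂ - t₁) * u₃ ^ (t₃ - t₂) * u₄ ^ (t₄ - t₃) * u₅ ^ (n - t₄) *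
      64 ^ ((q ^ n - 1).primeFactors.filter (· < 64)).card * q ^ 12 ≤
        q ^ (2 * n) * 1000 ^ n * ∏ p ∈ (q ^ n - 1).primeFactors with p < 64, p) :
    ∃ α : E, IsPrimitiveElem α ∧ IsKNormal q n 2 α := by
  classical
  have hq1 : 1 < q := hq ▸ Fintype.one_lt_card
  have hcardE : Fintype.card E = q ^ n := by rw [Module.card_eq_pow_finrank (K := K), hq, hn]
  have hne : (X ^ n - 1 : K[X]) ≠ 0 := (monic_X_pow_sub_C 1 (by omega)).ne_zero
  have hf0 : f ≠ 0 := by rintro rfl; exact hne (by rw [← hfg, zero_mul])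
  have hg0 : g ≠ 0 := by rintro rfl; exact hne (by rw [← hfg, mul_zero])
  have hdeg : g.natDegree = n - 2 := by
    have h : f.natDegree + g.natDegree = n := by
      rw [← natDegree_mul hf0 hg0, hfg]; exact natDegree_X_pow_sub_C
    omega
  let H : Finset K[X] := (UniqueFactorizationMonoid.normalizedFactors g).toFinset
  have hH : ∀ h, h ∈ H ↔ Monic h ∧ Irreducible h ∧ h ∣ g := by
    intro h
    rw [Multiset.mem_toFinset, UniqueFactorizationMonoid.mem_normalizedFactors_iff' hg0]
    constructor
    · rintro ⟨h1, h2, h3⟩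
      exact ⟨(normalize_eq_self_iff_monic h1.ne_zero).mp h2, h1, h3⟩
    · rintro ⟨h1, h2, h3⟩
      exact ⟨h2, h1.normalize_eq_self, h3⟩
  have hH' : ∀ h ∈ H, Monic h ∧ Irreducible h ∧ h ∣ X ^ n - 1 := fun h hh =>
    ⟨((hH h).mp hh).1, ((hH h).mp hh).2.1,
      ((hH h).mp hh).2.2.trans ⟨f, by rw [mul_comm, hfg]⟩⟩
  have hqR : (1 : ℝ) < q := by exact_mod_cast hq1
  have hlam : ∀ d : ℕ, 0 < d → (0 : ℝ) < 1 - ((q : ℝ) ^ d)⁻¹ := by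
    intro d hd
    rw [sub_pos]
    exact inv_lt_one_of_one_lt₀ (one_lt_pow₀ hqR hd.ne')
  set c₁ : ℝ := u₁ / 1000 with hc1
  set c₂ : ℝ := u₂ / 1000 with hc2
  set c₃ : ℝ := u₃ / 1000 with hc3
  set c₄ : ℝ := u₄ / 1000 with hc4
  set c₅ : ℝ := u₅ / 1000 with hc5
  have hl : ∀ (j u : ℕ), 0 < j → (2 * q ^ j) ^ 6 * 1000 ^ j ≤ u ^ j * (q ^ j - 1) ^ 6 →
      (2 / (1 - ((q : ℝ) ^ j)⁻¹)) ^ 6 ≤ ((u : ℝ) / 1000) ^ j := by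
    intro j u hj h
    have h1 : (1 : ℝ) < (q : ℝ) ^ j := one_lt_pow₀ hqR hj.ne'
    have h2 : (2 / (1 - ((q : ℝ) ^ j)⁻¹)) = (2 * (q : ℝ) ^ j) / ((q : ℝ) ^ j - 1) := by
      have : (q : ℝ) ^ j - 1 ≠ 0 := by linarith
      field_simp
    rw [h2, div_pow, div_pow, div_le_div_iff₀ (pow_pos (by linarith) _) (by positivity)]
    have h3 : (((q ^ j - 1 : ℕ) : ℝ)) = (q : ℝ) ^ j - 1 := by
      rw [Nat.cast_sub (Nat.one_le_pow _ _ (by omega))]; push_cast; rfl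
    rw [← h3]
    exact_mod_cast h
  have hc51 : 1 ≤ c₅ := by
    rw [hc5, le_div_iff₀ (by norm_num)]; rw [one_mul]; exact_mod_cast h5
  let w : ℕ → K[X] → ℕ := fun j h => if h.natDegree = j then h.natDegree else 0
  let w₅ : K[X] → ℕ := fun h => if 5 ≤ h.natDegree then h.natDegree else 0
  have hpoint : ∀ h ∈ H, (2 / (1 - ((q : ℝ) ^ h.natDegree)⁻¹)) ^ 6 ≤
      c₁ ^ w 1 h * c₂ ^ w 2 h * c₃ ^ w 3 h * c₄ ^ w 4 h * c₅ ^ w₅ h := by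
    intro h hh
    have hd : 0 < h.natDegree := (hH' h hh).2.1.natDegree_pos
    rcases (by omega : h.natDegree = 1 ∨ h.natDegree = 2 ∨ h.natDegree = 3 ∨ h.natDegree = 4 ∨
      5 ≤ h.natDegree) with e | e | e | e | e
    · simpa [w, w₅, e] using hl 1 u₁ one_pos (by simpa using hl1)
    · simpa [w, w₅, e] using hl 2 u₂ two_pos hl2
    · simpa [w, w₅, e] using hl 3 u₃ three_pos hl3
    · simpa [w, w₅, e] using hl 4 u₄ four_pos hl4
    · have e1 : h.natDegree ≠ 1 := by omega
      have e2 : h.natDegree ≠ 2 := by omega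
      have e3 : h.natDegree ≠ 3 := by omega
      have e4 : h.natDegree ≠ 4 := by omega
      simp only [w, w₅, e, e1, e2, e3, e4, if_true, if_false, pow_zero, one_mul]
      refine le_trans ?_ ((hl 5 u₅ (by norm_num) hl5).trans (pow_le_pow_right₀ hc51 e))
      have p5 := hlam 5 (by norm_num)
      have pd := hlam _ hd
      gcongr
      exact hqR.le
  have hΛ : (∏ h ∈ H, (2 / (1 - ((q : ℝ) ^ h.natDegree)⁻¹))) ^ 6 ≤
      c₁ ^ t₁ * c₂ ^ (t₂ - t₁) * c₃ ^ (t₃ - t₂) * c₄ ^ (t₄ - t₃) * c₅ ^ (n - t₄) := by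
    rw [← Finset.prod_pow]
    refine (Finset.prod_le_prod (fun h _ => by positivity) hpoint).trans ?_
    simp only [Finset.prod_mul_distrib, Finset.prod_pow_eq_pow_sum]
    have hw : ∀ j, ∑ h ∈ H, w j h = degreeMass H j := fun j => (Finset.sum_filter _ _).symm
    have htot : ∑ h ∈ H, w 1 h + ∑ h ∈ H, w 2 h + ∑ h ∈ H, w 3 h + ∑ h ∈ H, w 4 h +
        ∑ h ∈ H, w₅ h = ∑ h ∈ H, h.natDegree := by
      simp only [← Finset.sum_add_distrib]
      refine Finset.sum_congr rfl fun h hh => ?_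
      have hd : 0 < h.natDegree := (hH' h hh).2.1.natDegree_pos
      simp only [w, w₅]
      split_ifs <;> omega
    have hle := sum_natDegree_le (by omega) H hH'
    have m1 := degreeMass_one_le (by omega) H hH'
    have m2 := degreeMass_add_le (by omega) H hH' (d := 2) (e := 1) (by norm_num) (by norm_num)
      (by norm_num)
    have m3 := degreeMass_add_le (by omega) H hH' (d := 3) (e := 1) (by norm_num) (by norm_num)
      (by norm_num)
    have m4 := degreeMass_add_le (by omega) H hH' (d := 4) (e := 2) (by norm_num) (by norm_num)
      (by norm_num)
    rw [hq] at m1 m2 m3 m4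
    rw [pow_one] at m2 m3
    rw [← hw] at m1 m2 m3 m4
    have cast : ∀ {a b : ℕ}, a ≤ b → (a : ℝ) / 1000 ≤ (b : ℝ) / 1000 := fun h => by
      gcongr
    exact prod_pow_le_of_partial_sums (cast h12) (cast h23) (cast h34) (cast h45) hc51 ht12 ht23
      ht34 ht4 (by omega) (by omega) (by omega) (by omega) (by omega)
  subst hn
  have hmain' := exists_primitive_isKNormal_of_lt hfg (by omega) H hH (E := E)
  rw [hf, hq] at hmain'
  refine hmain' ?_
  rw [hcardE, hdeg]
  set n := Module.finrank K E with hn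
  set M := q ^ n - 1 with hM
  have hMpos : 0 < M := Nat.sub_pos_of_lt (Nat.one_lt_pow (by omega) hq1)
  have hprod : ∏ h ∈ H, (2 / (1 - ((q : ℝ) ^ h.natDegree)⁻¹)) =
      2 ^ H.card / ∏ h ∈ H, (1 - ((q : ℝ) ^ h.natDegree)⁻¹) := by
    rw [Finset.prod_div_distrib, Finset.prod_const]
  have hPr : 0 < ∏ h ∈ H, (1 - ((q : ℝ) ^ h.natDegree)⁻¹) :=
    Finset.prod_pos fun h hh => hlam _ (hH' h hh).2.1.natDegree_pos
  rw [← div_lt_iff₀ hPr, mul_div_assoc, mul_div_right_comm, ← hprod]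
  set Λ := ∏ h ∈ H, (2 / (1 - ((q : ℝ) ^ h.natDegree)⁻¹)) with hΛdef
  refine lt_of_pow_lt_pow_left₀ 6 (by positivity) ?_
  set ω := M.primeFactors.card with hω
  set k := (M.primeFactors.filter (· < 64)).card with hk
  set P := ∏ p ∈ M.primeFactors with p < 64, p with hP
  have hPpos : 0 < P := Finset.prod_pos fun p hp =>
    (Nat.prime_of_mem_primeFactors (Finset.mem_filter.mp hp).1).pos
  have hωR : (64 : ℝ) ^ ω * P ≤ M * 64 ^ k := by
    exact_mod_cast pow_card_primeFactors_mul_le hMpos.ne'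
  have hsqrt : √((q ^ n : ℕ) : ℝ) ^ 6 = ((q : ℝ) ^ n) ^ 3 := by
    rw [show 6 = 2 * 3 by norm_num, pow_mul, Real.sq_sqrt (by positivity)]; push_cast; rfl
  have hc : c₁ ^ t₁ * c₂ ^ (t₂ - t₁) * c₃ ^ (t₃ - t₂) * c₄ ^ (t₄ - t₃) * c₅ ^ (n - t₄) *
      1000 ^ n = (u₁ : ℝ) ^ t₁ * u₂ ^ (t₂ - t₁) * u₃ ^ (t₃ - t₂) * u₄ ^ (t₄ - t₃) *
        u₅ ^ (n - t₄) := by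
    have : (1000 : ℝ) ^ n = 1000 ^ t₁ * 1000 ^ (t₂ - t₁) * 1000 ^ (t₃ - t₂) *
        1000 ^ (t₄ - t₃) * 1000 ^ (n - t₄) := by
      simp only [← pow_add]; congr 1; omega
    rw [this, hc1, hc2, hc3, hc4, hc5]
    simp only [div_pow]
    field_simp
  have hmainR : (u₁ : ℝ) ^ t₁ * u₂ ^ (t₂ - t₁) * u₃ ^ (t₃ - t₂) * u₄ ^ (t₄ - t₃) *
      u₅ ^ (n - t₄) * 64 ^ k * q ^ 12 ≤ (q : ℝ) ^ (2 * n) * 1000 ^ n * P := by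
    exact_mod_cast hmain
  rw [← hc] at hmainR
  have hMlt : (M : ℝ) < (q : ℝ) ^ n := by
    have : M < q ^ n := Nat.sub_lt (by positivity) one_pos
    exact_mod_cast this
  have hPR : (0 : ℝ) < P := by exact_mod_cast hPpos
  have hΛ6 : Λ ^ 6 * 64 ^ k * q ^ 12 ≤ (q : ℝ) ^ (2 * n) * P := by
    refine le_of_mul_le_mul_right ?_ (show (0 : ℝ) < 1000 ^ n by positivity)
    calc Λ ^ 6 * 64 ^ k * q ^ 12 * 1000 ^ n ≤ (c₁ ^ t₁ * c₂ ^ (t₂ - t₁) * c₃ ^ (t₃ - t₂) *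
          c₄ ^ (t₄ - t₃) * c₅ ^ (n - t₄)) * 64 ^ k * q ^ 12 * 1000 ^ n := by gcongr
      _ = c₁ ^ t₁ * c₂ ^ (t₂ - t₁) * c₃ ^ (t₃ - t₂) *
          c₄ ^ (t₄ - t₃) * c₅ ^ (n - t₄) * 1000 ^ n * 64 ^ k * q ^ 12 := by ring
      _ ≤ _ := hmainR
      _ = _ := by ring
  have hΛpos : 0 < Λ := Finset.prod_pos fun h hh =>
    div_pos two_pos (hlam _ (hH' h hh).2.1.natDegree_pos)
  have hn2 : (q : ℝ) ^ (n - 2) * q ^ 2 = q ^ n := by rw [← pow_add]; congr 1; omega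
  have hω64 : ((2 : ℝ) ^ ω) ^ 6 = 64 ^ ω := by rw [← pow_mul, mul_comm, pow_mul]; norm_num
  refine lt_of_mul_lt_mul_right ?_ (show (0 : ℝ) ≤ P * q ^ 12 by positivity)
  rw [mul_pow, mul_pow, hω64, hsqrt]
  calc (64 : ℝ) ^ ω * (Λ ^ 6 * ((q : ℝ) ^ n) ^ 3) * (P * q ^ 12)
      = (64 ^ ω * P) * (Λ ^ 6 * ((q : ℝ) ^ n) ^ 3 * q ^ 12) := by ring
    _ ≤ (M * 64 ^ k) * (Λ ^ 6 * ((q : ℝ) ^ n) ^ 3 * q ^ 12) := by gcongr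
    _ = M * (Λ ^ 6 * 64 ^ k * q ^ 12) * ((q : ℝ) ^ n) ^ 3 := by ring
    _ ≤ M * ((q : ℝ) ^ (2 * n) * P) * ((q : ℝ) ^ n) ^ 3 := by gcongr
    _ < (q : ℝ) ^ n * ((q : ℝ) ^ (2 * n) * P) * ((q : ℝ) ^ n) ^ 3 := by gcongr
    _ = ((q : ℝ) ^ (n - 2)) ^ 6 * (P * q ^ 12) := by
      have : ((q : ℝ) ^ (n - 2)) ^ 6 * q ^ 12 = (q ^ n) ^ 6 := by rw [← hn2]; ring
      have h2 : (q : ℝ) ^ (2 * n) = (q ^ n) ^ 2 := pow_mul' _ _ _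
      rw [h2]
      linear_combination (-(P : ℝ)) * this

section DegreeTwoDivisors

variable {K : Type*} [Field K] [Fintype K]

theorem exists_natDegree_two_mul_eq {q n : ℕ} (hq : Fintype.card K = q) (hn : n ≠ 0)
    (h : Nat.gcd (q ^ 3 - q) n ≠ 1) :
    ∃ f g : K[X], f * g = X ^ n - 1 ∧ f.natDegree = 2 := by
  obtain ⟨r, hr, hrd⟩ := Nat.exists_prime_and_dvd h
  obtain ⟨hr1, hr2⟩ := Nat.dvd_gcd_iff.mp hrd
  have hfac : (X - 1 : K[X]) * ∑ i ∈ Finset.range r, X ^ i = X ^ r - 1 := mul_geom_sum _ _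
  have hX1 : (X - 1 : K[X]) = X - C 1 := by simp
  have key : ∃ h : K[X], Irreducible h ∧ h ∣ ∑ i ∈ Finset.range r, X ^ i ∧ h.natDegree ∣ 2 := by
    have hq3 : q ^ 3 - q = q * (q ^ 2 - 1) := by rw [Nat.mul_sub, mul_one, pow_succ']
    rw [hq3, hr.dvd_mul] at hr1
    rcases hr1 with hrq | hrq
    · refine ⟨X - C 1, irreducible_X_sub_C 1, ?_, by rw [natDegree_X_sub_C]; exact one_dvd 2⟩
      rw [dvd_iff_isRoot, IsRoot, eval_finsetSum]
      have hchar : (q : K) = 0 := by rw [← hq]; exact Nat.cast_card_eq_zero K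
      obtain ⟨p, hp⟩ := CharP.exists K
      have hpp : p.Prime := CharP.char_is_prime K p
      have hpr : p = r := by
        obtain ⟨m, _, hm⟩ := FiniteField.card K p
        rw [← hq, hm] at hrq
        exact ((Nat.prime_dvd_prime_iff_eq hr hpp).mp (hr.dvd_of_dvd_pow hrq)).symm
      subst hpr
      simp
    · have hdeg : (∑ i ∈ Finset.range r, (X : K[X]) ^ i).natDegree ≠ 0 := by
        intro h0
        have h1 := congrArg natDegree hfac
        have hne : (X ^ r - 1 : K[X]) ≠ 0 := (monic_X_pow_sub_C 1 hr.ne_zero).ne_zero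
        rw [natDegree_mul (left_ne_zero_of_mul (hfac ▸ hne)) (right_ne_zero_of_mul (hfac ▸ hne)),
          h0, hX1, natDegree_X_sub_C, ← C_1, natDegree_X_pow_sub_C] at h1
        exact hr.one_lt.ne h1
      obtain ⟨h, hirr, hdvd⟩ := exists_irreducible_of_natDegree_ne_zero hdeg
      refine ⟨h, hirr, hdvd, ?_⟩
      apply natDegree_dvd_of_dvd_X_pow_gcd_card_sub_one hirr (n := r)
      rw [hq, Nat.gcd_eq_left hrq, ← hfac]
      exact hdvd.mul_left _
  obtain ⟨h, hirr, hdvd, h2⟩ := key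
  have hrn : (X ^ r - 1 : K[X]) ∣ X ^ n - 1 := by
    obtain ⟨c, rfl⟩ := hr2
    rw [pow_mul]
    exact sub_one_dvd_pow_sub_one _ _
  rcases (Nat.dvd_prime Nat.prime_two).mp h2 with h1 | h2
  · obtain ⟨g, hg⟩ := (mul_dvd_mul_left (X - 1 : K[X]) hdvd).trans (hfac ▸ hrn)
    refine ⟨_, g, hg.symm, ?_⟩
    rw [natDegree_mul (hX1 ▸ X_sub_C_ne_zero 1) hirr.ne_zero, h1, hX1, natDegree_X_sub_C]
  · obtain ⟨g, hg⟩ := (hdvd.trans (Dvd.intro_left _ hfac)).trans hrn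
    exact ⟨h, g, hg.symm, h2⟩

theorem gcd_ne_one_of_natDegree_two_dvd {q n : ℕ} (hq : Fintype.card K = q) (hn : n ≠ 0)
    {P : K[X]} (hP : P.natDegree = 2) (hdvd : P ∣ X ^ n - 1) :
    Nat.gcd (q ^ 3 - q) n ≠ 1 := by
  intro hgcd
  have hq3 : q ^ 3 - q = q * (q ^ 2 - 1) := by rw [Nat.mul_sub, mul_one, pow_succ']
  rw [hq3, ← Nat.coprime_iff_gcd_eq_one, Nat.coprime_mul_iff_left] at hgcd
  obtain ⟨hg1, hg2⟩ := hgcd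
  have hn0 : (n : K) ≠ 0 := by
    obtain ⟨p, hp⟩ := CharP.exists K
    have hpp : p.Prime := CharP.char_is_prime K p
    obtain ⟨m, _, hm⟩ := FiniteField.card K p
    rw [Ne, CharP.cast_eq_zero_iff K p]
    intro hpn
    have : p ∣ q := by rw [← hq, hm]; exact dvd_pow_self _ m.2.ne'
    exact Nat.not_coprime_of_dvd_of_dvd hpp.one_lt this hpn hg1
  have hsf : Squarefree (X ^ n - 1 : K[X]) := (X_pow_sub_one_separable_iff.mpr hn0).squarefree
  have hlin : ∀ h : K[X], Irreducible h → h.natDegree ∣ 2 → h ∣ P → h ∣ X - C 1 := by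
    intro h hirr hd hhP
    have := dvd_X_pow_gcd_card_sub_one hirr hn hd (hhP.trans hdvd)
    rwa [hq, Nat.gcd_comm, hg2, pow_one, ← C_1] at this
  have hdegle : ∀ h : K[X], Irreducible h → h.natDegree ∣ 2 → h ∣ P → h.natDegree = 1 := by
    intro h hirr hd hhP
    have := natDegree_le_of_dvd (hlin h hirr hd hhP) (X_sub_C_ne_zero 1)
    rw [natDegree_X_sub_C] at this
    have := hirr.natDegree_pos
    omega
  have hP0 : P ≠ 0 := by rintro rfl; simp at hP
  obtain ⟨h, hirr, c, rfl⟩ := exists_irreducible_of_natDegree_ne_zero (f := P) (by omega)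
  have hc0 : c ≠ 0 := right_ne_zero_of_mul hP0
  rw [natDegree_mul hirr.ne_zero hc0] at hP
  have hpos := hirr.natDegree_pos
  have h2 : h.natDegree ∣ 2 := by
    obtain h' | h' : h.natDegree = 1 ∨ h.natDegree = 2 := by omega
    · simp [h']
    · simp [h']
  have h1 := hdegle h hirr h2 (dvd_mul_right _ _)
  have hc1 : c.natDegree = 1 := by omega
  have hcirr : Irreducible c := irreducible_of_degree_eq_one
    ((degree_eq_iff_natDegree_eq_of_pos one_pos).mpr hc1)
  have hass : Associated h c :=
    ((hirr.associated_of_dvd (irreducible_X_sub_C 1) (hlin h hirr h2 (dvd_mul_right _ _))).trans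
      (hcirr.associated_of_dvd (irreducible_X_sub_C 1)
        (hlin c hcirr (by simp [hc1]) (dvd_mul_left _ _))).symm)
  exact hirr.not_isUnit (hsf h ((mul_dvd_mul_left h hass.dvd).trans hdvd))

end DegreeTwoDivisors

/-- A finite field of cardinality `q ^ n`, with `q` a prime power, is an extension of degree `n`
of a field with `q` elements. -/
theorem exists_subfield_card_eq {E : Type*} [Field E] [Fintype E] {q n : ℕ} (hq : IsPrimePow q)
    (hE : Fintype.card E = q ^ n) :
    ∃ (K : Type) (_ : Field K) (_ : Fintype K) (_ : Algebra K E),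
      Fintype.card K = q ∧ Module.finrank K E = n := by
  obtain ⟨p, m, hp, hm, rfl⟩ := hq
  rw [← Nat.prime_iff] at hp
  have : Fact p.Prime := ⟨hp⟩
  have hchar : CharP E p := by
    obtain ⟨p', hp'⟩ := CharP.exists E
    have hpp : p'.Prime := CharP.char_is_prime E p'
    obtain ⟨k, _, hk⟩ := FiniteField.card E p'
    have : p' ∣ (p ^ m) ^ n := by rw [← hE, hk]; exact dvd_pow_self _ k.2.ne'
    have := (Nat.prime_dvd_prime_iff_eq hpp hp).mp (hpp.dvd_of_dvd_pow (hpp.dvd_of_dvd_pow this))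
    exact this ▸ hp'
  let : Algebra (ZMod p) E := ZMod.algebra E p
  have hfr : Module.finrank (ZMod p) E = m * n := by
    have h := Module.card_eq_pow_finrank (K := ZMod p) (V := E)
    rw [hE, ZMod.card, ← pow_mul] at h
    exact (Nat.pow_right_injective hp.two_le h).symm
  have hdvd : Module.finrank (ZMod p) (GaloisField p m) ∣ Module.finrank (ZMod p) E := by
    rw [GaloisField.finrank p hm.ne', hfr]
    exact dvd_mul_right _ _
  obtain ⟨φ⟩ := FiniteField.nonempty_algHom_of_finrank_dvd hdvd
  let : Fintype (GaloisField p m) := Fintype.ofFinite _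
  let : Algebra (GaloisField p m) E := φ.toRingHom.toAlgebra
  have hcard : Fintype.card (GaloisField p m) = p ^ m := by
    rw [← Nat.card_eq_fintype_card, GaloisField.card p m hm.ne']
  refine ⟨GaloisField p m, inferInstance, inferInstance, inferInstance, hcard, ?_⟩
  have h := Module.card_eq_pow_finrank (K := GaloisField p m) (V := E)
  rw [hE, hcard] at h
  exact (Nat.pow_right_injective (hp.two_le.trans (Nat.le_self_pow hm.ne' p)) h).symm

section NumericalCriterion

/-- The primes below `64`. -/
def primesBelow64 : List ℕ := [2, 3, 5, 7, 11, 13, 17, 19, 23, 29, 31, 37, 41, 43, 47, 53, 59, 61]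

theorem primeFactors_filter_lt_64 {M : ℕ} (hM : M ≠ 0) :
    (M.primeFactors.filter (· < 64)) = (primesBelow64.filter (· ∣ M)).toFinset := by
  have h : ∀ p < 64, p.Prime ↔ p ∈ primesBelow64 := by decide +kernel
  have h' : ∀ p ∈ primesBelow64, p < 64 := by decide
  ext p
  simp only [Finset.mem_filter, Nat.mem_primeFactors, List.mem_toFinset, List.mem_filter,
    decide_eq_true_eq]
  constructor
  · rintro ⟨⟨h1, h2, -⟩, h3⟩
    exact ⟨(h p h3).mp h1, h2⟩
  · rintro ⟨h1, h2⟩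
    exact ⟨⟨(h p (h' p h1)).mpr h1, h2, hM⟩, h' p h1⟩

theorem nodup_primesBelow64_filter (M : ℕ) : (primesBelow64.filter (· ∣ M)).Nodup :=
  List.Nodup.filter _ (by decide)

theorem card_primeFactors_filter_lt_64 {M : ℕ} (hM : M ≠ 0) :
    (M.primeFactors.filter (· < 64)).card = (primesBelow64.filter (· ∣ M)).length := by
  rw [primeFactors_filter_lt_64 hM, List.toFinset_card_of_nodup (nodup_primesBelow64_filter M)]

theorem prod_primeFactors_filter_lt_64 {M : ℕ} (hM : M ≠ 0) :
    (∏ p ∈ M.primeFactors with p < 64, p) = (primesBelow64.filter (· ∣ M)).prod := by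
  rw [primeFactors_filter_lt_64 hM, List.prod_toFinset _ (nodup_primesBelow64_filter M),
    List.map_id']

theorem pow_length_filter_mul_prod_le (l : List ℕ) (hl : ∀ p ∈ l, p ≤ 64) (P : ℕ → Bool) :
    64 ^ (l.filter P).length * l.prod ≤ 64 ^ l.length * (l.filter P).prod := by
  induction l with
  | nil => simp
  | cons a l ih =>
    have ih := ih fun p hp => hl p (List.mem_cons_of_mem _ hp)
    have ha := hl a List.mem_cons_self
    by_cases h : P a
    · rw [List.filter_cons_of_pos h]
      simp only [List.length_cons, List.prod_cons, pow_succ]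
      calc _ = (64 ^ (l.filter P).length * l.prod) * (64 * a) := by ring
        _ ≤ (64 ^ l.length * (l.filter P).prod) * (64 * a) := by gcongr
        _ = _ := by ring
    · rw [List.filter_cons_of_neg h]
      simp only [List.length_cons, List.prod_cons, pow_succ]
      calc _ = (64 ^ (l.filter P).length * l.prod) * a := by ring
        _ ≤ (64 ^ l.length * (l.filter P).prod) * 64 := by gcongr
        _ = _ := by ring

theorem pow_card_primeFactors_filter_mul_le {M : ℕ} (hM : M ≠ 0) :
    64 ^ (M.primeFactors.filter (· < 64)).card * primesBelow64.prod ≤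
      64 ^ 18 * ∏ p ∈ M.primeFactors with p < 64, p := by
  rw [card_primeFactors_filter_lt_64 hM, prod_primeFactors_filter_lt_64 hM]
  exact pow_length_filter_mul_prod_le primesBelow64 (by decide) _

/-- The conditions on the weights `uⱼ` required by the numerical criterion. -/
def weightCheck (q u₁ u₂ u₃ u₄ u₅ : ℕ) : Bool :=
  decide (u₂ ≤ u₁) && decide (u₃ ≤ u₂) && decide (u₄ ≤ u₃) && decide (u₅ ≤ u₄) &&
  decide (1000 ≤ u₅) &&
  decide ((2 * q) ^ 6 * 1000 ≤ u₁ * (q - 1) ^ 6) &&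
  decide ((2 * q ^ 2) ^ 6 * 1000 ^ 2 ≤ u₂ ^ 2 * (q ^ 2 - 1) ^ 6) &&
  decide ((2 * q ^ 3) ^ 6 * 1000 ^ 3 ≤ u₃ ^ 3 * (q ^ 3 - 1) ^ 6) &&
  decide ((2 * q ^ 4) ^ 6 * 1000 ^ 4 ≤ u₄ ^ 4 * (q ^ 4 - 1) ^ 6) &&
  decide ((2 * q ^ 5) ^ 6 * 1000 ^ 5 ≤ u₅ ^ 5 * (q ^ 5 - 1) ^ 6)

/-- The main inequality of the numerical criterion, for degree bounds `tⱼ` computed from `n`. -/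
def sieveCheck (q u₁ u₂ u₃ u₄ u₅ n : ℕ) : Bool :=
  let t₁ := Nat.gcd n (q - 1)
  let t₂ := Nat.gcd n (q ^ 2 - 1)
  let t₃ := min n (t₂ + (Nat.gcd n (q ^ 3 - 1) - t₁))
  let t₄ := min n (t₃ + (Nat.gcd n (q ^ 4 - 1) - t₂))
  let s := primesBelow64.filter (· ∣ q ^ n - 1)
  decide (u₁ ^ t₁ * u₂ ^ (t₂ - t₁) * u₃ ^ (t₃ - t₂) * u₄ ^ (t₄ - t₃) * u₅ ^ (n - t₄) *
    64 ^ s.length * q ^ 12 ≤ q ^ (2 * n) * 1000 ^ n * s.prod)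

variable {E : Type*} [Field E] [Fintype E] {q n u₁ u₂ u₃ u₄ u₅ : ℕ}

theorem gcd_sub_one_le (n q : ℕ) {a b : ℕ} (hn : n ≠ 0) (h : a ∣ b) :
    Nat.gcd n (q ^ a - 1) ≤ Nat.gcd n (q ^ b - 1) :=
  Nat.le_of_dvd (Nat.gcd_pos_of_pos_left _ (Nat.pos_of_ne_zero hn))
    (Nat.gcd_dvd_gcd_of_dvd_right _ (Nat.pow_sub_one_dvd_pow_sub_one q h))

theorem exists_primitive_isKNormal_of_sieveCheck (hE : Fintype.card E = q ^ n)
    (hq : IsPrimePow q) (hn : 3 ≤ n) (hgcd : Nat.gcd (q ^ 3 - q) n ≠ 1)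
    (hw : weightCheck q u₁ u₂ u₃ u₄ u₅) (hs : sieveCheck q u₁ u₂ u₃ u₄ u₅ n) :
    ∃ α : E, IsPrimitiveElem α ∧ IsKNormal q n 2 α := by
  obtain ⟨K, _, _, _, hK, hfr⟩ := exists_subfield_card_eq hq hE
  obtain ⟨f, g, hfg, hf⟩ := exists_natDegree_two_mul_eq (K := K) hK (by omega) hgcd
  simp only [weightCheck, Bool.and_eq_true, decide_eq_true_eq] at hw
  obtain ⟨⟨⟨⟨⟨⟨⟨⟨⟨h12, h23⟩, h34⟩, h45⟩, h5⟩, hl1⟩, hl2⟩, hl3⟩, hl4⟩, hl5⟩ := hw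
  have h1 := gcd_sub_one_le n q (by omega) (one_dvd 2)
  rw [pow_one] at h1
  have hM : q ^ n - 1 ≠ 0 := by
    have := Nat.one_lt_pow (n := n) (by omega) hq.one_lt
    omega
  refine exists_primitive_isKNormal_of_bounds hK hfr hfg hf hn h12 h23 h34 h45 h5 hl1 hl2 hl3 hl4
    hl5 h1 ?_ ?_ (min_le_left _ _) le_rfl le_rfl le_rfl le_rfl ?_
  · exact le_min (Nat.gcd_le_left _ (by omega)) (Nat.le_add_right _ _)
  · exact le_min (min_le_left _ _) (Nat.le_add_right _ _)
  · rw [card_primeFactors_filter_lt_64 hM, prod_primeFactors_filter_lt_64 hM]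
    simpa only [sieveCheck, decide_eq_true_eq] using hs

theorem le_of_base_le {a b c d m n : ℕ} (hab : a ≤ b) (hmn : m ≤ n)
    (h : c * a ^ m ≤ d * b ^ m) : c * a ^ n ≤ d * b ^ n := by
  obtain ⟨k, rfl⟩ := Nat.exists_eq_add_of_le hmn
  calc c * a ^ (m + k) = (c * a ^ m) * a ^ k := by ring
    _ ≤ (d * b ^ m) * b ^ k := by gcongr
    _ = _ := by ring

theorem main_le_of_tail_le {C u t n₀ : ℕ} (hq : 1 < q) (hn : n ≠ 0) (ht : t ≤ n₀) (hn₀ : n₀ ≤ n)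
    (hu : u ≤ 1000 * q ^ 2)
    (h : C * u ^ (n₀ - t) * 64 ^ 18 * q ^ 12 ≤ primesBelow64.prod * (1000 * q ^ 2) ^ n₀) :
    C * u ^ (n - t) * 64 ^ ((q ^ n - 1).primeFactors.filter (· < 64)).card * q ^ 12 ≤
        q ^ (2 * n) * 1000 ^ n * ∏ p ∈ (q ^ n - 1).primeFactors with p < 64, p := by
  have hM : q ^ n - 1 ≠ 0 := by
    have := Nat.one_lt_pow hn hq
    omega
  have h0 : (C * 64 ^ 18 * q ^ 12) * u ^ (n - t) ≤
      (primesBelow64.prod * (1000 * q ^ 2) ^ t) * (1000 * q ^ 2) ^ (n - t) := by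
    refine le_of_base_le hu (Nat.sub_le_sub_right hn₀ t) ?_
    have : (1000 * q ^ 2) ^ n₀ = (1000 * q ^ 2) ^ t * (1000 * q ^ 2) ^ (n₀ - t) := by
      rw [← pow_add, Nat.add_sub_cancel' ht]
    rw [this] at h
    linarith
  rw [mul_assoc primesBelow64.prod, ← pow_add, Nat.add_sub_cancel' (ht.trans hn₀)] at h0
  have h1 := pow_card_primeFactors_filter_mul_le hM
  set k := ((q ^ n - 1).primeFactors.filter (· < 64)).card
  set P := ∏ p ∈ (q ^ n - 1).primeFactors with p < 64, p
  refine Nat.le_of_mul_le_mul_left (c := primesBelow64.prod * 64 ^ 18) ?_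
    (by decide +kernel : 0 < primesBelow64.prod * 64 ^ 18)
  calc primesBelow64.prod * 64 ^ 18 * (C * u ^ (n - t) * 64 ^ k * q ^ 12)
      = (C * 64 ^ 18 * q ^ 12 * u ^ (n - t)) * (64 ^ k * primesBelow64.prod) := by ring
    _ ≤ (primesBelow64.prod * (1000 * q ^ 2) ^ n) * (64 ^ 18 * P) := Nat.mul_le_mul h0 h1
    _ = _ := by rw [mul_pow, ← pow_mul]; ring

/-- The tail inequality when only the factors of degree one are treated separately. -/
def tailCheck (q u₁ u₂ n₀ : ℕ) : Bool :=
  decide (q - 1 ≤ n₀) && decide (u₂ ≤ 1000 * q ^ 2) &&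
  decide (u₁ ^ (q - 1) * u₂ ^ (n₀ - (q - 1)) * 64 ^ 18 * q ^ 12 ≤
    primesBelow64.prod * (1000 * q ^ 2) ^ n₀)

/-- The tail inequality when the factors of degree at most three are treated separately. -/
def tailCheckThree (q u₁ u₂ u₃ u₄ t₁ t₂ t₃ n₀ : ℕ) : Bool :=
  decide (q - 1 ≤ t₁) && decide (q ^ 2 - 1 ≤ t₂) && decide (t₁ ≤ t₂) && decide (t₂ ≤ t₃) &&
  decide (t₂ + (q ^ 3 - 1) ≤ t₃ + 1) && decide (t₃ ≤ n₀) && decide (u₄ ≤ 1000 * q ^ 2) &&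
  decide (u₁ ^ t₁ * u₂ ^ (t₂ - t₁) * u₃ ^ (t₃ - t₂) * u₄ ^ (n₀ - t₃) * 64 ^ 18 * q ^ 12 ≤
    primesBelow64.prod * (1000 * q ^ 2) ^ n₀)

theorem exists_primitive_isKNormal_of_tailCheck {n₀ : ℕ} (hE : Fintype.card E = q ^ n)
    (hq : IsPrimePow q) (hn : 3 ≤ n) (hgcd : Nat.gcd (q ^ 3 - q) n ≠ 1)
    (hw : weightCheck q u₁ u₂ u₂ u₂ u₂) (hs : tailCheck q u₁ u₂ n₀) (hn₀ : n₀ ≤ n) :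
    ∃ α : E, IsPrimitiveElem α ∧ IsKNormal q n 2 α := by
  obtain ⟨K, _, _, _, hK, hfr⟩ := exists_subfield_card_eq hq hE
  obtain ⟨f, g, hfg, hf⟩ := exists_natDegree_two_mul_eq (K := K) hK (by omega) hgcd
  simp only [weightCheck, tailCheck, Bool.and_eq_true, decide_eq_true_eq] at hw hs
  obtain ⟨⟨⟨⟨⟨⟨⟨⟨⟨h12, h23⟩, h34⟩, h45⟩, h5⟩, hl1⟩, hl2⟩, hl3⟩, hl4⟩, hl5⟩ := hw
  obtain ⟨⟨ht, hu⟩, hs⟩ := hs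
  refine exists_primitive_isKNormal_of_bounds hK hfr hfg hf hn h12 h23 h34 h45 h5 hl1 hl2 hl3 hl4
    hl5 (t₁ := q - 1) (t₂ := n) (t₃ := n) (t₄ := n) (ht.trans hn₀) le_rfl le_rfl le_rfl
    (Nat.gcd_le_right _ (by have := hq.one_lt; omega)) (Nat.gcd_le_left _ (by omega))
    (min_le_left _ _) (min_le_left _ _) ?_
  simpa using main_le_of_tail_le hq.one_lt (by omega) ht hn₀ hu hs

theorem exists_primitive_isKNormal_of_tailCheckThree {t₁ t₂ t₃ n₀ : ℕ}
    (hE : Fintype.card E = q ^ n)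
    (hq : IsPrimePow q) (hn : 3 ≤ n) (hgcd : Nat.gcd (q ^ 3 - q) n ≠ 1)
    (hw : weightCheck q u₁ u₂ u₃ u₄ u₄) (hs : tailCheckThree q u₁ u₂ u₃ u₄ t₁ t₂ t₃ n₀)
    (hn₀ : n₀ ≤ n) :
    ∃ α : E, IsPrimitiveElem α ∧ IsKNormal q n 2 α := by
  obtain ⟨K, _, _, _, hK, hfr⟩ := exists_subfield_card_eq hq hE
  obtain ⟨f, g, hfg, hf⟩ := exists_natDegree_two_mul_eq (K := K) hK (by omega) hgcd
  simp only [weightCheck, tailCheckThree, Bool.and_eq_true, decide_eq_true_eq] at hw hs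
  obtain ⟨⟨⟨⟨⟨⟨⟨⟨⟨h12, h23⟩, h34⟩, h45⟩, h5⟩, hl1⟩, hl2⟩, hl3⟩, hl4⟩, hl5⟩ := hw
  obtain ⟨⟨⟨⟨⟨⟨⟨ht1, ht2⟩, ht12⟩, ht23⟩, ht3⟩, ht30⟩, hu⟩, hs⟩ := hs
  have hq1 := hq.one_lt
  have hq2 : 1 < q ^ 2 := Nat.one_lt_pow (by omega) hq1
  have hq3 : 1 < q ^ 3 := Nat.one_lt_pow (by omega) hq1
  refine exists_primitive_isKNormal_of_bounds hK hfr hfg hf hn h12 h23 h34 h45 h5 hl1 hl2 hl3 hl4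
    hl5 (t₁ := t₁) (t₂ := t₂) (t₃ := t₃) (t₄ := n) ht12 ht23 (ht30.trans hn₀) le_rfl
    ((Nat.gcd_le_right _ (by omega)).trans ht1) ((Nat.gcd_le_right _ (by omega)).trans ht2)
    ((min_le_right _ _).trans ?_) (min_le_left _ _) ?_
  · have h1 : Nat.gcd n (q ^ 3 - 1) ≤ q ^ 3 - 1 := Nat.gcd_le_right _ (by omega)
    have h2 : 0 < Nat.gcd n (q - 1) := Nat.gcd_pos_of_pos_left _ (by omega)
    omega
  · simpa using main_le_of_tail_le hq.one_lt (by omega) ht30 hn₀ hu hs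


/-- The pairs `(q, n)` are exceptional if the numerical criterion does not apply to them. -/
def exceptionalDegrees : ℕ → List ℕ
  | 2 => [6, 8, 9, 10, 12, 14, 15, 16, 18, 20, 21, 22, 24, 26, 27, 28, 30, 32, 33,
      34, 36, 39, 40, 42, 45, 48, 60]
  | 3 => [6, 8, 9, 10, 12, 14, 15, 16, 18, 20, 24, 26, 32]
  | 4 => [5, 6, 8, 9, 10, 12, 14, 15, 18, 21, 30]
  | 5 => [5, 6, 8, 9, 10, 12, 14, 16, 18, 20, 24]
  | 7 => [6, 7, 8, 9, 10, 12, 15, 16, 18, 24]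
  | 8 => [6, 7, 8, 9, 10, 12, 14, 21]
  | 9 => [5, 6, 8, 9, 10, 12, 16, 20]
  | 11 => [5, 6, 8, 9, 10, 12, 15, 20]
  | 13 => [6, 7, 8, 9, 10, 12, 14, 24]
  | 16 => [5, 6, 8, 9, 10, 15]
  | 17 => [6, 8, 9, 10, 12, 16]
  | 19 => [5, 6, 8, 9, 10, 12, 18]
  | _ => []

theorem exists_primitive_isKNormal_of_interval {a b : ℕ} (hE : Fintype.card E = q ^ n)
    (hq : IsPrimePow q) (hn : 3 ≤ n) (hgcd : Nat.gcd (q ^ 3 - q) n ≠ 1)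
    (hex : n ∉ exceptionalDegrees q) (hw : weightCheck q u₁ u₂ u₃ u₄ u₅)
    (hs : ∀ n ∈ List.range' a (b - a), Nat.gcd (q ^ 3 - q) n = 1 ∨ n ∈ exceptionalDegrees q ∨
      sieveCheck q u₁ u₂ u₃ u₄ u₅ n) (ha : a ≤ n) (hb : n < b) :
    ∃ α : E, IsPrimitiveElem α ∧ IsKNormal q n 2 α := by
  have hmem : n ∈ List.range' a (b - a) := by
    rw [List.mem_range'_1]
    omega
  exact exists_primitive_isKNormal_of_sieveCheck hE hq hn hgcd hw
    (((hs n hmem).resolve_left hgcd).resolve_left hex)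

theorem exists_primitive_isKNormal_of_not_exceptional
    (hq : q ∈ ({2, 3, 4, 5, 7, 8, 9, 11, 13, 16, 17, 19} : Set ℕ)) (hn : 5 ≤ n)
    (hE : Fintype.card E = q ^ n) (hgcd : Nat.gcd (q ^ 3 - q) n ≠ 1)
    (hex : n ∉ exceptionalDegrees q) :
    ∃ α : E, IsPrimitiveElem α ∧ IsKNormal q n 2 α := by
  have hpow : ∀ {p k : ℕ}, p.Prime → k ≠ 0 → IsPrimePow (p ^ k) := fun hp hk =>
    hp.isPrimePow.pow hk
  have hn3 : 3 ≤ n := by omega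
  simp only [Set.mem_insert_iff, Set.mem_singleton_iff] at hq
  rcases hq with rfl | rfl | rfl | rfl | rfl | rfl | rfl | rfl | rfl | rfl | rfl | rfl
  · have hpp : IsPrimePow 2 := hpow (p := 2) (k := 1) (by norm_num) (by norm_num)
    rcases lt_or_ge n 176 with h | h
    · exact exists_primitive_isKNormal_of_interval (a := 5) (b := 176) (u₁ := 4096000) (u₂ := 18963)
        (u₃ := 5225) (u₄ := 3116) (u₅ := 2387) hE hpp hn3 hgcd hex (by decide +kernel)
        (by decide +kernel) hn h
    · exact exists_primitive_isKNormal_of_tailCheckThree (n₀ := 176) (t₁ := 1) (t₂ := 3)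
        (t₃ := 9) (u₁ := 4096000) (u₂ := 18963) (u₃ := 5225) (u₄ := 3116) hE hpp hn3 hgcd
        (by decide +kernel) (by decide +kernel) h
  · have hpp : IsPrimePow 3 := hpow (p := 3) (k := 1) (by norm_num) (by norm_num)
    rcases lt_or_ge n 57 with h | h
    · exact exists_primitive_isKNormal_of_interval (a := 5) (b := 57) (u₁ := 729000) (u₂ := 11391)
        (u₃ := 4314) (u₄ := 2882) (u₅ := 2309) hE hpp hn3 hgcd hex (by decide +kernel)
        (by decide +kernel) hn h
    · exact exists_primitive_isKNormal_of_tailCheckThree (n₀ := 57) (t₁ := 2) (t₂ := 8)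
        (t₃ := 33) (u₁ := 729000) (u₂ := 11391) (u₃ := 4314) (u₄ := 2882) hE hpp hn3 hgcd
        (by decide +kernel) (by decide +kernel) h
  · have hpp : IsPrimePow 4 := hpow (p := 2) (k := 2) (by norm_num) (by norm_num)
    rcases lt_or_ge n 99 with h | h
    · exact exists_primitive_isKNormal_of_interval (a := 5) (b := 99) (u₁ := 359594) (u₂ := 9710)
        (u₃ := 4128) (u₄ := 2846) (u₅ := 2301) hE hpp hn3 hgcd hex (by decide +kernel)
        (by decide +kernel) hn h
    · exact exists_primitive_isKNormal_of_tailCheck (n₀ := 99) (u₁ := 359594) (u₂ := 9710)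
        hE hpp hn3 hgcd (by decide +kernel) (by decide +kernel) h
  · have hpp : IsPrimePow 5 := hpow (p := 5) (k := 1) (by norm_num) (by norm_num)
    rcases lt_or_ge n 54 with h | h
    · exact exists_primitive_isKNormal_of_interval (a := 5) (b := 54) (u₁ := 244141) (u₂ := 9043)
        (u₃ := 4065) (u₄ := 2836) (u₅ := 2299) hE hpp hn3 hgcd hex (by decide +kernel)
        (by decide +kernel) hn h
    · exact exists_primitive_isKNormal_of_tailCheck (n₀ := 54) (u₁ := 244141) (u₂ := 9043)
        hE hpp hn3 hgcd (by decide +kernel) (by decide +kernel) h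
  · have hpp : IsPrimePow 7 := hpow (p := 7) (k := 1) (by norm_num) (by norm_num)
    rcases lt_or_ge n 36 with h | h
    · exact exists_primitive_isKNormal_of_interval (a := 5) (b := 36) (u₁ := 161385) (u₂ := 8511)
        (u₃ := 4024) (u₄ := 2831) (u₅ := 2298) hE hpp hn3 hgcd hex (by decide +kernel)
        (by decide +kernel) hn h
    · exact exists_primitive_isKNormal_of_tailCheck (n₀ := 36) (u₁ := 161385) (u₂ := 8511)
        hE hpp hn3 hgcd (by decide +kernel) (by decide +kernel) h
  · have hpp : IsPrimePow 8 := hpow (p := 2) (k := 3) (by norm_num) (by norm_num)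
    rcases lt_or_ge n 33 with h | h
    · exact exists_primitive_isKNormal_of_interval (a := 5) (b := 33) (u₁ := 142604) (u₂ := 8388)
        (u₃ := 4016) (u₄ := 2830) (u₅ := 2298) hE hpp hn3 hgcd hex (by decide +kernel)
        (by decide +kernel) hn h
    · exact exists_primitive_isKNormal_of_tailCheck (n₀ := 33) (u₁ := 142604) (u₂ := 8388)
        hE hpp hn3 hgcd (by decide +kernel) (by decide +kernel) h
  · have hpp : IsPrimePow 9 := hpow (p := 3) (k := 2) (by norm_num) (by norm_num)
    rcases lt_or_ge n 31 with h | h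
    · exact exists_primitive_isKNormal_of_interval (a := 5) (b := 31) (u₁ := 129747) (u₂ := 8304)
        (u₃ := 4011) (u₄ := 2830) (u₅ := 2298) hE hpp hn3 hgcd hex (by decide +kernel)
        (by decide +kernel) hn h
    · exact exists_primitive_isKNormal_of_tailCheck (n₀ := 31) (u₁ := 129747) (u₂ := 8304)
        hE hpp hn3 hgcd (by decide +kernel) (by decide +kernel) h
  · have hpp : IsPrimePow 11 := hpow (p := 11) (k := 1) (by norm_num) (by norm_num)
    rcases lt_or_ge n 29 with h | h
    · exact exists_primitive_isKNormal_of_interval (a := 5) (b := 29) (u₁ := 113380) (u₂ := 8202)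
        (u₃ := 4007) (u₄ := 2829) (u₅ := 2298) hE hpp hn3 hgcd hex (by decide +kernel)
        (by decide +kernel) hn h
    · exact exists_primitive_isKNormal_of_tailCheck (n₀ := 29) (u₁ := 113380) (u₂ := 8202)
        hE hpp hn3 hgcd (by decide +kernel) (by decide +kernel) h
  · have hpp : IsPrimePow 13 := hpow (p := 13) (k := 1) (by norm_num) (by norm_num)
    rcases lt_or_ge n 28 with h | h
    · exact exists_primitive_isKNormal_of_interval (a := 5) (b := 28) (u₁ := 103456) (u₂ := 8144)
        (u₃ := 4004) (u₄ := 2829) (u₅ := 2298) hE hpp hn3 hgcd hex (by decide +kernel)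
        (by decide +kernel) hn h
    · exact exists_primitive_isKNormal_of_tailCheck (n₀ := 28) (u₁ := 103456) (u₂ := 8144)
        hE hpp hn3 hgcd (by decide +kernel) (by decide +kernel) h
  · have hpp : IsPrimePow 16 := hpow (p := 2) (k := 4) (by norm_num) (by norm_num)
    rcases lt_or_ge n 27 with h | h
    · exact exists_primitive_isKNormal_of_interval (a := 5) (b := 27) (u₁ := 94266) (u₂ := 8095)
        (u₃ := 4002) (u₄ := 2829) (u₅ := 2298) hE hpp hn3 hgcd hex (by decide +kernel)
        (by decide +kernel) hn h
    · exact exists_primitive_isKNormal_of_tailCheck (n₀ := 27) (u₁ := 94266) (u₂ := 8095)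
        hE hpp hn3 hgcd (by decide +kernel) (by decide +kernel) h
  · have hpp : IsPrimePow 17 := hpow (p := 17) (k := 1) (by norm_num) (by norm_num)
    rcases lt_or_ge n 27 with h | h
    · exact exists_primitive_isKNormal_of_interval (a := 5) (b := 27) (u₁ := 92078) (u₂ := 8084)
        (u₃ := 4002) (u₄ := 2829) (u₅ := 2298) hE hpp hn3 hgcd hex (by decide +kernel)
        (by decide +kernel) hn h
    · exact exists_primitive_isKNormal_of_tailCheck (n₀ := 27) (u₁ := 92078) (u₂ := 8084)
        hE hpp hn3 hgcd (by decide +kernel) (by decide +kernel) h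
  · have hpp : IsPrimePow 19 := hpow (p := 19) (k := 1) (by norm_num) (by norm_num)
    rcases lt_or_ge n 27 with h | h
    · exact exists_primitive_isKNormal_of_interval (a := 5) (b := 27) (u₁ := 88526) (u₂ := 8067)
        (u₃ := 4002) (u₄ := 2829) (u₅ := 2298) hE hpp hn3 hgcd hex (by decide +kernel)
        (by decide +kernel) hn h
    · exact exists_primitive_isKNormal_of_tailCheck (n₀ := 27) (u₁ := 88526) (u₂ := 8067)
        hE hpp hn3 hgcd (by decide +kernel) (by decide +kernel) h

end NumericalCriterion

section PackedArithmetic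

/-- Evaluates `f a` after reducing the natural number `a` to a literal. -/
def force {β : Type*} (a : ℕ) (f : ℕ → β) : β :=
  Nat.rec (f 0) (fun k _ => f (Nat.succ k)) a

@[simp]
theorem force_eq {β : Type*} (a : ℕ) (f : ℕ → β) : force a f = f a := by
  cases a <;> rfl

/-- Evaluates `k l` after reducing the entries of the list `l` to literals. -/
def forceList {β : Type*} : List ℕ → (List ℕ → β) → β
  | [], k => k []
  | a :: l, k => force a fun a' => forceList l fun l' => k (a' :: l')

@[simp]
theorem forceList_eq {β : Type*} (l : List ℕ) (k : List ℕ → β) : forceList l k = k l := by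
  induction l generalizing k with
  | nil => rfl
  | cons a l ih => simp [forceList, ih]

/-- The base in which the coefficients of a polynomial are packed into a natural number. -/
abbrev packBase : ℕ := 2 ^ 64

/-- Packs a list of coefficients, constant coefficient first, into a natural number. -/
def pack : List ℕ → ℕ
  | [] => 0
  | d :: l => Nat.add d (Nat.mul packBase (pack l))

theorem pack_eq_ofDigits (l : List ℕ) : pack l = Nat.ofDigits packBase l := by
  induction l with
  | nil => rfl
  | cons d l ih => rw [Nat.ofDigits_cons, ← ih]; rfl

/-- Coefficientwise sum. -/
def addDigits : List ℕ → List ℕ → List ℕ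
  | [], m => m
  | l, [] => l
  | a :: l, b :: m => (a + b) :: addDigits l m

/-- Product of polynomials given by their lists of coefficients. -/
def mulDigits : List ℕ → List ℕ → List ℕ
  | [], _ => []
  | a :: l, m => addDigits (m.map (a * ·)) (0 :: mulDigits l m)

section Digits

variable {S : Type*} [CommSemiring S] (θ : S)

theorem ofDigits_nil_eq : Nat.ofDigits θ [] = 0 := rfl

theorem ofDigits_cons_eq (d : ℕ) (l : List ℕ) :
    Nat.ofDigits θ (d :: l) = d + θ * Nat.ofDigits θ l := rfl

theorem ofDigits_addDigits (l m : List ℕ) :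
    Nat.ofDigits θ (addDigits l m) = Nat.ofDigits θ l + Nat.ofDigits θ m := by
  induction l generalizing m with
  | nil => simp [addDigits, ofDigits_nil_eq]
  | cons a l ih =>
    cases m with
    | nil => simp [addDigits, ofDigits_nil_eq]
    | cons b m => simp only [addDigits, ofDigits_cons_eq, ih, Nat.cast_add]; ring

theorem ofDigits_map_mul (a : ℕ) (m : List ℕ) :
    Nat.ofDigits θ (m.map (a * ·)) = a * Nat.ofDigits θ m := by
  induction m with
  | nil => simp [ofDigits_nil_eq]
  | cons b m ih => simp only [List.map_cons, ofDigits_cons_eq, ih, Nat.cast_mul]; ring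

theorem ofDigits_mulDigits (l m : List ℕ) :
    Nat.ofDigits θ (mulDigits l m) = Nat.ofDigits θ l * Nat.ofDigits θ m := by
  induction l with
  | nil => simp [mulDigits, ofDigits_nil_eq]
  | cons a l ih =>
    simp only [mulDigits, ofDigits_addDigits, ofDigits_map_mul, ofDigits_cons_eq, ih,
      Nat.cast_zero]
    ring

theorem ofDigits_take_add_drop (l : List ℕ) (N : ℕ) :
    Nat.ofDigits θ l = Nat.ofDigits θ (l.take N) + θ ^ N * Nat.ofDigits θ (l.drop N) := by
  induction l generalizing N with
  | nil => simp [ofDigits_nil_eq]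
  | cons a l ih =>
    cases N with
    | zero => simp [ofDigits_nil_eq]
    | succ N =>
      simp only [List.take_succ_cons, List.drop_succ_cons, ofDigits_cons_eq]
      rw [ih N]
      ring

theorem ofDigits_map_add_mul (p : ℕ) (f g : ℕ → ℕ) (l : List ℕ)
    (h : ∀ d ∈ l, d = f d + p * g d) :
    Nat.ofDigits θ l = Nat.ofDigits θ (l.map f) + p * Nat.ofDigits θ (l.map g) := by
  induction l with
  | nil => simp [ofDigits_nil_eq]
  | cons d l ih =>
    simp only [List.map_cons, ofDigits_cons_eq]
    rw [ih fun d hd => h d (List.mem_cons_of_mem _ hd)]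
    have h' : (d : S) = ((f d + p * g d : ℕ) : S) := congrArg _ (h d List.mem_cons_self)
    rw [h', Nat.cast_add, Nat.cast_mul]
    ring

end Digits

theorem length_addDigits (l m : List ℕ) :
    (addDigits l m).length = max l.length m.length := by
  induction l generalizing m with
  | nil => simp [addDigits]
  | cons a l ih => cases m <;> simp [addDigits, ih]

theorem length_mulDigits_le (l m : List ℕ) :
    (mulDigits l m).length ≤ l.length + m.length := by
  induction l with
  | nil => simp [mulDigits]
  | cons a l ih =>
    simp only [mulDigits, length_addDigits, List.length_map, List.length_cons]
    omega

theorem addDigits_le {l m : List ℕ} {B C : ℕ} (hl : ∀ d ∈ l, d ≤ B) (hm : ∀ d ∈ m, d ≤ C) :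
    ∀ d ∈ addDigits l m, d ≤ B + C := by
  induction l generalizing m with
  | nil => intro d hd; exact (hm d hd).trans (Nat.le_add_left _ _)
  | cons a l ih =>
    cases m with
    | nil => intro d hd; exact (hl d hd).trans (Nat.le_add_right _ _)
    | cons b m =>
      simp only [List.forall_mem_cons] at hl hm
      simp only [addDigits, List.forall_mem_cons]
      exact ⟨Nat.add_le_add hl.1 hm.1, ih hl.2 hm.2⟩

theorem mulDigits_le {l m : List ℕ} {B : ℕ} (hm : ∀ d ∈ m, d ≤ B) :
    ∀ d ∈ mulDigits l m, d ≤ l.sum * B := by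
  induction l with
  | nil => simp [mulDigits]
  | cons a l ih =>
    rw [mulDigits, List.sum_cons, add_mul]
    refine addDigits_le ?_ ?_
    · simp only [List.mem_map]
      rintro _ ⟨d, hd, rfl⟩
      exact Nat.mul_le_mul_left _ (hm d hd)
    · simp only [List.forall_mem_cons]
      exact ⟨Nat.zero_le _, ih⟩

theorem ofDigits_eq_of_ofDigits_eq {S : Type*} [CommSemiring S] (θ : S) {b : ℕ} {l m : List ℕ}
    (hl : ∀ d ∈ l, d < b) (hm : ∀ d ∈ m, d < b)
    (h : Nat.ofDigits b l = Nat.ofDigits b m) : Nat.ofDigits θ l = Nat.ofDigits θ m := by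
  have hzero : ∀ l : List ℕ, (∀ d ∈ l, d < b) → Nat.ofDigits b l = 0 → Nat.ofDigits θ l = 0 := by
    intro l hl h
    induction l with
    | nil => exact ofDigits_nil_eq θ
    | cons d l ih =>
      simp only [List.forall_mem_cons] at hl
      rw [Nat.ofDigits_cons, Nat.add_eq_zero_iff, mul_eq_zero] at h
      rw [ofDigits_cons_eq, h.1, ih hl.2 (h.2.resolve_left (by omega))]
      simp
  induction l generalizing m with
  | nil => exact (hzero m hm (by rw [← h]; simp)).symm
  | cons d l ih =>
    cases m with
    | nil => exact hzero _ hl (by rw [h]; simp)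
    | cons e m =>
      simp only [List.forall_mem_cons] at hl hm
      simp only [Nat.ofDigits_cons] at h
      simp only [ofDigits_cons_eq]
      have hb : 0 < b := by omega
      have h1 := congrArg (· % b) h
      simp only [Nat.add_mul_mod_self_left, Nat.mod_eq_of_lt hl.1, Nat.mod_eq_of_lt hm.1] at h1
      subst h1
      rw [ih hl.2 hm.2 (Nat.eq_of_mul_eq_mul_left hb (Nat.add_left_cancel h))]

theorem land_add_two_pow_mul {k a b c d : ℕ} (ha : a < 2 ^ k) (hc : c < 2 ^ k) :
    (a + 2 ^ k * b) &&& (c + 2 ^ k * d) = (a &&& c) + 2 ^ k * (b &&& d) := by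
  have h1 := Nat.and_mod_two_pow (a := a + 2 ^ k * b) (b := c + 2 ^ k * d) (n := k)
  have h2 := Nat.and_div_two_pow (a := a + 2 ^ k * b) (b := c + 2 ^ k * d) (n := k)
  have hk : 0 < 2 ^ k := Nat.two_pow_pos k
  rw [Nat.add_mul_mod_self_left, Nat.add_mul_mod_self_left, Nat.mod_eq_of_lt ha,
    Nat.mod_eq_of_lt hc] at h1
  rw [Nat.add_mul_div_left _ _ hk, Nat.add_mul_div_left _ _ hk, Nat.div_eq_of_lt ha,
    Nat.div_eq_of_lt hc, zero_add, zero_add] at h2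
  rw [← h1, ← h2, Nat.mod_add_div]

theorem ofDigits_land_replicate {h N : ℕ} (hh : h < packBase) {l : List ℕ} (hl : l.length ≤ N)
    (hd : ∀ d ∈ l, d < packBase) :
    Nat.ofDigits packBase l &&& Nat.ofDigits packBase (List.replicate N h) =
      Nat.ofDigits packBase (l.map (· &&& h)) := by
  induction l generalizing N with
  | nil => simp
  | cons d l ih =>
    cases N with
    | zero => simp at hl
    | succ N =>
      simp only [List.forall_mem_cons] at hd
      simp only [List.replicate_succ, List.map_cons, Nat.ofDigits_cons]
      rw [land_add_two_pow_mul hd.1 hh, ih (by simpa using hl) hd.2]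

theorem land_high_half {d : ℕ} (hd : d < 2 ^ 64) :
    d &&& (2 ^ 64 - 2 ^ 32) = 2 ^ 32 * (d / 2 ^ 32) := by
  have h := land_add_two_pow_mul (k := 32) (a := d % 2 ^ 32) (b := d / 2 ^ 32) (c := 0)
    (d := 2 ^ 32 - 1) (Nat.mod_lt _ (by norm_num)) (by norm_num)
  rw [Nat.mod_add_div, Nat.and_two_pow_sub_one_eq_mod, Nat.and_zero, zero_add,
    Nat.mod_eq_of_lt (a := d / 2 ^ 32) (by omega)] at h
  simpa using h

end PackedArithmetic

section PackedRing

/-- Constants for the arithmetic of `𝔽_p[x] / (x ^ N - c(x))` in packed form. -/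
structure PackedRing where
  /-- The characteristic. -/
  p : ℕ
  /-- The degree of the modulus. -/
  N : ℕ
  /-- The packed polynomial congruent to `x ^ N`. -/
  c : ℕ
  /-- The power `packBase ^ N`. -/
  wn : ℕ
  /-- The reciprocal of `p`, scaled by `2 ^ 32` and rounded up. -/
  mu : ℕ
  /-- The mask selecting the upper half of each coefficient. -/
  high : ℕ

namespace PackedRing

variable (P : PackedRing)

/-- Replaces `x ^ N` by `c` once. -/
def fold (a : ℕ) : ℕ :=
  Nat.add (Nat.mul (Nat.div a P.wn) P.c) (Nat.mod a P.wn)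

/-- Reduces all coefficients modulo `p`. -/
def modp (a : ℕ) : ℕ :=
  Nat.sub a (Nat.mul P.p (Nat.div (Nat.land (Nat.mul a P.mu) P.high) 4294967296))

/-- The code of a packed polynomial. The low word is a checksum, which makes the hash values of
distinct codes distinct in practice. -/
def tag (a : ℕ) : ℕ :=
  Nat.add (Nat.mul a 18446744073709551616) (Nat.mod a 18446744073709551557)

/-- The packed polynomial with a given code. -/
def untag (a : ℕ) : ℕ :=
  Nat.div a 18446744073709551616

theorem untag_tag (a : ℕ) : untag (tag a) = a := by
  change (a * 18446744073709551616 + a % 18446744073709551557) / 18446744073709551616 = a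
  omega

/-- The code of the canonical representative of an unreduced polynomial. -/
def reduce (a : ℕ) : ℕ :=
  tag (P.modp (P.fold (P.fold a)))

/-- Multiplication. -/
def mul (a b : ℕ) : ℕ :=
  P.reduce (Nat.mul (untag a) (untag b))

/-- The operation `a * b + c * d`. -/
def mulAddMul (a b c d : ℕ) : ℕ :=
  P.reduce (Nat.add (Nat.mul (untag a) (untag b)) (Nat.mul (untag c) (untag d)))

/-- Negation. -/
def neg (a : ℕ) : ℕ :=
  P.reduce (Nat.mul (untag a) (Nat.pred P.p))

/-- Subtraction of one. -/
def subOne (a : ℕ) : ℕ :=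
  P.reduce (Nat.add (untag a) (Nat.pred P.p))

/-- Exponentiation by squaring; the exponent has at most as many binary digits as the first
argument says. -/
def pow : ℕ → ℕ → ℕ → ℕ
  | 0, _, _ => tag 1
  | k + 1, a, e =>
    cond (Nat.beq e 0) (tag 1)
      (force (Nat.div e 2) fun h => force (pow k a h) fun b => force (P.mul b b) fun b =>
        cond (Nat.beq (Nat.mod e 2) 1) (P.mul b a) b)

variable {S : Type*} [CommRing S]

/-- The ring `P` with reduction rule `cl` maps to `S` by sending `x` to `θ`. -/
structure IsModel (cl : List ℕ) (θ : S) : Prop where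
  two_le : 2 ≤ P.p
  wn_eq : P.wn = packBase ^ P.N
  c_eq : P.c = Nat.ofDigits packBase cl
  high_eq : P.high = Nat.ofDigits packBase (List.replicate P.N (2 ^ 64 - 2 ^ 32))
  mu_eq : P.mu = 2 ^ 32 / P.p + 1
  length_le : 2 * cl.length ≤ P.N
  N_pos : 0 < P.N
  bound : 2 * P.N * P.p ^ 2 * (cl.sum + 1) ^ 2 * P.p < 2 ^ 32
  cast_p : (P.p : S) = 0
  pow_N : θ ^ P.N = Nat.ofDigits θ cl

/-- The number `a` is the code of the canonical packed form of a polynomial whose value at `θ` is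
`z`. -/
def Rep (θ : S) (a : ℕ) (z : S) : Prop :=
  ∃ l : List ℕ, Nat.ofDigits packBase l = untag a ∧ Nat.ofDigits θ l = z ∧ l.length ≤ P.N ∧
    ∀ d ∈ l, d < P.p

variable {P} {cl : List ℕ} {θ : S}

theorem IsModel.p_lt (hP : P.IsModel cl θ) : P.p < 2 ^ 32 := by
  have h1 := hP.N_pos
  have h2 := hP.two_le
  have h3 := hP.bound
  have : 1 ≤ 2 * P.N * P.p ^ 2 * (cl.sum + 1) ^ 2 := Nat.pos_of_ne_zero (by positivity)
  nlinarith

theorem IsModel.exists_fold (hP : P.IsModel cl θ) {l : List ℕ} {B k : ℕ} (hB : B < packBase)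
    (hl : ∀ d ∈ l, d ≤ B) (hk : l.length ≤ P.N + k) :
    ∃ l' : List ℕ, Nat.ofDigits packBase l' = P.fold (Nat.ofDigits packBase l) ∧
      Nat.ofDigits θ l' = Nat.ofDigits θ l ∧ (∀ d ∈ l', d ≤ B * (cl.sum + 1)) ∧
      l'.length ≤ max P.N (cl.length + k) := by
  have hl' : ∀ d ∈ l, d < packBase := fun d hd => (hl d hd).trans_lt hB
  refine ⟨addDigits (mulDigits cl (l.drop P.N)) (l.take P.N), ?_, ?_, ?_, ?_⟩
  · rw [ofDigits_addDigits, ofDigits_mulDigits, ← hP.c_eq,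
      ← Nat.ofDigits_div_pow_eq_ofDigits_drop _ (by norm_num) _ hl',
      ← Nat.ofDigits_mod_pow_eq_ofDigits_take _ (by norm_num) _ hl', ← hP.wn_eq, mul_comm]
    rfl
  · rw [ofDigits_addDigits, ofDigits_mulDigits, ← hP.pow_N, ofDigits_take_add_drop θ l P.N]
    ring
  · intro d hd
    refine (addDigits_le (mulDigits_le fun d hd => hl d (List.mem_of_mem_drop hd))
      (fun d hd => hl d (List.mem_of_mem_take hd)) d hd).trans (le_of_eq ?_)
    ring
  · rw [length_addDigits]
    have := length_mulDigits_le cl (l.drop P.N)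
    simp only [List.length_drop, List.length_take] at this ⊢
    omega

theorem reciprocal_bounds {p a : ℕ} (hp : 2 ≤ p) (ha : a * p < 2 ^ 32) :
    p * (a * (2 ^ 32 / p + 1) / 2 ^ 32) ≤ a ∧ a < p * (a * (2 ^ 32 / p + 1) / 2 ^ 32) + p := by
  have h1 : p * (2 ^ 32 / p) ≤ 2 ^ 32 := Nat.mul_div_le _ _
  have h2 : 2 ^ 32 < p * (2 ^ 32 / p + 1) := by
    rw [mul_add, mul_one]
    exact Nat.lt_mul_div_succ _ (by omega)
  set m := 2 ^ 32 / p + 1 with hm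
  have h3 : p * m ≤ 2 ^ 32 + p := by rw [hm, mul_add]; omega
  set Q := a * m / 2 ^ 32 with hQ
  have h4 : Q * 2 ^ 32 ≤ a * m := Nat.div_mul_le_self _ _
  have h5 : a * m < (Q + 1) * 2 ^ 32 := by
    rw [mul_comm (Q + 1)]
    exact Nat.lt_mul_div_succ _ (by norm_num)
  constructor
  · by_contra! h
    have h6 : (a + 1) * 2 ^ 32 ≤ p * (Q * 2 ^ 32) := by nlinarith
    have h7 : p * (Q * 2 ^ 32) ≤ a * (p * m) := by
      calc _ ≤ p * (a * m) := Nat.mul_le_mul_left _ h4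
        _ = _ := by ring
    have h8 : a * (p * m) ≤ a * (2 ^ 32 + p) := Nat.mul_le_mul_left _ h3
    nlinarith
  · by_contra! h
    have h6 : p * (a * m) < p * ((Q + 1) * 2 ^ 32) := Nat.mul_lt_mul_of_pos_left h5 (by omega)
    have h7 : a * 2 ^ 32 ≤ a * (p * m) := Nat.mul_le_mul_left _ h2.le
    nlinarith

theorem IsModel.exists_modp (hP : P.IsModel cl θ) {l : List ℕ}
    (hl : ∀ d ∈ l, d * P.p < 2 ^ 32) (hN : l.length ≤ P.N) :
    P.Rep θ (tag (P.modp (Nat.ofDigits packBase l))) (Nat.ofDigits θ l) := by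
  have hp := hP.two_le
  let g : ℕ → ℕ := fun d => d * P.mu / 2 ^ 32
  let f : ℕ → ℕ := fun d => d - P.p * g d
  have hfg : ∀ d ∈ l, d = f d + P.p * g d ∧ f d < P.p := by
    intro d hd
    have h := reciprocal_bounds hp (hl d hd)
    rw [← hP.mu_eq] at h
    simp only [f, g]
    omega
  have hmu : ∀ d ∈ l, d * P.mu < packBase := by
    intro d hd
    have h1 : d < 2 ^ 31 := by have := hl d hd; nlinarith
    have h2 : P.mu ≤ 2 ^ 32 := by
      rw [hP.mu_eq]
      have := Nat.div_le_div_left hp (by norm_num) (a := 2 ^ 32)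
      omega
    calc d * P.mu ≤ d * 2 ^ 32 := Nat.mul_le_mul_left _ h2
      _ < 2 ^ 31 * 2 ^ 32 := Nat.mul_lt_mul_of_pos_right h1 (by norm_num)
      _ ≤ packBase := by norm_num
  have hq : Nat.div (Nat.land (Nat.mul (Nat.ofDigits packBase l) P.mu) P.high) 4294967296 =
      Nat.ofDigits packBase (l.map g) := by
    have h1 : Nat.mul (Nat.ofDigits packBase l) P.mu =
        Nat.ofDigits packBase (l.map (P.mu * ·)) := by
      rw [ofDigits_map_mul]; exact mul_comm _ _
    have h2 : Nat.land (Nat.ofDigits packBase (l.map (P.mu * ·))) P.high =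
        Nat.ofDigits packBase ((l.map (P.mu * ·)).map (· &&& (2 ^ 64 - 2 ^ 32))) := by
      rw [hP.high_eq]
      refine ofDigits_land_replicate (by norm_num) (by simpa using hN) ?_
      simp only [List.mem_map]
      rintro _ ⟨d, hd, rfl⟩
      rw [mul_comm]
      exact hmu d hd
    have h3 : (l.map (P.mu * ·)).map (· &&& (2 ^ 64 - 2 ^ 32)) = (l.map g).map (2 ^ 32 * ·) := by
      rw [List.map_map, List.map_map]
      refine List.map_congr_left fun d hd => ?_
      simp only [Function.comp, g]
      rw [land_high_half (by rw [mul_comm]; exact hmu d hd), mul_comm d]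
    rw [h1, h2, h3, ofDigits_map_mul]
    exact Nat.mul_div_cancel_left _ (by norm_num)
  refine ⟨l.map f, ?_, ?_, by simpa using hN, ?_⟩
  · have h := ofDigits_map_add_mul packBase P.p f g l fun d hd => (hfg d hd).1
    rw [untag_tag, modp, hq, h]
    exact (Nat.add_sub_cancel _ _).symm
  · rw [ofDigits_map_add_mul θ P.p f g l fun d hd => (hfg d hd).1, hP.cast_p]
    ring
  · simp only [List.mem_map]
    rintro _ ⟨d, hd, rfl⟩
    exact (hfg d hd).2

theorem IsModel.rep_reduce (hP : P.IsModel cl θ) {l : List ℕ}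
    (hl : ∀ d ∈ l, d ≤ 2 * P.N * P.p ^ 2) (hN : l.length ≤ P.N + P.N) :
    P.Rep θ (P.reduce (Nat.ofDigits packBase l)) (Nat.ofDigits θ l) := by
  have hb := hP.bound
  have hp := hP.two_le
  have hlen := hP.length_le
  have hb2 : 2 * P.N * P.p ^ 2 * (cl.sum + 1) * (cl.sum + 1) < 2 ^ 32 := by nlinarith
  have hb1 : 2 * P.N * P.p ^ 2 * (cl.sum + 1) < packBase :=
    ((Nat.le_mul_of_pos_right _ (Nat.succ_pos _)).trans_lt hb2).trans (by norm_num)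
  have hb0 : 2 * P.N * P.p ^ 2 < packBase :=
    (Nat.le_mul_of_pos_right _ (Nat.succ_pos _)).trans_lt hb1
  obtain ⟨l₁, h1, h1', h1d, h1l⟩ := hP.exists_fold hb0 hl hN
  obtain ⟨l₂, h2, h2', h2d, h2l⟩ := hP.exists_fold hb1 h1d (k := cl.length) (by omega)
  have := hP.exists_modp (l := l₂) (fun d hd => by have := h2d d hd; nlinarith) (by omega)
  rw [h2', h1', h2, h1] at this
  simpa [reduce] using this

theorem Rep.sum_le {l : List ℕ} {N p : ℕ} (h : l.length ≤ N) (hl : ∀ d ∈ l, d < p) :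
    l.sum ≤ N * p :=
  (List.sum_le_card_nsmul l p fun d hd => (hl d hd).le).trans (Nat.mul_le_mul_right _ h)

theorem IsModel.rep_mulAddMul (hP : P.IsModel cl θ) {a b c d : ℕ} {x y z w : S}
    (ha : P.Rep θ a x) (hb : P.Rep θ b y) (hc : P.Rep θ c z) (hd : P.Rep θ d w) :
    P.Rep θ (P.mulAddMul a b c d) (x * y + z * w) := by
  obtain ⟨l₁, ha, rfl, hl₁, hd₁⟩ := ha
  obtain ⟨l₂, hb, rfl, hl₂, hd₂⟩ := hb
  obtain ⟨l₃, hc, rfl, hl₃, hd₃⟩ := hc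
  obtain ⟨l₄, hd, rfl, hl₄, hd₄⟩ := hd
  have h := hP.rep_reduce (l := addDigits (mulDigits l₁ l₂) (mulDigits l₃ l₄)) ?_ ?_
  · rw [ofDigits_addDigits, ofDigits_mulDigits, ofDigits_mulDigits, ofDigits_addDigits,
      ofDigits_mulDigits, ofDigits_mulDigits, ha, hb, hc, hd] at h
    exact h
  · intro d hd
    refine (addDigits_le (mulDigits_le fun d hd => (hd₂ d hd).le)
      (mulDigits_le fun d hd => (hd₄ d hd).le) d hd).trans ?_
    have h1 := Nat.mul_le_mul_right P.p (Rep.sum_le hl₁ hd₁)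
    have h3 := Nat.mul_le_mul_right P.p (Rep.sum_le hl₃ hd₃)
    nlinarith
  · rw [length_addDigits]
    have h1 := length_mulDigits_le l₁ l₂
    have h2 := length_mulDigits_le l₃ l₄
    omega

theorem rep_zero : P.Rep θ 0 0 := ⟨[], rfl, rfl, by simp, by simp⟩

theorem IsModel.rep_natCast (hP : P.IsModel cl θ) {d : ℕ} (hd : d < P.p) :
    P.Rep θ (tag d) (d : S) :=
  ⟨[d], by simp [untag_tag], by rw [ofDigits_cons_eq, ofDigits_nil_eq, mul_zero, add_zero],
    hP.N_pos, by simpa using hd⟩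

theorem IsModel.rep_one (hP : P.IsModel cl θ) : P.Rep θ (tag 1) 1 := by
  simpa using hP.rep_natCast hP.two_le

theorem IsModel.rep_mul (hP : P.IsModel cl θ) {a b : ℕ} {x y : S}
    (ha : P.Rep θ a x) (hb : P.Rep θ b y) : P.Rep θ (P.mul a b) (x * y) := by
  have h := hP.rep_mulAddMul ha hb rep_zero rep_zero
  rw [mul_zero, add_zero] at h
  exact h

theorem IsModel.rep_pred (hP : P.IsModel cl θ) : P.Rep θ (tag (Nat.pred P.p)) (-1) := by
  have h1 := hP.two_le
  have h := hP.rep_natCast (d := P.p - 1) (by omega)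
  rwa [Nat.cast_sub (by omega), hP.cast_p, Nat.cast_one, zero_sub] at h

theorem IsModel.rep_neg (hP : P.IsModel cl θ) {a : ℕ} {x : S} (ha : P.Rep θ a x) :
    P.Rep θ (P.neg a) (-x) := by
  have h := hP.rep_mul ha hP.rep_pred
  rwa [mul_neg_one, mul, untag_tag] at h

theorem IsModel.rep_subOne (hP : P.IsModel cl θ) {a : ℕ} {x : S} (ha : P.Rep θ a x) :
    P.Rep θ (P.subOne a) (x - 1) := by
  have h := hP.rep_mulAddMul ha hP.rep_one hP.rep_one hP.rep_pred
  rw [mul_one, one_mul, ← sub_eq_add_neg] at h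
  convert h using 1
  rw [subOne, mulAddMul, untag_tag, untag_tag]
  simp

theorem IsModel.rep_pow (hP : P.IsModel cl θ) {a : ℕ} {x : S} (ha : P.Rep θ a x) (k e : ℕ)
    (he : e < 2 ^ k) : P.Rep θ (P.pow k a e) (x ^ e) := by
  induction k generalizing e with
  | zero =>
    obtain rfl : e = 0 := by omega
    rw [pow, _root_.pow_zero]
    exact hP.rep_one
  | succ k ih =>
    rw [pow]
    rcases Nat.eq_zero_or_pos e with rfl | hpos
    · rw [Nat.beq_refl, cond_true, _root_.pow_zero]
      exact hP.rep_one
    have h0 : Nat.beq e 0 = false := by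
      cases e with
      | zero => omega
      | succ e => rfl
    rw [h0, cond_false]
    simp only [force_eq]
    have hh : P.Rep θ (P.pow k a (Nat.div e 2)) (x ^ (e / 2)) := ih (e / 2) (by omega)
    have h2 := hP.rep_mul hh hh
    rw [← pow_add] at h2
    cases hb : Nat.beq (Nat.mod e 2) 1 with
    | true =>
      rw [cond_true]
      have h1 : e % 2 = 1 := Nat.eq_of_beq_eq_true hb
      have := hP.rep_mul h2 ha
      rw [← pow_succ] at this
      rwa [show e / 2 + e / 2 + 1 = e by omega] at this
    | false =>
      rw [cond_false]
      have h1 : e % 2 ≠ 1 := Nat.ne_of_beq_eq_false hb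
      rwa [show e / 2 + e / 2 = e by omega] at h2

theorem IsModel.rep_unique (hP : P.IsModel cl θ) {a : ℕ} {x y : S} (hx : P.Rep θ a x)
    (hy : P.Rep θ a y) : x = y := by
  obtain ⟨l, h, rfl, -, hl⟩ := hx
  obtain ⟨m, h', rfl, -, hm⟩ := hy
  have hp : P.p < packBase := hP.p_lt.trans (by norm_num)
  exact ofDigits_eq_of_ofDigits_eq θ (fun d hd => (hl d hd).trans hp)
    (fun d hd => (hm d hd).trans hp) (h.trans h'.symm)

end PackedRing

end PackedRing

section PackedEuclid

/-- The polynomial with the given list of coefficients, leading coefficient first. -/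
def listPoly {S : Type*} [Semiring S] : List S → S[X]
  | [] => 0
  | a :: l => C a * X ^ l.length + listPoly l

theorem degree_listPoly_lt {S : Type*} [Semiring S] (l : List S) :
    (listPoly l).degree < l.length := by
  induction l with
  | nil => simp [listPoly]
  | cons a l ih =>
    rw [listPoly, List.length_cons]
    refine (degree_add_le _ _).trans_lt (max_lt ?_ (ih.trans ?_))
    · exact (degree_C_mul_X_pow_le _ _).trans_lt (by exact_mod_cast Nat.lt_succ_self _)
    · exact_mod_cast Nat.lt_succ_self _

theorem natDegree_listPoly_cons {S : Type*} [Semiring S] {a : S} (ha : a ≠ 0) (l : List S) :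
    (listPoly (a :: l)).natDegree = l.length := by
  rw [listPoly, natDegree_add_eq_left_of_degree_lt, natDegree_C_mul_X_pow _ _ ha]
  rw [degree_C_mul_X_pow _ ha]
  exact degree_listPoly_lt l

namespace PackedRing

variable (P : PackedRing)

/-- The coefficients of `b * A + a * B` for lists aligned at their leading coefficients. -/
def eliminate (b a : ℕ) : List ℕ → List ℕ → List ℕ
  | [], _ => []
  | x :: A, [] => P.mul b x :: eliminate b a A []
  | x :: A, y :: B => P.mulAddMul b x a y :: eliminate b a A B

/-- Euclid's algorithm without divisions. The result is passed to `k` together with the product of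
`acc` and the leading coefficients that occurred. -/
def euclid : ℕ → List ℕ → List ℕ → ℕ → (List ℕ → ℕ → Bool) → Bool
  | 0, _, _, _, _ => false
  | _ + 1, [], B, acc, k => k B acc
  | _ + 1, _ :: _, [], _, _ => false
  | f + 1, a :: A, b :: B, acc, k =>
    cond (Nat.beq a 0) (euclid f A (b :: B) acc k)
      (cond (Nat.ble B.length A.length)
        (force (P.neg a) fun a' => forceList (P.eliminate b a' A B) fun A' =>
          euclid f A' (b :: B) acc k)
        (force (P.mul acc a) fun acc => euclid f (b :: B) (a :: A) acc k))

variable {P} {E : Type*} [Field E] {cl : List ℕ} {θ : E}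

theorem IsModel.exists_eliminate (hP : P.IsModel cl θ) {a b : ℕ} {x y : E} (ha : P.Rep θ a x)
    (hb : P.Rep θ b y) {A B : List ℕ} {u v : List E} (hA : List.Forall₂ (P.Rep θ) A u)
    (hB : List.Forall₂ (P.Rep θ) B v) (hlen : v.length ≤ u.length) :
    ∃ w, List.Forall₂ (P.Rep θ) (P.eliminate b a A B) w ∧ w.length = u.length ∧
      listPoly w = C y * listPoly u + C x * X ^ (u.length - v.length) * listPoly v := by
  induction hA generalizing B v with
  | nil =>
    have : v = [] := by simpa using hlen
    subst this
    exact ⟨[], by simp [eliminate], rfl, by simp [listPoly]⟩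
  | @cons a₀ u₀ A u h₀ hA ih =>
    cases hB with
    | nil =>
      obtain ⟨w, hw, hwl, hwp⟩ := ih List.Forall₂.nil (by simp)
      refine ⟨y * u₀ :: w, ?_, by simp [hwl], ?_⟩
      · rw [eliminate]
        exact List.Forall₂.cons (hP.rep_mul hb h₀) hw
      · simp only [listPoly, hwp, hwl, C_mul]
        ring
    | @cons b₀ v₀ B v h₁ hB =>
      simp only [List.length_cons, Nat.add_le_add_iff_right] at hlen
      obtain ⟨w, hw, hwl, hwp⟩ := ih hB hlen
      refine ⟨(y * u₀ + x * v₀) :: w, ?_, by simp [hwl], ?_⟩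
      · rw [eliminate]
        exact List.Forall₂.cons (hP.rep_mulAddMul hb h₀ ha h₁) hw
      · obtain ⟨k, hk⟩ := Nat.exists_eq_add_of_le hlen
        have h1 : (u₀ :: u).length - (v₀ :: v).length = k := by simp [hk]
        have h2 : u.length - v.length = k := by omega
        rw [h2] at hwp
        simp only [h1]
        simp only [listPoly, hwp, hwl, C_mul, C_add, hk, pow_add]
        ring

theorem IsModel.euclid_sound (hP : P.IsModel cl θ) (f : ℕ) {A B : List ℕ} {u v : List E}
    {acc : ℕ} {z : E} {k : List ℕ → ℕ → Bool} (h : P.euclid f A B acc k = true)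
    (hA : List.Forall₂ (P.Rep θ) A u) (hB : List.Forall₂ (P.Rep θ) B v) (hz : P.Rep θ acc z)
    (hv : z ≠ 0 → v.head? ≠ some 0) :
    ∃ (G : List ℕ) (w : List E) (acc' : ℕ) (z' : E), k G acc' = true ∧
      List.Forall₂ (P.Rep θ) G w ∧ P.Rep θ acc' z' ∧ z ∣ z' ∧
      (z' ≠ 0 → w.head? ≠ some 0 ∧
        ∀ D : E[X], D ∣ listPoly u ∧ D ∣ listPoly v ↔ D ∣ listPoly w) := by
  induction f generalizing A B u v acc z with
  | zero => simp [euclid] at h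
  | succ f ih =>
    cases hA with
    | nil =>
      rw [euclid] at h
      exact ⟨B, v, acc, z, h, hB, hz, dvd_rfl, fun hz' => ⟨hv hz', fun D => by simp [listPoly]⟩⟩
    | @cons a x A u ha hA =>
      cases hB with
      | nil => simp [euclid] at h
      | @cons b y B v hb hB =>
        simp only [euclid, force_eq, forceList_eq] at h
        cases h0 : Nat.beq a 0 with
        | true =>
          rw [h0, cond_true] at h
          obtain rfl : a = 0 := Nat.eq_of_beq_eq_true h0
          obtain rfl : x = 0 := hP.rep_unique ha rep_zero
          obtain ⟨G, w, acc', z', h1, h2, h3, h4, h5⟩ := ih h hA (hB.cons hb) hz hv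
          refine ⟨G, w, acc', z', h1, h2, h3, h4, fun hz' => ⟨(h5 hz').1, fun D => ?_⟩⟩
          rw [← (h5 hz').2 D]
          simp [listPoly]
        | false =>
          rw [h0, cond_false] at h
          cases hl : Nat.ble B.length A.length with
          | true =>
            rw [hl, cond_true] at h
            have hlen : v.length ≤ u.length := by
              rw [← hA.length_eq, ← hB.length_eq]
              exact Nat.le_of_ble_eq_true hl
            obtain ⟨u', hu', -, hp⟩ := hP.exists_eliminate (hP.rep_neg ha) hb hA hB hlen
            obtain ⟨G, w, acc', z', h1, h2, h3, h4, h5⟩ := ih h hu' (hB.cons hb) hz hv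
            refine ⟨G, w, acc', z', h1, h2, h3, h4, fun hz' => ⟨(h5 hz').1, fun D => ?_⟩⟩
            rw [← (h5 hz').2 D]
            have hy : y ≠ 0 := by
              have : z ≠ 0 := fun h => hz' (zero_dvd_iff.mp (h ▸ h4))
              simpa using hv this
            have key : listPoly u' = C y * listPoly (x :: u) -
                C x * X ^ (u.length - v.length) * listPoly (y :: v) := by
              rw [hp]
              obtain ⟨k, hk⟩ := Nat.exists_eq_add_of_le hlen
              simp only [listPoly, hk, Nat.add_sub_cancel_left, C_neg, pow_add]
              ring
            rw [key]
            refine and_congr_left fun hD => ?_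
            rw [dvd_sub_left (hD.mul_left _)]
            exact (IsUnit.dvd_mul_left (isUnit_C.mpr hy.isUnit)).symm
          | false =>
            rw [hl, cond_false] at h
            obtain ⟨G, w, acc', z', h1, h2, h3, h4, h5⟩ :=
              ih h (hB.cons hb) (hA.cons ha) (hP.rep_mul hz ha)
                (fun h => by simpa using right_ne_zero_of_mul h)
            refine ⟨G, w, acc', z', h1, h2, h3, (dvd_mul_right _ _).trans h4,
              fun hz' => ⟨(h5 hz').1, fun D => ?_⟩⟩
            rw [← (h5 hz').2 D, and_comm]

/-- The list of the first `k` iterates of the `q`-th power map at `a`. -/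
def powers (P : PackedRing) (q : ℕ) : ℕ → ℕ → List ℕ
  | 0, _ => []
  | k + 1, a => force (P.pow 5 a q) fun b => a :: powers P q k b

theorem IsModel.rep_powers (hP : P.IsModel cl θ) {q : ℕ} (hq : q < 2 ^ 5) (k : ℕ) {a : ℕ} {x : E}
    (ha : P.Rep θ a x) :
    ∃ u, List.Forall₂ (P.Rep θ) (P.powers q k a) u ∧ u.length = k ∧
      listPoly u = gPoly q k x := by
  induction k generalizing a x with
  | zero => exact ⟨[], List.Forall₂.nil, rfl, by simp [listPoly, gPoly]⟩
  | succ k ih =>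
    obtain ⟨u, h1, h2, h3⟩ := ih (hP.rep_pow ha 5 q hq)
    refine ⟨x :: u, ?_, by simp [h2], ?_⟩
    · rw [powers, force_eq]
      exact h1.cons ha
    · rw [listPoly, h3, h2, gPoly, gPoly, Finset.sum_range_succ']
      rw [add_comm]
      congr 1
      · refine Finset.sum_congr rfl fun i hi => ?_
        rw [← pow_mul, pow_succ', show k + 1 - 1 - (i + 1) = k - 1 - i by omega]
      · simp

end PackedRing

end PackedEuclid

section PackedCertificate

universe u

theorem map_ofDigits_eq {S T : Type*} [CommSemiring S] [CommSemiring T] (f : S →+* T) (x : S)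
    (l : List ℕ) : f (Nat.ofDigits x l) = Nat.ofDigits (f x) l := by
  induction l with
  | nil => simp [ofDigits_nil_eq]
  | cons d l ih => simp [ofDigits_cons_eq, ih]

theorem degree_ofDigits_X_lt {S : Type*} [CommRing S] (l : List ℕ) :
    (Nat.ofDigits (X : S[X]) l).degree < l.length := by
  induction l with
  | nil => simp [ofDigits_nil_eq]
  | cons d l ih =>
    rw [degree_lt_iff_coeff_zero] at ih ⊢
    intro m hm
    rw [List.length_cons] at hm
    obtain ⟨k, rfl⟩ := Nat.exists_eq_succ_of_ne_zero (show m ≠ 0 by omega)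
    rw [ofDigits_cons_eq, coeff_add, Nat.succ_eq_add_one, coeff_X_mul, ih k (by omega),
      coeff_natCast_ite, if_neg (by omega), add_zero, Nat.cast_zero]

/-- A field with `q` elements contains a root of every monic polynomial `x ^ N - c(x)` whose
adjoined root is fixed by the `q`-th power map. -/
theorem exists_pow_eq_ofDigits {E : Type u} [Field E] [Fintype E] {N : ℕ} {cl : List ℕ}
    (hN : 0 < N) (hl : cl.length ≤ N)
    (h : ∀ (S : Type u) [CommRing S] [Algebra E S] (θ : S), θ ^ N = Nat.ofDigits θ cl →
      θ ^ Fintype.card E = θ) :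
    ∃ θ : E, θ ^ N = Nat.ofDigits θ cl := by
  set P : E[X] := X ^ N - Nat.ofDigits X cl with hP
  have hdeg : P.degree = N := by
    rw [hP, degree_sub_eq_left_of_degree_lt, degree_X_pow]
    rw [degree_X_pow]
    exact (degree_ofDigits_X_lt cl).trans_le (by exact_mod_cast hl)
  have hroot : AdjoinRoot.root P ^ N = Nat.ofDigits (AdjoinRoot.root P) cl := by
    have := AdjoinRoot.mk_self (f := P)
    rwa [hP, map_sub, map_pow, map_ofDigits_eq, sub_eq_zero, ← hP] at this
  have hdvd : P ∣ X ^ Fintype.card E - X := by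
    rw [← AdjoinRoot.mk_eq_zero, map_sub, map_pow, AdjoinRoot.mk_X, sub_eq_zero]
    exact h _ _ hroot
  have hcard := Fintype.one_lt_card (α := E)
  have hsplits : P.Splits := by
    refine Splits.of_dvd ?_ (FiniteField.X_pow_card_sub_X_ne_zero E hcard) hdvd
    have := FiniteField.roots_X_pow_card_sub_X E
    rw [splits_iff_card_roots, this, FiniteField.X_pow_card_sub_X_natDegree_eq E hcard]
    rfl
  obtain ⟨θ, hθ⟩ := hsplits.exists_eval_eq_zero (by rw [hdeg]; exact_mod_cast hN.ne')
  refine ⟨θ, ?_⟩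
  rw [hP, eval_sub, eval_pow, eval_X, sub_eq_zero] at hθ
  rw [hθ, ← coe_evalRingHom, map_ofDigits_eq, coe_evalRingHom, eval_X]

namespace PackedRing

/-- The packed form of `𝔽_p[x] / (x ^ N - c(x))`, where `cl` lists the coefficients of `c`. -/
def ofList (p N : ℕ) (cl : List ℕ) : PackedRing where
  p := p
  N := N
  c := pack cl
  wn := packBase ^ N
  mu := 2 ^ 32 / p + 1
  high := pack (List.replicate N 18446744069414584320)

/-- Applies `k` to `ofList p N cl` after evaluating the constants. -/
def withOfList {β : Type*} (p N : ℕ) (cl : List ℕ) (k : PackedRing → β) : β :=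
  force (pack cl) fun c => force (Nat.pow packBase N) fun wn =>
    force (Nat.succ (Nat.div 4294967296 p)) fun mu =>
      force (pack (List.replicate N 18446744069414584320)) fun high => k ⟨p, N, c, wn, mu, high⟩

theorem withOfList_eq {β : Type*} (p N : ℕ) (cl : List ℕ) (k : PackedRing → β) :
    withOfList p N cl k = k (ofList p N cl) := by
  simp only [withOfList, force_eq]
  rfl

/-- The `k`-th iterate of the `p`-th power map. -/
def frobenius (P : PackedRing) : ℕ → ℕ → ℕ
  | 0, a => a
  | k + 1, a => force (P.pow 5 a P.p) fun b => frobenius P k b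

/-- The product of `z` and the elements `a ^ (M / r) - 1` for `r` in a list. -/
def orderProduct (P : PackedRing) (M a : ℕ) : List ℕ → ℕ → ℕ
  | [], z => z
  | r :: l, z => force (P.pow 100 a (Nat.div M r)) fun b => force (P.subOne b) fun b =>
      force (P.mul z b) fun z => orderProduct P M a l z

variable {P : PackedRing}

theorem IsModel.rep_frobenius {S : Type*} [CommRing S] {cl : List ℕ} {θ : S}
    (hP : P.IsModel cl θ) (hp : P.p < 2 ^ 5) (k : ℕ) {a : ℕ} {x : S} (ha : P.Rep θ a x) :
    P.Rep θ (P.frobenius k a) (x ^ P.p ^ k) := by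
  induction k generalizing a x with
  | zero => simpa [frobenius] using ha
  | succ k ih =>
    rw [frobenius, force_eq, pow_succ', pow_mul]
    exact ih (hP.rep_pow ha 5 _ hp)

theorem IsModel.rep_orderProduct {S : Type*} [CommRing S] {cl : List ℕ} {θ : S}
    (hP : P.IsModel cl θ) {M : ℕ} (hM : M < 2 ^ 100) {a : ℕ} {x : S} (ha : P.Rep θ a x)
    (l : List ℕ) {b : ℕ} {z : S} (hb : P.Rep θ b z) :
    P.Rep θ (P.orderProduct M a l b) (z * (l.map fun r => x ^ (M / r) - 1).prod) := by
  induction l generalizing b z with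
  | nil => simpa [orderProduct] using hb
  | cons r l ih =>
    rw [orderProduct, force_eq, force_eq, force_eq, List.map_cons, List.prod_cons, ← mul_assoc]
    exact ih (hP.rep_mul hb (hP.rep_subOne
      (hP.rep_pow ha 100 _ ((Nat.div_le_self M r).trans_lt hM))))

end PackedRing

/-- Data describing an element of `𝔽_{q ^ n}`: the field is described as a quotient of
`𝔽_p[x] / (x ^ N - c(x))`, where `cl` lists the coefficients of `c`, and `al` lists the
coefficients of the element. -/
structure PackedElement where
  /-- The size of the base field. -/
  q : ℕ
  /-- The degree over the base field. -/
  n : ℕ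
  /-- The characteristic. -/
  p : ℕ
  /-- The degree over the prime field. -/
  d : ℕ
  /-- The degree of the modulus. -/
  N : ℕ
  /-- The coefficients of `c`. -/
  cl : List ℕ
  /-- The coefficients of the element. -/
  al : List ℕ

namespace PackedElement

open PackedRing

/-- The conditions on the parameters of a `PackedElement`. -/
def WellFormed (c : PackedElement) (rs : List ℕ) : Prop :=
  (2 ≤ c.p ∧ c.p < 2 ^ 5 ∧ 2 ≤ c.N ∧ 2 * c.cl.length ≤ c.N ∧
    2 * c.N * c.p ^ 2 * (c.cl.sum + 1) ^ 2 * c.p < 2 ^ 32) ∧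
  (c.p ^ c.d = c.q ^ c.n ∧ c.q < 2 ^ 5 ∧ 1 ≤ c.n) ∧
  (c.al.length ≤ c.N ∧ ∀ a ∈ c.al, a < c.p) ∧
  (c.q ^ c.n - 1 < 2 ^ 100 ∧ (∀ r ∈ rs, r ∣ c.q ^ c.n - 1) ∧ c.q ^ c.n - 1 ∣ rs.prod ^ 100)

instance (c : PackedElement) (rs : List ℕ) : Decidable (c.WellFormed rs) := by
  unfold WellFormed
  infer_instance

/-- The polynomial `x ^ n - 1` as a list of codes. -/
def xPowSubOne (p n : ℕ) : List ℕ :=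
  tag 1 :: (List.replicate (n - 1) 0 ++ [tag (p - 1)])

/-- The test that the element described by `c` is primitive and `2`-normal, where `rs` lists the
primes dividing `q ^ n - 1`. -/
def certify (c : PackedElement) (rs : List ℕ) : Bool :=
  decide (c.WellFormed rs) &&
  withOfList c.p c.N c.cl fun P => force (c.q ^ c.n - 1) fun M => force (tag (pack c.al)) fun a =>
    force (tag packBase) fun x => Nat.beq (P.frobenius c.d x) x &&
    forceList (xPowSubOne c.p c.n) fun B => P.euclid 200 (P.powers c.q c.n a) B a fun G z =>
      Nat.beq G.length 3 && Nat.beq (P.pow 100 (P.orderProduct M a rs z) M) (tag 1)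

theorem forall₂_xPowSubOne {P : PackedRing} {E : Type*} [Field E] {cl : List ℕ} {θ : E}
    (hP : P.IsModel cl θ) {n : ℕ} (hn : 1 ≤ n) :
    ∃ v : List E, List.Forall₂ (P.Rep θ) (xPowSubOne P.p n) v ∧ v.head? = some 1 ∧
      listPoly v = X ^ n - 1 := by
  have key : ∀ k, List.Forall₂ (P.Rep θ) (List.replicate k 0 ++ [tag (P.p - 1)])
      (List.replicate k 0 ++ [-1]) ∧ listPoly (List.replicate k (0 : E) ++ [-1]) = -1 := by
    intro k
    induction k with
    | zero => exact ⟨by simpa using hP.rep_pred, by simp [listPoly]⟩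
    | succ k ih =>
      rw [List.replicate_succ, List.replicate_succ]
      exact ⟨ih.1.cons rep_zero, by simpa [listPoly] using ih.2⟩
  refine ⟨1 :: (List.replicate (n - 1) 0 ++ [-1]), (key _).1.cons hP.rep_one, rfl, ?_⟩
  rw [listPoly, (key _).2]
  simp [Nat.sub_add_cancel hn, sub_eq_add_neg]

theorem exists_of_certify {c : PackedElement} {rs : List ℕ} (h : c.certify rs = true)
    (hrs : ∀ r ∈ rs, r.Prime) {E : Type u} [Field E] [Fintype E]
    (hE : Fintype.card E = c.q ^ c.n) :
    ∃ α : E, IsPrimitiveElem α ∧ IsKNormal c.q c.n 2 α := by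
  rw [certify, withOfList_eq, force_eq, force_eq, force_eq, forceList_eq, Bool.and_eq_true,
    Bool.and_eq_true, decide_eq_true_eq] at h
  obtain ⟨⟨⟨hp2, hp5, hN, hl, hb⟩, ⟨hpd, hq, hn⟩, ⟨hal, had⟩, hM, hrd, hprod⟩, hroot, hmain⟩ := h
  have hcast : ((c.p : ℕ) : E) = 0 := by
    have h1 := FiniteField.cast_card_eq_zero E
    rw [hE, ← hpd, Nat.cast_pow] at h1
    exact eq_zero_of_pow_eq_zero h1
  have hmodel : ∀ (S : Type u) [CommRing S] [Algebra E S] (θ : S),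
      θ ^ c.N = Nat.ofDigits θ c.cl → (ofList c.p c.N c.cl).IsModel c.cl θ := by
    intro S _ _ θ hθ
    refine ⟨hp2, rfl, pack_eq_ofDigits _, pack_eq_ofDigits _, rfl, hl,
      by simp only [ofList]; omega, hb, ?_, hθ⟩
    have := congrArg (algebraMap E S) hcast
    simpa [ofList] using this
  obtain ⟨θ, hθ⟩ : ∃ θ : E, θ ^ c.N = Nat.ofDigits θ c.cl := by
    refine exists_pow_eq_ofDigits (by omega) (by omega) fun S _ _ θ hθ => ?_
    have hS := hmodel S θ hθ
    have hrep : (ofList c.p c.N c.cl).Rep θ (tag packBase) θ :=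
      ⟨[0, 1], by simp [untag_tag, ofDigits_cons_eq, ofDigits_nil_eq],
        by simp [ofDigits_cons_eq, ofDigits_nil_eq], hN, by
        simp only [List.mem_cons, List.not_mem_nil, or_false, forall_eq_or_imp, forall_eq]
        exact ⟨by simp only [ofList]; omega, hp2⟩⟩
    have := hS.rep_frobenius hp5 c.d hrep
    rw [Nat.eq_of_beq_eq_true hroot] at this
    rw [hE, ← hpd]
    exact hS.rep_unique this hrep
  have hP := hmodel E θ hθ
  obtain ⟨α, hα⟩ : ∃ α : E, (ofList c.p c.N c.cl).Rep θ (tag (pack c.al)) α :=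
    ⟨_, c.al, by rw [untag_tag, pack_eq_ofDigits], rfl, hal, had⟩
  obtain ⟨u, hu, -, hup⟩ := hP.rep_powers hq c.n hα
  obtain ⟨v, hv, hv1, hvp⟩ := forall₂_xPowSubOne hP hn
  obtain ⟨G, w, b, z, hG, hw, hz, hdvd, hgcd⟩ :=
    hP.euclid_sound 200 hmain hu hv hα (fun _ => by simp [hv1])
  rw [Bool.and_eq_true] at hG
  have hlen : w.length = 3 := by rw [← hw.length_eq]; exact Nat.eq_of_beq_eq_true hG.1
  have hone := hP.rep_pow (hP.rep_orderProduct hM hα rs hz) 100 _ hM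
  rw [Nat.eq_of_beq_eq_true hG.2] at hone
  have hpow := hP.rep_unique hone hP.rep_one
  have hM0 : c.q ^ c.n - 1 ≠ 0 := by
    have := Fintype.one_lt_card (α := E)
    omega
  have hne : z * (rs.map fun r => α ^ ((c.q ^ c.n - 1) / r) - 1).prod ≠ 0 := by
    intro h0
    rw [h0, zero_pow hM0] at hpow
    exact zero_ne_one hpow
  have hz0 := left_ne_zero_of_mul hne
  have hα0 : α ≠ 0 := fun h0 => hz0 (zero_dvd_iff.mp (h0 ▸ hdvd))
  refine ⟨α, ?_, ?_⟩
  · rw [IsPrimitiveElem, hE]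
    refine orderOf_eq_of_pow_and_pow_div_prime (Nat.pos_of_ne_zero hM0) ?_ ?_
    · rw [← hE]
      exact FiniteField.pow_card_sub_one_eq_one α hα0
    · intro r hr hrM h1
      obtain ⟨s, hs, hrs'⟩ := (Prime.dvd_prod_iff hr.prime).mp
        (hr.dvd_of_dvd_pow (hrM.trans hprod))
      obtain rfl := (Nat.prime_dvd_prime_iff_eq hr (hrs s hs)).mp hrs'
      refine right_ne_zero_of_mul hne (List.prod_eq_zero (List.mem_map.mpr ⟨r, hs, ?_⟩))
      rw [h1, sub_self]
  · obtain ⟨hw0, hD⟩ := hgcd hz0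
    rw [hup, hvp] at hD
    rw [IsKNormal]
    have hassoc : Associated (@EuclideanDomain.gcd E[X] _ (Classical.decEq _)
        (X ^ c.n - 1) (gPoly c.q c.n α)) (listPoly w) := by
      refine associated_of_dvd_dvd ((hD _).mp ⟨@EuclideanDomain.gcd_dvd_right _ _ (_) _ _,
        @EuclideanDomain.gcd_dvd_left _ _ (_) _ _⟩) ?_
      exact @EuclideanDomain.dvd_gcd _ _ (_) _ _ _ ((hD _).mpr dvd_rfl).2 ((hD _).mpr dvd_rfl).1
    rw [natDegree_eq_of_degree_eq (degree_eq_degree_of_associated hassoc)]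
    match w, hlen, hw0 with
    | a :: w, hlen, hw0 =>
      rw [natDegree_listPoly_cons (by simpa using hw0)]
      simpa using hlen

end PackedElement

end PackedCertificate

section SmallPairs

/-- The test that `r` has no divisor `m` with `k ≤ m` and `m ^ 2 ≤ r`. -/
def trialDivision (r : ℕ) : ℕ → ℕ → Bool
  | 0, _ => false
  | f + 1, k => cond (Nat.ble (Nat.mul k k) r)
      (cond (Nat.beq (Nat.mod r k) 0) false (force (Nat.succ k) fun k => trialDivision r f k)) true

theorem not_dvd_of_trialDivision {r f k : ℕ} (h : trialDivision r f k = true) {m : ℕ}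
    (hk : k ≤ m) (hm : m * m ≤ r) : ¬ m ∣ r := by
  induction f generalizing k with
  | zero => simp [trialDivision] at h
  | succ f ih =>
    rw [trialDivision] at h
    have h1 : Nat.ble (Nat.mul k k) r = true :=
      Nat.ble_eq_true_of_le ((Nat.mul_le_mul hk hk).trans hm)
    rw [h1, cond_true] at h
    cases h2 : Nat.beq (Nat.mod r k) 0 with
    | true => simp [h2] at h
    | false =>
      rw [h2, cond_false, force_eq] at h
      rcases hk.eq_or_lt with rfl | hk
      · have h3 : r % k ≠ 0 := Nat.ne_of_beq_eq_false h2
        exact fun hd => h3 (Nat.mod_eq_zero_of_dvd hd)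
      · exact ih h hk

theorem prime_of_trialDivision {r f : ℕ} (hr : 2 ≤ r) (h : trialDivision r f 2 = true) :
    r.Prime := by
  by_contra hp
  refine not_dvd_of_trialDivision h (Nat.minFac_prime (by omega)).two_le ?_ (Nat.minFac_dvd r)
  rw [← sq]
  exact Nat.minFac_sq_le_self (by omega) hp

/-- The primes dividing `q ^ n - 1` for some of the pairs `(q, n)` listed in
`exceptionalDegrees`. -/
def orderPrimes : List ℕ := [
  2, 3, 5, 7, 11, 13, 17, 19, 23, 29, 31, 37, 41, 43, 61, 71, 73, 79, 89, 97, 101, 109, 113, 127,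
  151, 157, 181, 191, 193, 199, 241, 257, 307, 313, 331, 337, 409, 449, 521, 523, 547, 601, 631,
  673, 683, 757, 769, 829, 911, 1063, 1093, 1117, 1181, 1201, 1321, 2251, 2411, 2731, 2801, 3221,
  3833, 4561, 4733, 5167, 5419, 6481, 7321, 8191, 9161, 11489, 13421, 14281, 18913, 19531, 22079,
  23311, 28393, 29989, 30941, 41761, 43691, 61681, 65537, 83233, 88741, 92737, 117307, 121369,
  131071, 159871, 169553, 184417, 236377, 262657, 390001, 398581, 599479, 649657, 797161, 1270657,
  1609669, 1772893, 5229043, 21523361, 42521761, 195019441, 212601841, 815702161]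

theorem prime_of_mem_orderPrimes : ∀ r ∈ orderPrimes, r.Prime := by
  have h : ∀ r ∈ orderPrimes, 2 ≤ r ∧ trialDivision r 30000 2 = true := by decide +kernel
  exact fun r hr => prime_of_trialDivision (h r hr).1 (h r hr).2

/-- A primitive `2`-normal element for each of the pairs `(q, n)` listed in
`exceptionalDegrees`. -/
def exceptionalElements : List PackedElement := [
  ⟨2, 6, 2, 6, 6, [1, 1], [0, 1, 0, 0, 0, 1]⟩,
  ⟨2, 8, 2, 8, 16, [1, 1], [0, 0, 0, 1, 0, 0, 0, 0, 0, 0, 0, 0, 1]⟩,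
  ⟨2, 9, 2, 9, 9, [1, 1], [1, 0, 1, 1]⟩,
  ⟨2, 10, 2, 10, 10, [1, 0, 0, 1], [1, 1, 0, 1]⟩,
  ⟨2, 12, 2, 12, 12, [1, 0, 0, 1], [0, 1, 0, 1, 0, 0, 1]⟩,
  ⟨2, 14, 2, 14, 14, [1, 0, 0, 0, 0, 1], [1, 0, 0, 1]⟩,
  ⟨2, 15, 2, 15, 15, [1, 1], [1, 0, 0, 1, 0, 0, 0, 0, 0, 0, 1, 0, 0, 1]⟩,
  ⟨2, 16, 2, 16, 16, [1, 1, 1, 0, 0, 0, 1], [0, 0, 1, 1]⟩,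
  ⟨2, 18, 2, 18, 18, [1, 0, 0, 1], [1, 0, 0, 1, 0, 1]⟩,
  ⟨2, 20, 2, 20, 20, [1, 0, 0, 1], [0, 0, 0, 1, 0, 0, 1]⟩,
  ⟨2, 21, 2, 21, 21, [1, 0, 1], [1, 0, 1, 1]⟩,
  ⟨2, 22, 2, 22, 22, [1, 1], [0, 0, 1]⟩,
  ⟨2, 24, 2, 24, 24, [1, 1, 1, 0, 0, 0, 0, 1], [0, 1, 0, 1, 0, 1]⟩,
  ⟨2, 26, 2, 26, 26, [1, 1, 1, 0, 0, 0, 1], [0, 0, 1]⟩,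
  ⟨2, 27, 2, 27, 27, [1, 1, 1, 0, 0, 1], [1, 0, 0, 1]⟩,
  ⟨2, 28, 2, 28, 28, [1, 1], [0, 0, 0, 1, 0, 0, 1]⟩,
  ⟨2, 30, 2, 30, 30, [1, 1], [1, 0, 1, 0, 0, 1]⟩,
  ⟨2, 32, 2, 32, 32, [1, 1, 0, 0, 1, 0, 0, 0, 0, 0, 0, 1], [0, 1, 1, 1, 0, 1]⟩,
  ⟨2, 33, 2, 33, 33, [1, 0, 0, 0, 0, 0, 0, 0, 0, 0, 1], [1, 1, 1, 0, 1]⟩,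
  ⟨2, 34, 2, 34, 34, [1, 0, 0, 0, 0, 0, 0, 1], [1, 1, 0, 1]⟩,
  ⟨2, 36, 2, 36, 36, [1, 0, 0, 0, 0, 0, 0, 0, 0, 1], [0, 0, 0, 0, 0, 0, 0, 0, 0, 1, 0, 0, 0, 0,
    0, 0, 0, 0, 1, 0, 0, 0, 0, 0, 0, 0, 1, 0, 0, 0, 0, 0, 0, 1]⟩,
  ⟨2, 39, 2, 39, 39, [1, 0, 0, 0, 1], [1, 1]⟩,
  ⟨2, 40, 2, 40, 40, [1, 1, 0, 1, 0, 0, 0, 0, 0, 1], [1, 1, 1, 1, 1]⟩,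
  ⟨2, 42, 2, 42, 42, [1, 0, 0, 0, 0, 0, 0, 1], [1, 0, 1, 1, 0, 0, 0, 1]⟩,
  ⟨2, 45, 2, 45, 45, [1, 1, 1, 0, 0, 0, 0, 0, 0, 0, 0, 0, 0, 0, 0, 0, 0, 1], [1, 0, 1, 1]⟩,
  ⟨2, 48, 2, 48, 48, [1, 1, 1, 0, 0, 0, 0, 0, 0, 0, 0, 0, 0, 0, 0, 0, 0, 1], [0, 0, 0, 1, 1, 1]⟩,
  ⟨2, 60, 2, 60, 60, [1, 1], [1, 1, 1]⟩,
  ⟨3, 6, 3, 6, 6, [1, 1], [0, 1, 1, 1]⟩,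
  ⟨3, 8, 3, 8, 8, [1, 0, 1], [1, 0, 1, 1]⟩,
  ⟨3, 9, 3, 9, 9, [1, 0, 1, 1], [0, 0, 2]⟩,
  ⟨3, 10, 3, 10, 10, [2, 0, 1], [2, 0, 0, 0, 0, 1, 2, 0, 2]⟩,
  ⟨3, 12, 3, 12, 12, [1, 0, 1], [1, 1, 1, 0, 1]⟩,
  ⟨3, 14, 3, 14, 14, [1, 1], [0, 2]⟩,
  ⟨3, 15, 3, 15, 15, [1, 0, 2], [0, 2]⟩,
  ⟨3, 16, 3, 16, 16, [1, 0, 0, 0, 1], [1, 1, 2, 0, 1]⟩,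
  ⟨3, 18, 3, 18, 18, [1, 0, 0, 0, 0, 0, 0, 1], [1, 1, 0, 1]⟩,
  ⟨3, 20, 3, 20, 20, [1, 0, 0, 0, 0, 1], [0, 0, 0, 0, 2, 1, 0, 0, 0, 0, 1]⟩,
  ⟨3, 24, 3, 24, 24, [1, 0, 0, 0, 1], [0, 0, 0, 0, 2, 0, 0, 0, 2, 2, 2]⟩,
  ⟨3, 26, 3, 26, 26, [2, 0, 1], [0, 0, 0, 0, 0, 0, 0, 1, 0, 0, 0, 0, 0, 2, 1, 0, 0, 0, 0, 0, 0,
    0, 0, 2]⟩,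
  ⟨3, 32, 3, 32, 32, [1, 0, 0, 0, 0, 1], [0, 2]⟩,
  ⟨4, 5, 2, 10, 10, [1, 0, 0, 1], [0, 1, 1, 0, 1]⟩,
  ⟨4, 6, 2, 12, 12, [1, 0, 0, 1], [1, 1, 0, 1]⟩,
  ⟨4, 8, 2, 16, 16, [1, 1, 1, 0, 0, 0, 1], [0, 1, 0, 1]⟩,
  ⟨4, 9, 2, 18, 18, [1, 0, 0, 1], [1, 1, 1, 0, 1]⟩,
  ⟨4, 10, 2, 20, 20, [1, 0, 0, 1], [1, 1]⟩,
  ⟨4, 12, 2, 24, 24, [1, 1, 1, 0, 0, 0, 0, 1], [0, 1, 1, 1, 1]⟩,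
  ⟨4, 14, 2, 28, 28, [1, 1], [0, 1, 0, 0, 1]⟩,
  ⟨4, 15, 2, 30, 30, [1, 1], [1, 1, 0, 0, 1]⟩,
  ⟨4, 18, 2, 36, 36, [1, 0, 0, 0, 0, 0, 0, 0, 0, 1], [0, 1, 1, 1, 0, 0, 1]⟩,
  ⟨4, 21, 2, 42, 42, [1, 0, 0, 0, 0, 0, 0, 1], [1, 0, 0, 1, 1]⟩,
  ⟨4, 30, 2, 60, 60, [1, 1], [0, 0, 1]⟩,
  ⟨5, 5, 5, 5, 5, [1, 1], [3, 0, 1]⟩,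
  ⟨5, 6, 5, 6, 6, [2, 2], [0, 3, 0, 0, 4]⟩,
  ⟨5, 8, 5, 8, 8, [2], [4, 1, 1, 1]⟩,
  ⟨5, 9, 5, 9, 9, [1, 2, 2], [1, 4, 2]⟩,
  ⟨5, 10, 5, 10, 10, [2, 0, 1], [0, 0, 0, 1, 4, 2]⟩,
  ⟨5, 12, 5, 12, 12, [1, 1], [2, 1]⟩,
  ⟨5, 14, 5, 14, 14, [2, 0, 1], [0, 1, 1, 1]⟩,
  ⟨5, 16, 5, 16, 16, [2], [1, 2, 0, 0, 4, 0, 0, 0, 4, 0, 0, 0, 2, 0, 4, 2]⟩,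
  ⟨5, 18, 5, 18, 18, [1, 2], [2, 2, 1]⟩,
  ⟨5, 20, 5, 20, 20, [2, 0, 0, 0, 1], [0, 0, 3, 0, 0, 0, 0, 0, 0, 0, 0, 3, 4, 0, 0, 0, 0, 2, 2]⟩,
  ⟨5, 24, 5, 24, 24, [2, 0, 0, 0, 2], [0, 0, 0, 0, 0, 0, 0, 0, 0, 4, 0, 0, 3, 0, 0, 0, 0, 0, 4,
    1]⟩,
  ⟨7, 6, 7, 6, 6, [3], [1, 0, 2, 3, 3]⟩,
  ⟨7, 7, 7, 7, 7, [1, 1], [3, 0, 0, 3, 3]⟩,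
  ⟨7, 8, 7, 8, 8, [1, 1], [0, 3, 1]⟩,
  ⟨7, 9, 7, 9, 9, [2], [5, 1, 1]⟩,
  ⟨7, 10, 7, 10, 10, [1, 2], [0, 0, 5, 0, 3, 0, 4, 2]⟩,
  ⟨7, 12, 7, 12, 12, [2, 0, 0, 2], [0, 0, 5, 0, 0, 3, 2, 2]⟩,
  ⟨7, 15, 7, 15, 15, [2, 0, 0, 2], [0, 0, 0, 0, 0, 0, 0, 0, 5, 4, 2]⟩,
  ⟨7, 16, 7, 16, 16, [1, 2], [2, 1]⟩,
  ⟨7, 18, 7, 18, 18, [3], [2, 0, 3, 3, 0, 0, 6, 5, 0, 3, 5, 5]⟩,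
  ⟨7, 24, 7, 24, 24, [2, 0, 0, 2], [0, 0, 2, 0, 0, 0, 0, 0, 0, 0, 0, 0, 0, 0, 0, 0, 5, 0, 0, 0,
    2, 2]⟩,
  ⟨8, 6, 2, 18, 18, [1, 0, 0, 1], [0, 1, 0, 0, 0, 1]⟩,
  ⟨8, 7, 2, 21, 21, [1, 0, 1], [0, 1, 1]⟩,
  ⟨8, 8, 2, 24, 24, [1, 1, 1, 0, 0, 0, 0, 1], [1, 1, 1, 0, 0, 0, 1, 1]⟩,
  ⟨8, 9, 2, 27, 27, [1, 1, 1, 0, 0, 1], [1, 1]⟩,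
  ⟨8, 10, 2, 30, 30, [1, 1], [0, 1, 0, 0, 1, 0, 1]⟩,
  ⟨8, 12, 2, 36, 36, [1, 0, 0, 0, 0, 0, 0, 0, 0, 1], [0, 0, 1, 1, 0, 0, 0, 1]⟩,
  ⟨8, 14, 2, 42, 42, [1, 0, 0, 0, 0, 0, 0, 1], [0, 1, 1, 1, 1, 1, 1]⟩,
  ⟨8, 21, 2, 63, 63, [1, 1], [1, 1, 0, 1]⟩,
  ⟨9, 5, 3, 10, 10, [2, 0, 1], [0, 1, 0, 0, 0, 1, 1]⟩,
  ⟨9, 6, 3, 12, 12, [1, 0, 1], [1, 0, 0, 0, 0, 1]⟩,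
  ⟨9, 8, 3, 16, 16, [1, 0, 0, 0, 1], [0, 1, 1, 1]⟩,
  ⟨9, 9, 3, 18, 18, [1, 0, 0, 0, 0, 0, 0, 1], [0, 2, 0, 0, 0, 2, 2]⟩,
  ⟨9, 10, 3, 20, 20, [1, 0, 0, 0, 0, 1], [0, 1, 1, 1]⟩,
  ⟨9, 12, 3, 24, 24, [1, 0, 0, 0, 1], [1, 2, 1, 0, 0, 0, 0, 1]⟩,
  ⟨9, 16, 3, 32, 32, [1, 0, 0, 0, 0, 1], [2, 1, 0, 1]⟩,
  ⟨9, 20, 3, 40, 40, [1, 1], [2, 1, 2, 0, 1]⟩,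
  ⟨11, 5, 11, 5, 5, [2], [1, 1, 1]⟩,
  ⟨11, 6, 11, 6, 6, [1, 1], [0, 0, 3, 8]⟩,
  ⟨11, 8, 11, 8, 8, [2, 2], [0, 0, 0, 5, 0, 0, 0, 6]⟩,
  ⟨11, 9, 11, 9, 9, [1, 4], [1, 6, 6, 4, 0, 3]⟩,
  ⟨11, 10, 11, 10, 10, [2], [3, 8, 10, 7, 5, 4, 7, 7]⟩,
  ⟨11, 12, 11, 12, 12, [1, 2], [0, 0, 0, 2, 0, 6]⟩,
  ⟨11, 15, 11, 15, 15, [1, 1], [4, 1, 1]⟩,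
  ⟨11, 20, 11, 20, 20, [2, 0, 0, 0, 0, 2], [0, 0, 0, 8, 2, 6, 1, 9]⟩,
  ⟨13, 6, 13, 6, 6, [2], [11, 6, 0, 4, 3]⟩,
  ⟨13, 7, 13, 7, 7, [1, 3], [1, 2, 6]⟩,
  ⟨13, 8, 13, 8, 8, [2], [1, 0, 0, 6, 0, 9, 7]⟩,
  ⟨13, 9, 13, 9, 9, [2], [8, 1, 1]⟩,
  ⟨13, 10, 13, 10, 10, [2, 0, 6], [0, 4, 2, 0, 6, 7]⟩,
  ⟨13, 12, 13, 12, 12, [2], [8, 0, 1, 10, 0, 5, 7, 5, 10, 1, 1, 5]⟩,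
  ⟨13, 14, 13, 14, 14, [2, 4], [8, 0, 0, 0, 0, 0, 0, 10, 0, 0, 7]⟩,
  ⟨13, 24, 13, 24, 24, [2], [2, 0, 5, 0, 10, 0, 3, 1, 8, 10, 2, 6, 1, 12, 3, 9, 8, 8, 10]⟩,
  ⟨16, 5, 2, 20, 20, [1, 0, 0, 1], [1, 1, 0, 0, 0, 0, 0, 1]⟩,
  ⟨16, 6, 2, 24, 24, [1, 1, 1, 0, 0, 0, 0, 1], [0, 1, 1, 0, 1, 1]⟩,
  ⟨16, 8, 2, 32, 32, [1, 1, 0, 0, 1, 0, 0, 0, 0, 0, 0, 1], [0, 0, 0, 0, 1, 0, 0, 0, 0, 0, 0, 1,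
    0, 0, 1]⟩,
  ⟨16, 9, 2, 36, 36, [1, 0, 0, 0, 0, 0, 0, 0, 0, 1], [1, 1, 1]⟩,
  ⟨16, 10, 2, 40, 40, [1, 1, 0, 1, 0, 0, 0, 0, 0, 1], [0, 1, 0, 1]⟩,
  ⟨16, 15, 2, 60, 60, [1, 1], [0, 1, 1, 1, 1]⟩,
  ⟨17, 6, 17, 6, 6, [1, 2], [0, 13, 1]⟩,
  ⟨17, 8, 17, 8, 8, [3], [9, 16, 7, 13, 8, 0, 0, 6]⟩,
  ⟨17, 9, 17, 9, 9, [1, 1], [6, 0, 0, 4, 14, 0, 16]⟩,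
  ⟨17, 10, 17, 10, 10, [1, 1], [0, 0, 0, 3, 4, 0, 12]⟩,
  ⟨17, 12, 17, 12, 12, [2, 2], [0, 0, 0, 0, 0, 0, 0, 0, 0, 11, 3]⟩,
  ⟨17, 16, 17, 16, 16, [3], [8, 13, 13, 4, 2, 6, 12, 15, 11, 6, 6, 0, 14, 1, 13]⟩,
  ⟨19, 5, 19, 5, 5, [1, 3], [14, 0, 8, 6]⟩,
  ⟨19, 6, 19, 6, 6, [2], [0, 14, 10, 0, 15, 1]⟩,
  ⟨19, 8, 19, 8, 8, [1, 3], [0, 2, 0, 3]⟩,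
  ⟨19, 9, 19, 9, 9, [2], [8, 18, 0, 11, 2, 3, 4, 1]⟩,
  ⟨19, 10, 19, 10, 10, [2, 4], [0, 0, 0, 0, 0, 4, 0, 9, 18]⟩,
  ⟨19, 12, 19, 12, 12, [4, 1], [0, 0, 0, 1, 0, 1, 16]⟩,
  ⟨19, 18, 19, 18, 18, [2], [7, 14, 1, 12, 15, 6, 7, 0, 0, 2, 17, 4, 16, 12, 13, 9, 13, 11]⟩]

/-- The primes dividing `q ^ n - 1` among the `orderPrimes`. -/
def PackedElement.primes (c : PackedElement) : List ℕ :=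
  orderPrimes.filter fun r => Nat.beq (Nat.mod (c.q ^ c.n - 1) r) 0

theorem certify_of_mem_exceptionalElements :
    ∀ c ∈ exceptionalElements, c.certify c.primes = true := by
  have h : ∀ c ∈ exceptionalElements, forceList c.primes (fun rs => c.certify rs) = true := by
    decide +kernel
  simpa only [forceList_eq] using h

theorem exists_mem_exceptionalElements :
    ∀ q ∈ [2, 3, 4, 5, 7, 8, 9, 11, 13, 16, 17, 19], ∀ n ∈ exceptionalDegrees q,
      ∃ c ∈ exceptionalElements, c.q = q ∧ c.n = n := by
  decide +kernel

theorem exists_primitive_isKNormal_of_exceptional {q n : ℕ}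
    (hq : q ∈ ({2, 3, 4, 5, 7, 8, 9, 11, 13, 16, 17, 19} : Set ℕ))
    (hn : n ∈ exceptionalDegrees q) {E : Type*} [Field E] [Fintype E]
    (hE : Fintype.card E = q ^ n) : ∃ α : E, IsPrimitiveElem α ∧ IsKNormal q n 2 α := by
  obtain ⟨c, hc, rfl, rfl⟩ := exists_mem_exceptionalElements q (by simpa using hq) n hn
  exact PackedElement.exists_of_certify (certify_of_mem_exceptionalElements c hc)
    (fun r hr => prime_of_mem_orderPrimes r (List.mem_of_mem_filter hr)) hE

end SmallPairs

/-- For `q ∈ {2,3,4,5,7,8,9,11,13,16,17,19}` and `n ≥ 5`, there exists a primitive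
`2`-normal element in `F_{q^n}` over `F_q` if and only if `gcd(q^3 - q, n) ≠ 1`. -/
theorem primitive_two_normal_small_q (q n : ℕ)
    (hq : q ∈ ({2, 3, 4, 5, 7, 8, 9, 11, 13, 16, 17, 19} : Set ℕ)) (hn : 5 ≤ n)
    (E : Type*) [Field E] [Fintype E] (hE : Fintype.card E = q ^ n) :
    (∃ α : E, IsPrimitiveElem α ∧ IsKNormal q n 2 α) ↔ Nat.gcd (q ^ 3 - q) n ≠ 1 := by
  constructor
  · rintro ⟨α, -, hα⟩
    have hpow : IsPrimePow q := by
      rw [← isPrimePow_pow_iff (show n ≠ 0 by omega), ← hE]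
      exact Fintype.isPrimePow_card_of_field
    obtain ⟨K, _, _, _, hK, hd⟩ := exists_subfield_card_eq hpow hE
    rw [← hK, ← hd] at hα
    obtain ⟨P, -, hdvd, hP⟩ := exists_natDegree_eq_of_isKNormal hα
    rw [hd] at hdvd
    exact gcd_ne_one_of_natDegree_two_dvd hK (by omega) hP hdvd
  · intro hgcd
    by_cases hex : n ∈ exceptionalDegrees q
    · exact exists_primitive_isKNormal_of_exceptional hq hex hE
    · exact exists_primitive_isKNormal_of_not_exceptional hq hn hE hgcd hex

end
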